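/- Regularity is preserved and reflected by tensor: for alien positive behaviours A and B both distinct from 0, the behaviours A and B are both regular if and only if A ⊗ B is regular. -/

import Mathlib

namespace Ludics

abbrev Address := List ℕ

/-- An action of Ludics: the daimon, or a proper action given by a polarity
(`true` = positive), a focus address and a ramification. -/
inductive Action where
  | daimon : Action
  | proper (pos : Bool) (focus : Address) (ram : Finset ℕ) : Action
deriving DecidableEq

namespace Action

def isPositive : Action → Bool
  | daimon => true
  | proper pos _ _ => pos

def focus? : Action → Option Address
  | daimon => none
  | proper _ ξ _ => some ξ

/-- Reverse the polarity of an action. -/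
def dual : Action → Action
  | daimon => daimon
  | proper pos ξ I => proper (!pos) ξ I

/-- `a.justifiesB b` : the focus of `b` is one of the addresses created by `a`. -/
def justifiesB : Action → Action → Bool
  | proper _ ξ I, proper _ ζ _ => decide (∃ i ∈ I, ζ = ξ ++ [i])
  | _, _ => false

def justifies (a b : Action) : Prop := a.justifiesB b = true

end Action

/-- A sequent of a base: an optional left address (at most one) and a finite
set of right addresses. -/
structure Sequent where
  left : Option Address
  right : Finset Address

abbrev Base := List Sequent

def Base.isPositive (β : Base) : Prop := ∃ σ ∈ β, σ.left = none

/-- An action is initial w.r.t. a base if its focus belongs to the base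
(on the side corresponding to its polarity). -/
def Initial (β : Base) (a : Action) : Prop :=
  ∃ pol ξ I, a = .proper pol ξ I ∧
    ∃ σ ∈ β, (pol = true ∧ ξ ∈ σ.right) ∨ (pol = false ∧ σ.left = some ξ)

/-- A sequent "owns" an action when its focus is hereditarily justified by an
address of the sequent (i.e. extends an address of the sequent). -/
def Sequent.owns (σ : Sequent) (a : Action) : Prop :=
  ∃ ξ, a.focus? = some ξ ∧
    ((∃ γ, σ.left = some γ ∧ γ <+: ξ) ∨ (∃ δ ∈ σ.right, δ <+: ξ))

def Sequent.addresses (σ : Sequent) : Set Address :=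
  (match σ.left with | some γ => {γ} | none => ∅) ∪ ↑σ.right

def Base.addresses (β : Base) : Set Address :=
  {a | ∃ σ ∈ β, a ∈ σ.addresses}

/-- The dual base: each sequent `Γ ⊢ Δ` gives sequents `⊢ Γ` and `δ ⊢` for δ ∈ Δ. -/
noncomputable def Sequent.dualSequents (σ : Sequent) : List Sequent :=
  (match σ.left with
    | some γ => [⟨none, ({γ} : Finset Address)⟩]
    | none => []) ++
    σ.right.toList.map fun δ => ⟨some δ, (∅ : Finset Address)⟩

noncomputable def Base.dual (β : Base) : Base := (β.map Sequent.dualSequents).flatten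

/-- View of a sequence, computed on the reversed sequence (most recent action
first), with fuel. -/
def viewRevAux : ℕ → List Action → List Action
  | 0, _ => []
  | _ + 1, [] => []
  | n + 1, a :: w =>
    if a.isPositive then a :: viewRevAux n w
    else a :: viewRevAux n (w.dropWhile fun b => !(b.justifiesB a))

def viewRev (s : List Action) : List Action := viewRevAux s.length s

/-- The view `⌜s⌝` of a sequence of actions. -/
def view (s : List Action) : List Action := (viewRev s.reverse).reverse

/-- `p` is a path based on `β`. -/
structure IsPath (β : Base) (p : List Action) : Prop where
  alternating : p.Chain' fun a b => a.isPositive ≠ b.isPositive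
  justified : ∀ w a, w ++ [a] <+: p → a ≠ Action.daimon →
    Initial β a ∨ ∃ b ∈ w, b.justifies a
  negJump : ∀ w a b, w ++ [a] <+: p → a.isPositive = true → b ∈ w →
    b.justifies a → b ∈ view w
  posJump : ∀ w a, w ++ [a] <+: p → a.isPositive = true → a ≠ Action.daimon →
    ∀ σ ∈ β, (∃ f, a.focus? = some f ∧ f ∈ σ.right) →
      (w = [] ∧ σ.left = none) ∨
      ∃ w' b, w = w' ++ [b] ∧ b.isPositive = false ∧ σ.owns b
  linearity : (p.filterMap Action.focus?).Nodup
  daimonLast : ∀ w, w ++ [Action.daimon] <+: p → w ++ [Action.daimon] = p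
  daimonFirst : p.head? = some Action.daimon → β.isPositive
  totality : β.isPositive → ∃ a t, p = a :: t ∧
    (a = Action.daimon ∨ (a.isPositive = true ∧ Initial β a))

/-- A chronicle: a non-empty path where each non-initial negative action is
justified by the immediately preceding action. -/
def IsChronicle (β : Base) (c : List Action) : Prop :=
  IsPath β c ∧ c ≠ [] ∧
    ∀ w a b, w ++ [a, b] <+: c → b.isPositive = false →
      Initial β b ∨ a.justifies b

/-- The dual of a positive-ended sequence: reverse all polarities, removing a
final daimon if present and appending one otherwise. -/
def dualSeq (p : List Action) : List Action :=
  if p.getLast? = some Action.daimon then p.dropLast.map Action.dual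
  else p.map Action.dual ++ [Action.daimon]

/-- Positive-ended (possibly empty) sequence. -/
def PosEnded (p : List Action) : Prop :=
  p = [] ∨ ∃ a, p.getLast? = some a ∧ a.isPositive = true

/-- A (non-empty) negative-starting, positive-ended block. -/
def NegBlock (b : List Action) : Prop :=
  b ≠ [] ∧ (∀ a, b.head? = some a → a.isPositive = false) ∧
    ∀ a, b.getLast? = some a → a.isPositive = true

def EndsWithDaimon (p : List Action) : Prop := p.getLast? = some Action.daimon

/-- Basic shuffle of two positive-ended negative paths: interleaving by
positive-ended negative blocks; if the last `p`-block ends with the daimon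
then the last `q`-block is empty. -/
def ShuffleNeg (p q r : List Action) : Prop :=
  ∃ ps qs : List (List Action),
    ps.length = qs.length ∧
    (∀ b ∈ ps, b = [] ∨ NegBlock b) ∧
    (∀ b ∈ qs, b = [] ∨ NegBlock b) ∧
    ps.flatten = p ∧ qs.flatten = q ∧
    (List.zipWith (· ++ ·) ps qs).flatten = r ∧
    (EndsWithDaimon (ps.getLast?.getD []) → qs.getLast?.getD [] = [])

/-- The shuffle `r ∈ p ⧢ q`, including the extensions to two daimon-ended
paths and to paths with a common positive-ended prefix. -/
inductive Shuffle : List Action → List Action → List Action → Prop where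
  | base {p q r} : ShuffleNeg p q r → Shuffle p q r
  | daiLeft {p q r} {κ₁ κ₂ : Action} :
      Shuffle (p ++ [κ₁, Action.daimon]) q r →
      Shuffle (p ++ [κ₁, Action.daimon]) (q ++ [κ₂, Action.daimon]) r
  | daiRight {p q r} {κ₁ κ₂ : Action} :
      Shuffle p (q ++ [κ₂, Action.daimon]) r →
      Shuffle (p ++ [κ₁, Action.daimon]) (q ++ [κ₂, Action.daimon]) r
  | pre {s p q r} : s ≠ [] → PosEnded s → Shuffle p q r →
      Shuffle (s ++ p) (s ++ q) (s ++ r)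

/-- Shuffle closure of a set of (positive-ended) paths. -/
inductive ShuffleClosure (P : Set (List Action)) : List Action → Prop where
  | mem {p} : p ∈ P → ShuffleClosure P p
  | shuffle {p q r} : ShuffleClosure P p → ShuffleClosure P q →
      Shuffle p q r → ShuffleClosure P r

/-- Coherence of chronicles: comparability and propagation. -/
def Coherent (c₁ c₂ : List Action) : Prop :=
  (∀ w κ₁ κ₂, w ++ [κ₁] <+: c₁ → w ++ [κ₂] <+: c₂ →
      κ₁ = κ₂ ∨ (κ₁.isPositive = false ∧ κ₂.isPositive = false)) ∧
  (∀ w ξ₁ I₁ w₁ σ₁ ξ₂ I₂ w₂ σ₂,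
      w ++ Action.proper false ξ₁ I₁ :: w₁ ++ [σ₁] <+: c₁ →
      w ++ Action.proper false ξ₂ I₂ :: w₂ ++ [σ₂] <+: c₂ →
      ξ₁ ≠ ξ₂ → ∀ f, σ₁.focus? = some f → σ₂.focus? ≠ some f)

/-- A design, as a prefix-closed clique of chronicles. -/
structure IsDesign (β : Base) (D : Set (List Action)) : Prop where
  chron : ∀ c ∈ D, IsChronicle β c
  prefixClosed : ∀ c ∈ D, ∀ d, d <+: c → d ≠ [] → d ∈ D
  coherent : ∀ c ∈ D, ∀ d ∈ D, Coherent c d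
  maxPos : ∀ c ∈ D, (∀ κ, c ++ [κ] ∉ D) →
    ∃ a, c.getLast? = some a ∧ a.isPositive = true
  posNonempty : β.isPositive → D.Nonempty

/-- A net of designs, abusively seen as its set of chronicles. -/
structure IsNet (β : Base) (R : Set (List Action)) : Prop where
  chron : ∀ c ∈ R, IsChronicle β c
  prefixClosed : ∀ c ∈ R, ∀ d, d <+: c → d ≠ [] → d ∈ R

/-- `p` is a path of the design/net `D`: each view of each non-empty prefix of
`p` is a chronicle of `D`. -/
def PathOf (β : Base) (D : Set (List Action)) (p : List Action) : Prop :=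
  IsPath β p ∧ ∀ q, q <+: p → q ≠ [] → view q ∈ D

/-- Whose turn it is in normalization: `dpos` says whether the design `D` owns
the first (positive) move; afterwards `D` moves exactly after negative actions. -/
def TurnD (dpos : Prop) (s : List Action) : Prop :=
  match s.getLast? with
  | none => dpos
  | some a => a.isPositive = false

/-- Interaction (normalization) between a design `D` and a counter-net `R`,
described by its visited sequence `s` (seen from `D`): it converges from
state `s` if the design to move plays the daimon, or it plays a proper
positive action accepted (in dual form) by the other one, and the interaction
converges from the extended state. -/
inductive Conv (D R : Set (List Action)) (dpos : Prop) : List Action → Prop where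
  | daiD {s} : TurnD dpos s → view (s ++ [Action.daimon]) ∈ D → Conv D R dpos s
  | daiR {s} : ¬ TurnD dpos s →
      view (s.map Action.dual ++ [Action.daimon]) ∈ R → Conv D R dpos s
  | stepD {s κ} : TurnD dpos s → κ.isPositive = true → κ ≠ Action.daimon →
      view (s ++ [κ]) ∈ D → view ((s ++ [κ]).map Action.dual) ∈ R →
      Conv D R dpos (s ++ [κ]) → Conv D R dpos s
  | stepR {s κ} : ¬ TurnD dpos s → κ.isPositive = false →
      view ((s ++ [κ]).map Action.dual) ∈ R → view (s ++ [κ]) ∈ D →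
      Conv D R dpos (s ++ [κ]) → Conv D R dpos s

/-- The simple base `⊢ ξ` (positive) or `ξ ⊢` (negative). -/
def simpleBase (ξ : Address) (pos : Bool) : Base :=
  if pos then [⟨none, {ξ}⟩] else [⟨some ξ, ∅⟩]

/-- The orthogonal of a set of designs on a simple base. -/
def orthSet (ξ : Address) (pos : Bool) (A : Set (Set (List Action))) :
    Set (Set (List Action)) :=
  {E | IsDesign (simpleBase ξ !pos) E ∧
    ∀ D ∈ A, if pos then Conv D E True [] else Conv E D True []}

def biorth (ξ : Address) (pos : Bool) (A : Set (Set (List Action))) :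
    Set (Set (List Action)) :=
  orthSet ξ (!pos) (orthSet ξ pos A)

/-- A behaviour: a bi-orthogonally closed set of designs on a simple base. -/
structure Behaviour (ξ : Address) (pos : Bool) where
  designs : Set (Set (List Action))
  isDesign : ∀ D ∈ designs, IsDesign (simpleBase ξ pos) D
  closed : designs = biorth ξ pos designs

/-- Visitable paths of a set of designs: traces of convergent normalizations
with the orthogonal, characterized as the dual pairs of paths. -/
def VisitableSet (ξ : Address) (pos : Bool) (S : Set (Set (List Action)))
    (p : List Action) : Prop :=
  ∃ D ∈ S, ∃ E ∈ orthSet ξ pos S,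
    PathOf (simpleBase ξ pos) D p ∧ PathOf (simpleBase ξ !pos) E (dualSeq p)

def Visitable {ξ : Address} {pos : Bool} (A : Behaviour ξ pos)
    (p : List Action) : Prop :=
  VisitableSet ξ pos A.designs p

/-- Material (incarnated) design of a behaviour: inclusion-minimal. -/
def Material {ξ : Address} {pos : Bool} (A : Behaviour ξ pos)
    (D : Set (List Action)) : Prop :=
  D ∈ A.designs ∧ ∀ E ∈ A.designs, E ⊆ D → E = D

/-- Completion of a design: add daimon-ended chronicles after every missing
negative action. -/
def completion (β : Base) (D : Set (List Action)) : Set (List Action) :=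
  D ∪ {c' | ∃ c ∈ D, ∃ ξ I,
    (c' = c ++ [Action.proper false ξ I] ∨
      c' = c ++ [Action.proper false ξ I, Action.daimon]) ∧
    IsChronicle β (c ++ [Action.proper false ξ I, Action.daimon]) ∧
    c ++ [Action.proper false ξ I] ∉ D}

def DaiDesign : Set (List Action) := {[Action.daimon]}

def firstAction (D : Set (List Action)) (κ : Action) : Prop :=
  ∃ c ∈ D, c.head? = some κ

/-- Directory of a set of positive designs on `⊢ ξ`. -/
def directory (ξ : Address) (A : Set (Set (List Action))) : Set (Finset ℕ) :=
  {I | ∃ D ∈ A, firstAction D (Action.proper true ξ I)}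

/-- Alien positive behaviours: ramifications of first actions pairwise disjoint. -/
def Alien (ξ : Address) (A B : Behaviour ξ true) : Prop :=
  ∀ I ∈ directory ξ A.designs, ∀ J ∈ directory ξ B.designs, Disjoint I J

/-- Extension of the first action of a design by a set `J`. -/
def extDesign (ξ : Address) (J : Finset ℕ) (D : Set (List Action)) :
    Set (List Action) :=
  {c | ∃ I t, (Action.proper true ξ I :: t) ∈ D ∧
      c = Action.proper true ξ (I ∪ J) :: t}

/-- The extension `A_[B]` of a set of designs along another. -/
def extended (ξ : Address) (A B : Set (Set (List Action))) :
    Set (Set (List Action)) :=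
  insert DaiDesign
    {D' | ∃ D ∈ A, (∃ I, firstAction D (Action.proper true ξ I)) ∧
      ∃ E ∈ B, ∃ J, firstAction E (Action.proper true ξ J) ∧
        D' = extDesign ξ J D}

/-- The extension `P_[Q]` of a set of paths along another. -/
def extPaths (ξ : Address) (P Q : Set (List Action)) : Set (List Action) :=
  insert [Action.daimon]
    {p | ∃ I t, (Action.proper true ξ I :: t) ∈ P ∧
      ∃ q ∈ Q, ∃ J, q.head? = some (Action.proper true ξ J) ∧
        p = Action.proper true ξ (I ∪ J) :: t}

/-- Prefixing a (negative) design by the positive action `(+, ξ, {i})`. -/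
def shiftD (ξ : Address) (i : ℕ) (D : Set (List Action)) : Set (List Action) :=
  insert [Action.proper true ξ {i}]
    {c | ∃ d ∈ D, c = Action.proper true ξ {i} :: d}

/-- `C = ↑N` : the positive shift of the negative behaviour `N`. -/
def IsShiftOf (ξ : Address) (i : ℕ) (C : Behaviour ξ true)
    (N : Behaviour (ξ ++ [i]) false) : Prop :=
  C.designs = biorth ξ true (shiftD ξ i '' N.designs)

/-- `C = ⊕ₖ F k`. -/
def IsSumOf {ξ : Address} {ι : Type} (C : Behaviour ξ true)
    (F : ι → Behaviour ξ true) : Prop :=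
  C.designs = biorth ξ true (⋃ k, (F k).designs)

/-- Pairwise disjoint family of positive behaviours (disjoint directories). -/
def PairwiseDisjointFam {ξ : Address} {ι : Type}
    (F : ι → Behaviour ξ true) : Prop :=
  ∀ k l, k ≠ l → ∀ I ∈ directory ξ (F k).designs,
    I ∉ directory ξ (F l).designs

open Classical in
/-- Tensor of two positive designs on `⊢ ξ`. -/
noncomputable def tensorD (ξ : Address) (D E : Set (List Action)) :
    Set (List Action) :=
  if D = DaiDesign ∨ E = DaiDesign then DaiDesign
  else {c | ∃ I J, firstAction D (Action.proper true ξ I) ∧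
      firstAction E (Action.proper true ξ J) ∧
      ∃ t, ((Action.proper true ξ I :: t) ∈ D ∨
            (Action.proper true ξ J :: t) ∈ E) ∧
        c = Action.proper true ξ (I ∪ J) :: t}

/-- `C = A ⊗ B`. -/
def IsTensorOf {ξ : Address} (C A B : Behaviour ξ true) : Prop :=
  C.designs = biorth ξ true
    {G | ∃ D ∈ A.designs, ∃ E ∈ B.designs, G = tensorD ξ D E}

/-- Hereditary chains of justifiers inside a sequence `p`. -/
inductive JustChain (β : Base) (p : List Action) : List Action → Prop where
  | init {κ} : κ ∈ p → Initial β κ → JustChain β p [κ]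
  | cons {s κ κ'} : JustChain β p (s ++ [κ]) → κ' ∈ p → κ.justifies κ' →
      JustChain β p (s ++ [κ, κ'])

/-- Trivial chronicle for a behaviour: hereditary-justifier sequence of an
action of a chronicle of a material design. -/
def TrivialChronicle {ξ : Address} {pos : Bool} (A : Behaviour ξ pos)
    (s : List Action) : Prop :=
  ∃ D, Material A D ∧ ∃ c ∈ D, JustChain (simpleBase ξ pos) c s

/-- Regular path for a behaviour: reversible path whose justifier chains are
trivial chronicles for the behaviour. -/
def RegularPath {ξ : Address} {pos : Bool} (A : Behaviour ξ pos)
    (p : List Action) : Prop :=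
  IsPath (simpleBase ξ pos) p ∧ IsPath (simpleBase ξ !pos) (dualSeq p) ∧
  ∀ κ ∈ p, κ ≠ Action.daimon →
    ∃ s, JustChain (simpleBase ξ pos) p s ∧ s.getLast? = some κ ∧
      TrivialChronicle A s

/-- Regular behaviour: every regular path is visitable. -/
def Regular {ξ : Address} {pos : Bool} (A : Behaviour ξ pos) : Prop :=
  ∀ p, RegularPath A p → Visitable A p

/-- Proper actions occurring in a design. -/
def properActs (D : Set (List Action)) : Set Action :=
  {a | a ≠ Action.daimon ∧ ∃ c ∈ D, a ∈ c}

/-- Essentially finite behaviour: finitely many material designs, all finite. -/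
def EssFinite {ξ : Address} {pos : Bool} (A : Behaviour ξ pos) : Prop :=
  {D | Material A D}.Finite ∧ ∀ D, Material A D → (properActs D).Finite

/-- A slice of a design. -/
def IsSlice (D S : Set (List Action)) : Prop :=
  S ⊆ D ∧ (∀ c ∈ S, ∀ d, d <+: c → d ≠ [] → d ∈ S) ∧
  ∀ w ξ I₁ I₂, w ++ [Action.proper false ξ I₁] ∈ S →
    w ++ [Action.proper false ξ I₂] ∈ S → I₁ = I₂

/-- Uniformly bounded behaviour: slice sizes of material designs uniformly
bounded. -/
def UnifBounded {ξ : Address} {pos : Bool} (A : Behaviour ξ pos) : Prop :=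
  ∃ N : ℕ, ∀ D, Material A D → ∀ S, IsSlice D S →
    (properActs S).Finite ∧ (properActs S).ncard < N

def oneDesign (ξ : Address) : Set (List Action) :=
  {[Action.proper true ξ ∅]}

mutual
  /-- The class `C∞⁺` of positive behaviours: `0`, `1`, or a (possibly
  infinite) nonempty sum of finite tensors of shifts of `C∞⁻` elements. -/
  inductive CInf : (ξ : Address) → Behaviour ξ true → Prop where
    | zero {ξ} (A : Behaviour ξ true) :
        A.designs = {DaiDesign} → CInf ξ A
    | one {ξ} (A : Behaviour ξ true) :
        A.designs = biorth ξ true {oneDesign ξ} → CInf ξ A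
    | sum {ξ} {ι : Type} (F : ι → Behaviour ξ true) (C : Behaviour ξ true) :
        Nonempty ι → (∀ k, CInfTS ξ (F k)) → PairwiseDisjointFam F →
        IsSumOf C F → CInf ξ C
  /-- Finite tensors of positive shifts of duals of `C∞⁺` elements. -/
  inductive CInfTS : (ξ : Address) → Behaviour ξ true → Prop where
    | shift {ξ} {i : ℕ} (C : Behaviour ξ true) (N : Behaviour (ξ ++ [i]) false)
        (P : Behaviour (ξ ++ [i]) true) :
        CInf (ξ ++ [i]) P → N.designs = orthSet (ξ ++ [i]) true P.designs →
        IsShiftOf ξ i C N → CInfTS ξ C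
    | tensor {ξ} (A B C : Behaviour ξ true) :
        CInfTS ξ A → CInfTS ξ B → Alien ξ A B → IsTensorOf C A B →
        CInfTS ξ C
end

mutual
  /-- The class `C_f⁺`: as `C∞⁺` but with finite sums only. -/
  inductive CFin : (ξ : Address) → Behaviour ξ true → Prop where
    | zero {ξ} (A : Behaviour ξ true) :
        A.designs = {DaiDesign} → CFin ξ A
    | one {ξ} (A : Behaviour ξ true) :
        A.designs = biorth ξ true {oneDesign ξ} → CFin ξ A
    | sum {ξ} {ι : Type} (F : ι → Behaviour ξ true) (C : Behaviour ξ true) :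
        Nonempty ι → Finite ι → (∀ k, CFinTS ξ (F k)) → PairwiseDisjointFam F →
        IsSumOf C F → CFin ξ C
  inductive CFinTS : (ξ : Address) → Behaviour ξ true → Prop where
    | shift {ξ} {i : ℕ} (C : Behaviour ξ true) (N : Behaviour (ξ ++ [i]) false)
        (P : Behaviour (ξ ++ [i]) true) :
        CFin (ξ ++ [i]) P → N.designs = orthSet (ξ ++ [i]) true P.designs →
        IsShiftOf ξ i C N → CFinTS ξ C
    | tensor {ξ} (A B C : Behaviour ξ true) :
        CFinTS ξ A → CFinTS ξ B → Alien ξ A B → IsTensorOf C A B →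
        CFinTS ξ C
end

/-- The class `C∞⁻` : duals of `C∞⁺` elements. -/
def CInfN (ξ : Address) (B : Behaviour ξ false) : Prop :=
  ∃ A : Behaviour ξ true, CInf ξ A ∧ B.designs = orthSet ξ true A.designs

def CFinN (ξ : Address) (B : Behaviour ξ false) : Prop :=
  ∃ A : Behaviour ξ true, CFin ξ A ∧ B.designs = orthSet ξ true A.designs

section Part1
open Action
theorem dual_dual (a : Action) : a.dual.dual = a := by cases a <;> simp [dual]
theorem map_dual_dual (s : List Action) : (s.map dual).map dual = s := by
  induction s with
  | nil => rfl
  | cons a t ih => simp only [List.map_cons, dual_dual, ih]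
theorem jB_dual (a b : Action) : a.dual.justifiesB b.dual = a.justifiesB b := by
  cases a <;> cases b <;> simp [dual, justifiesB]
theorem focus_dual (a : Action) : a.dual.focus? = a.focus? := by
  cases a <;> rfl
theorem pol_dual {a : Action} (h : a ≠ daimon) : a.dual.isPositive = !a.isPositive := by
  cases a with
  | daimon => exact absurd rfl h
  | proper => rfl
theorem dual_ne_dai {a : Action} (h : a ≠ daimon) : a.dual ≠ daimon := by
  cases a with
  | daimon => exact absurd rfl h
  | proper => simp [dual]
theorem dual_eq_dai {a : Action} : a.dual = daimon ↔ a = daimon := by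
  cases a <;> simp [dual]
theorem dai_mem_map_dual {s : List Action} : daimon ∈ s.map dual ↔ daimon ∈ s := by
  simp [List.mem_map, dual_eq_dai]
theorem neg_ne_dai {a : Action} (h : a.isPositive = false) : a ≠ daimon := by
  rintro rfl; simp [isPositive] at h
theorem justifies_dual {a b : Action} : a.dual.justifies b.dual ↔ a.justifies b := by
  simp [justifies, jB_dual]
theorem justifies_iff {a b : Action} : a.justifies b ↔
    ∃ p f L q i M, a = proper p f L ∧ i ∈ L ∧ b = proper q (f ++ [i]) M := by
  cases a with
  | daimon => simp [justifies, justifiesB]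
  | proper p f L =>
    cases b with
    | daimon => simp [justifies, justifiesB]
    | proper q g M =>
      simp only [justifies, justifiesB, decide_eq_true_eq]
      constructor
      · rintro ⟨i, hi, rfl⟩
        exact ⟨p, f, L, q, i, M, rfl, hi, rfl⟩
      · rintro ⟨p', f', L', q', i, M', h1, hi, h2⟩
        cases h1; cases h2
        exact ⟨i, hi, rfl⟩
theorem viewRevAux_fuel : ∀ (n m : ℕ) (s : List Action), s.length ≤ n → s.length ≤ m →
    viewRevAux n s = viewRevAux m s := by
  intro n
  induction n with
  | zero =>
    intro m s h1 _
    have : s = [] := List.length_eq_zero_iff.mp (by omega)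
    subst this
    cases m <;> simp [viewRevAux]
  | succ n ih =>
    intro m s h1 h2
    cases s with
    | nil => cases m <;> simp [viewRevAux]
    | cons a w =>
      cases m with
      | zero => simp at h2
      | succ m =>
        simp only [List.length_cons, Nat.add_le_add_iff_right] at h1 h2
        have hd : (w.dropWhile fun b => !(b.justifiesB a)).length ≤ w.length :=
          (List.dropWhile_sublist _).length_le
        simp only [viewRevAux]
        rw [ih m w h1 h2, ih m _ (hd.trans h1) (hd.trans h2)]
theorem view_nil : view [] = [] := rfl
theorem view_pos (w : List Action) {a : Action} (h : a.isPositive = true) :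
    view (w ++ [a]) = view w ++ [a] := by
  simp [view, viewRev, viewRevAux, h]
theorem view_neg_aux (w : List Action) {a : Action} (h : a.isPositive = false) :
    view (w ++ [a]) =
      view (w.reverse.dropWhile fun b => !(b.justifiesB a)).reverse ++ [a] := by
  have hd : (w.reverse.dropWhile fun b => !(b.justifiesB a)).length ≤ w.length := by
    simpa using (List.dropWhile_sublist (fun b => !(b.justifiesB a)) (l := w.reverse)).length_le
  simp only [view, viewRev, List.reverse_append, List.reverse_cons, List.reverse_nil,
    List.nil_append, List.singleton_append, List.length_cons, viewRevAux, h, List.length_reverse,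
    Bool.false_eq_true, if_false, List.reverse_reverse]
  rw [viewRevAux_fuel w.length _ _ hd le_rfl]
theorem view_neg_just (w1 w2 : List Action) {m a : Action} (h : a.isPositive = false)
    (hm : m.justifies a) (h2 : ∀ x ∈ w2, ¬ x.justifies a) :
    view (w1 ++ m :: w2 ++ [a]) = view (w1 ++ [m]) ++ [a] := by
  rw [view_neg_aux _ h]
  congr 2
  rw [List.reverse_append, List.reverse_cons, List.append_assoc,
    List.dropWhile_append_of_pos]
  · simp only [List.singleton_append]
    rw [List.dropWhile_cons_of_neg (by simpa [justifies] using hm)]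
    simp
  · intro x hx
    have := h2 x (List.mem_reverse.mp hx)
    simpa [justifies] using this
theorem view_neg_init (w : List Action) {a : Action} (h : a.isPositive = false)
    (h2 : ∀ x ∈ w, ¬ x.justifies a) :
    view (w ++ [a]) = [a] := by
  rw [view_neg_aux _ h]
  have : (w.reverse.dropWhile fun b => !(b.justifiesB a)) = [] := by
    rw [List.dropWhile_eq_nil_iff]
    intro x hx
    have := h2 x (List.mem_reverse.mp hx)
    simpa [justifies] using this
  rw [this]; rfl
theorem exists_last_just (w : List Action) (a : Action) :
    (∀ x ∈ w, ¬ x.justifies a) ∨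
    ∃ w1 m w2, w = w1 ++ m :: w2 ∧ m.justifies a ∧ ∀ x ∈ w2, ¬ x.justifies a := by
  induction w using List.reverseRecOn with
  | nil => left; simp
  | append_singleton w b ih =>
    by_cases hb : b.justifies a
    · right; exact ⟨w, b, [], by simp, hb, by simp⟩
    · rcases ih with ih | ⟨w1, m, w2, rfl, hm, h2⟩
      · left
        intro x hx
        rcases List.mem_append.mp hx with hx | hx
        · exact ih x hx
        · rw [List.mem_singleton.mp hx]; exact hb
      · right
        refine ⟨w1, m, w2 ++ [b], by simp, hm, ?_⟩
        intro x hx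
        rcases List.mem_append.mp hx with hx | hx
        · exact h2 x hx
        · rw [List.mem_singleton.mp hx]; exact hb
theorem view_cases (w : List Action) (a : Action) :
    (a.isPositive = true ∧ view (w ++ [a]) = view w ++ [a]) ∨
    (a.isPositive = false ∧ (∀ x ∈ w, ¬ x.justifies a) ∧ view (w ++ [a]) = [a]) ∨
    (a.isPositive = false ∧ ∃ w1 m w2, w = w1 ++ m :: w2 ∧ m.justifies a ∧
      view (w ++ [a]) = view (w1 ++ [m]) ++ [a]) := by
  cases h : a.isPositive with
  | true => left; exact ⟨rfl, view_pos w h⟩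
  | false =>
    right
    rcases exists_last_just w a with h1 | ⟨w1, m, w2, rfl, hm, h2⟩
    · left; exact ⟨rfl, h1, view_neg_init w h h1⟩
    · right; exact ⟨rfl, w1, m, w2, rfl, hm, view_neg_just w1 w2 h hm h2⟩
theorem view_snoc (w : List Action) (a : Action) : ∃ c, view (w ++ [a]) = c ++ [a] := by
  rcases view_cases w a with ⟨_, h⟩ | ⟨_, _, h⟩ | ⟨_, w1, m, w2, _, _, h⟩
  · exact ⟨_, h⟩
  · exact ⟨[], h⟩
  · exact ⟨_, h⟩
theorem view_ne_nil {w : List Action} (h : w ≠ []) : view w ≠ [] := by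
  rcases List.eq_nil_or_concat' w with rfl | ⟨u, a, rfl⟩
  · exact absurd rfl h
  obtain ⟨c, hc⟩ := view_snoc u a
  rw [hc]; simp
theorem view_eq_nil {w : List Action} (h : view w = []) : w = [] := by
  by_contra hw; exact view_ne_nil hw h
theorem view_getLast? (w : List Action) : (view w).getLast? = w.getLast? := by
  induction w using List.reverseRecOn with
  | nil => rfl
  | append_singleton u a _ =>
    obtain ⟨c, hc⟩ := view_snoc u a
    rw [hc]; simp
theorem prefix_induction {P : List Action → Prop}
    (h : ∀ w, (∀ u, u.length < w.length → P u) → P w) (w : List Action) : P w := by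
  have : ∀ n, ∀ w : List Action, w.length = n → P w := by
    intro n
    induction n using Nat.strong_induction_on with
    | _ n ih =>
      intro w hw
      exact h w (fun u hu => ih u.length (hw ▸ hu) u rfl)
  exact this _ w rfl
theorem view_sublist (w : List Action) : (view w).Sublist w := by
  induction w using prefix_induction with
  | h w ih =>
    rcases List.eq_nil_or_concat' w with rfl | ⟨u, a, rfl⟩
    · exact List.Sublist.refl _
    · rcases view_cases u a with ⟨_, h⟩ | ⟨_, _, h⟩ | ⟨_, w1, m, w2, rfl, _, h⟩
      · rw [h]; exact (ih u (by simp)).append (List.Sublist.refl _)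
      · rw [h]; exact (List.nil_sublist u).append (List.Sublist.refl [a])
      · rw [h]
        refine List.Sublist.append ?_ (List.Sublist.refl _)
        refine (ih (w1 ++ [m]) (by simp)).trans ?_
        have : w1 ++ m :: w2 = (w1 ++ [m]) ++ w2 := by simp
        rw [this]; exact List.sublist_append_left _ _
theorem view_subset {w : List Action} {a : Action} (h : a ∈ view w) : a ∈ w :=
  (view_sublist w).subset h
theorem prefix_snoc {c w : List Action} {a : Action} (h : c <+: w ++ [a]) :
    c <+: w ∨ c = w ++ [a] := by
  rw [List.prefix_concat_iff] at h
  tauto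
theorem prefix_view (w : List Action) : ∀ c, c <+: view w → ∃ u, u <+: w ∧ c = view u := by
  induction w using prefix_induction with
  | h w ih =>
    intro c hc
    rcases List.eq_nil_or_concat' w with rfl | ⟨u, a, rfl⟩
    · rw [view_nil] at hc
      exact ⟨[], List.prefix_refl _, by rw [view_nil]; exact List.prefix_nil.mp hc⟩
    · rcases view_cases u a with ⟨_, h⟩ | ⟨_, _, h⟩ | ⟨_, w1, m, w2, rfl, _, h⟩
      · rw [h] at hc
        rcases prefix_snoc hc with hc | hc
        · obtain ⟨x, hx, rfl⟩ := ih u (by simp) c hc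
          exact ⟨x, hx.trans (List.prefix_append _ _), rfl⟩
        · exact ⟨u ++ [a], List.prefix_refl _, by rw [h, hc]⟩
      · rw [h] at hc
        rcases prefix_snoc (w := []) hc with hc | hc
        · exact ⟨[], List.nil_prefix, by rw [view_nil]; exact List.prefix_nil.mp hc⟩
        · exact ⟨u ++ [a], List.prefix_refl _, by rw [h, hc]; rfl⟩
      · rw [h] at hc
        rcases prefix_snoc hc with hc | hc
        · obtain ⟨x, hx, rfl⟩ := ih (w1 ++ [m]) (by simp) c hc
          refine ⟨x, hx.trans ?_, rfl⟩
          exact ⟨w2 ++ [a], by simp⟩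
        · exact ⟨w1 ++ m :: w2 ++ [a], List.prefix_refl _, by rw [h, hc]⟩
theorem mem_split_prefix {l : List Action} {a : Action} (h : a ∈ l) :
    ∃ u, u ++ [a] <+: l := by
  obtain ⟨u, v, rfl⟩ := List.append_of_mem h
  exact ⟨u, v, by simp⟩
theorem mem_view {w : List Action} {a : Action} (h : a ∈ view w) :
    ∃ u, u ++ [a] <+: w ∧ view (u ++ [a]) <+: view w := by
  obtain ⟨c, hc⟩ := mem_split_prefix h
  obtain ⟨x, hx, hcx⟩ := prefix_view w _ hc
  have hl : x.getLast? = some a := by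
    rw [← view_getLast?, ← hcx]; simp
  obtain ⟨u, rfl⟩ := List.getLast?_eq_some_iff.mp hl
  exact ⟨u, hx, hcx ▸ hc⟩
theorem view_map (φ : Action → Action) (l : List Action)
    (hp : ∀ a ∈ l, (φ a).isPositive = a.isPositive)
    (hj : ∀ a ∈ l, ∀ b ∈ l, (φ a).justifiesB (φ b) = a.justifiesB b) :
    view (l.map φ) = (view l).map φ := by
  induction l using prefix_induction with
  | h w ih =>
    rcases List.eq_nil_or_concat' w with rfl | ⟨u, a, rfl⟩
    · rfl
    · rw [List.map_append, List.map_singleton]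
      cases h : a.isPositive with
      | true =>
        rw [view_pos _ h, view_pos _ (by rw [hp a (by simp), h]), ih u (by simp)
          (fun x hx => hp x (by simp [hx])) (fun x hx y hy => hj x (by simp [hx]) y (by simp [hy]))]
        simp
      | false =>
        have hφ : (φ a).isPositive = false := by rw [hp a (by simp), h]
        rcases exists_last_just u a with h1 | ⟨w1, m, w2, rfl, hm, h2⟩
        · rw [view_neg_init u h h1, view_neg_init _ hφ]
          · rfl
          · intro x hx
            obtain ⟨y, hy, rfl⟩ := List.mem_map.mp hx
            have := h1 y hy
            unfold justifies at this ⊢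
            rwa [hj y (by simp [hy]) a (by simp)]
        · rw [view_neg_just w1 w2 h hm h2, List.map_append, List.map_cons,
            view_neg_just _ _ hφ]
          · have := ih (w1 ++ [m]) (by simp)
              (fun x hx => hp x (by simp at hx ⊢; tauto))
              (fun x hx y hy => hj x (by simp at hx ⊢; tauto) y (by simp at hy ⊢; tauto))
            rw [List.map_append, List.map_singleton] at this
            rw [this]; simp
          · unfold justifies at hm ⊢
            rwa [hj m (by simp) a (by simp)]
          · intro x hx
            obtain ⟨y, hy, rfl⟩ := List.mem_map.mp hx
            have := h2 y hy
            unfold justifies at this ⊢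
            rwa [hj y (by simp [hy]) a (by simp)]
end Part1
section Part2
open Action
def foci (s : List Action) : List Address := s.filterMap Action.focus?
theorem foci_append (s t : List Action) : foci (s ++ t) = foci s ++ foci t := by
  simp [foci]
theorem mem_foci {s : List Action} {f : Address} :
    f ∈ foci s ↔ ∃ b L, proper b f L ∈ s := by
  simp only [foci, List.mem_filterMap]
  constructor
  · rintro ⟨a, ha, h⟩
    cases a with
    | daimon => simp [focus?] at h
    | proper b g L => simp [focus?] at h; subst h; exact ⟨b, L, ha⟩
  · rintro ⟨b, L, h⟩; exact ⟨_, h, rfl⟩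
theorem foci_dual (s : List Action) : foci (s.map dual) = foci s := by
  simp only [foci, List.filterMap_map]
  congr 1; funext a; exact focus_dual a
def Steps (R : List Action → Action → Prop) (c : List Action) : Prop :=
  ∀ w a, w ++ [a] <+: c → R w a
theorem steps_nil (R : List Action → Action → Prop) : Steps R [] := by
  intro w a h; simp at h
theorem Steps.prefix {R : List Action → Action → Prop} {c d : List Action} (h : Steps R c)
    (hd : d <+: c) : Steps R d := fun w a hw => h w a (hw.trans hd)
theorem steps_snoc {R : List Action → Action → Prop} {c : List Action} {x : Action} :
    Steps R (c ++ [x]) ↔ Steps R c ∧ R c x := by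
  constructor
  · intro h
    exact ⟨h.prefix (List.prefix_append _ _), h c x (List.prefix_refl _)⟩
  · rintro ⟨h1, h2⟩ w a hw
    rcases prefix_snoc hw with hw | hw
    · exact h1 w a hw
    · have := List.append_inj' hw rfl
      obtain ⟨rfl, h⟩ := this
      simp at h; subst h; exact h2
def ChrStep (ξ : Address) (pos : Bool) (w : List Action) (a : Action) : Prop :=
  (w = [] ∧ ((∃ I, a = proper pos ξ I) ∨ (a = daimon ∧ pos = true))) ∨
  ∃ b, w.getLast? = some b ∧ b ≠ daimon ∧ a.isPositive ≠ b.isPositive ∧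
    (∀ f, a.focus? = some f → f ∉ foci w) ∧
    (a.isPositive = false → b.justifies a) ∧
    (a.isPositive = true → a ≠ daimon → ∃ m ∈ w, m.justifies a)
def Chr (ξ : Address) (pos : Bool) (c : List Action) : Prop :=
  c ≠ [] ∧ Steps (ChrStep ξ pos) c
theorem initial_simple {ξ : Address} {pos : Bool} {a : Action} :
    Initial (simpleBase ξ pos) a ↔ ∃ I, a = proper pos ξ I := by
  cases pos with
  | true =>
    simp only [Initial, simpleBase, if_true, List.mem_singleton]
    constructor
    · rintro ⟨pol, ζ, I, rfl, σ, rfl, h⟩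
      rcases h with ⟨rfl, h⟩ | ⟨_, h⟩
      · exact ⟨I, by simp at h; rw [h]⟩
      · simp at h
    · rintro ⟨I, rfl⟩
      exact ⟨true, ξ, I, rfl, _, rfl, Or.inl ⟨rfl, by simp⟩⟩
  | false =>
    simp only [Initial, simpleBase, Bool.false_eq_true, if_false, List.mem_singleton]
    constructor
    · rintro ⟨pol, ζ, I, rfl, σ, rfl, h⟩
      rcases h with ⟨_, h⟩ | ⟨rfl, h⟩
      · simp at h
      · exact ⟨I, by simp at h; rw [h]⟩
    · rintro ⟨I, rfl⟩
      exact ⟨false, ξ, I, rfl, _, rfl, Or.inr ⟨rfl, rfl⟩⟩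
theorem isPositive_simple {ξ : Address} {pos : Bool} :
    (simpleBase ξ pos).isPositive ↔ pos = true := by
  cases pos <;> simp [simpleBase, Base.isPositive]
theorem focus_none {a : Action} (h : a ≠ daimon) : ∃ b f L, a = proper b f L := by
  cases a with
  | daimon => exact absurd rfl h
  | proper b f L => exact ⟨b, f, L, rfl⟩
theorem IsPath.last_nodup {β : Base} {p : List Action} (h : IsPath β p) {w : List Action}
    {a : Action} (hw : w ++ [a] <+: p) {f : Address} (hf : a.focus? = some f) :
    f ∉ foci w := by
  obtain ⟨t, rfl⟩ := hw
  have := h.linearity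
  simp only [List.filterMap_append] at this
  have h1 := (List.nodup_append.mp (List.nodup_append.mp this).1).2.2
  intro hfm
  exact h1 f hfm f (by simp [hf]) rfl
theorem IsPath.alt {β : Base} {p : List Action} (h : IsPath β p) {w : List Action}
    {a b : Action} (hw : w ++ [b] ++ [a] <+: p) : a.isPositive ≠ b.isPositive := by
  obtain ⟨t, rfl⟩ := hw
  have := h.alternating
  have h2 := (List.isChain_append.mp (List.isChain_append.mp this).1).2.2 b (by simp) a (by simp)
  exact fun h => h2 h.symm
theorem chr_of_isChronicle {ξ : Address} {pos : Bool} {c : List Action}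
    (h : IsChronicle (simpleBase ξ pos) c) : Chr ξ pos c := by
  obtain ⟨hp, hne, hneg⟩ := h
  refine ⟨hne, ?_⟩
  have hfirst : ∀ a, [a] <+: c → (∃ I, a = proper pos ξ I) ∨ (a = daimon ∧ pos = true) := by
    intro a ha
    by_cases had : a = daimon
    · right
      refine ⟨had, ?_⟩
      subst had
      obtain ⟨t, rfl⟩ := ha
      exact isPositive_simple.mp (hp.daimonFirst (by simp))
    · left
      rcases hp.justified [] a (by simpa using ha) had with h | ⟨b, hb, _⟩
      · exact initial_simple.mp h
      · simp at hb
  intro w a hw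
  rcases List.eq_nil_or_concat' w with rfl | ⟨u, b, rfl⟩
  · left; exact ⟨rfl, hfirst a (by simpa using hw)⟩
  · right
    have hub : u ++ [b] <+: c := (List.prefix_append _ _).trans hw
    have hbd : b ≠ daimon := by
      rintro rfl
      have := hp.daimonLast u hub
      rw [← this] at hw
      have := hw.length_le
      simp at this
    have hξ : ξ ∈ foci (u ++ [b]) := by
      cases u with
      | nil =>
        rcases hfirst b (by simpa using hub) with ⟨I, rfl⟩ | ⟨h, _⟩
        · exact mem_foci.mpr ⟨pos, I, by simp⟩
        · exact absurd h hbd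
      | cons x t =>
        have hx : [x] <+: c := by
          obtain ⟨r, hr⟩ := hub
          exact ⟨t ++ [b] ++ r, by rw [← hr]; simp⟩
        rcases hfirst x hx with ⟨I, rfl⟩ | ⟨rfl, _⟩
        · exact mem_foci.mpr ⟨pos, I, by simp⟩
        · have := hp.daimonLast [] (by simpa using hx)
          rw [← this] at hub
          have := hub.length_le
          simp at this
    have hnoinit : ¬ Initial (simpleBase ξ pos) a := by
      intro h
      obtain ⟨I, rfl⟩ := initial_simple.mp h
      exact hp.last_nodup hw rfl hξ
    refine ⟨b, by simp, hbd, hp.alt hw, fun f hf => hp.last_nodup hw hf, ?_, ?_⟩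
    · intro ha
      rcases hneg u b a (by simpa using hw) ha with h | h
      · exact absurd h hnoinit
      · exact h
    · intro _ had
      rcases hp.justified _ a hw had with h | ⟨m, hm, h⟩
      · exact absurd h hnoinit
      · exact ⟨m, hm, h⟩
theorem chr_view {ξ : Address} {pos : Bool} {c : List Action}
    (h : Steps (ChrStep ξ pos) c) : view c = c := by
  induction c using List.reverseRecOn with
  | nil => rfl
  | append_singleton w a ih =>
    obtain ⟨h1, h2⟩ := steps_snoc.mp h
    have ih := ih h1
    cases ha : a.isPositive with
    | true => rw [view_pos _ ha, ih]
    | false =>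
      rcases h2 with ⟨rfl, _⟩ | ⟨b, hb, _, _, _, hj, _⟩
      · simpa using view_neg_init [] ha (by simp)
      · obtain ⟨u, rfl⟩ := List.getLast?_eq_some_iff.mp hb
        have := view_neg_just u [] ha (hj ha) (by simp)
        rw [this, ih]
theorem chr_nodup {ξ : Address} {pos : Bool} {c : List Action}
    (h : Steps (ChrStep ξ pos) c) : (foci c).Nodup := by
  induction c using List.reverseRecOn with
  | nil => simp [foci]
  | append_singleton w a ih =>
    obtain ⟨h1, h2⟩ := steps_snoc.mp h
    have ih := ih h1
    rw [foci_append, List.nodup_append]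
    refine ⟨ih, ?_, ?_⟩
    · cases a
      · exact List.nodup_nil
      · exact List.nodup_singleton _
    · intro f hf g hg hfg
      subst hfg
      have hg' : a.focus? = some f := by
        simp only [foci, List.mem_filterMap, List.mem_singleton] at hg
        obtain ⟨x, rfl, hx⟩ := hg; exact hx
      rcases h2 with ⟨rfl, _⟩ | ⟨b, hb, _, _, hn, hj, _⟩
      · simp [foci] at hf
      · exact hn f hg' hf
theorem chr_head {ξ : Address} {pos : Bool} {c : List Action}
    (h : Chr ξ pos c) : (∃ I t, c = proper pos ξ I :: t) ∨ (c = [daimon] ∧ pos = true) := by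
  obtain ⟨hne, hs⟩ := h
  cases c with
  | nil => exact absurd rfl hne
  | cons a t =>
    rcases hs [] a ⟨t, by simp⟩ with ⟨_, ⟨I, rfl⟩ | ⟨rfl, hp⟩⟩ | ⟨b, hb, _⟩
    · left; exact ⟨I, t, rfl⟩
    · right
      cases t with
      | nil => exact ⟨rfl, hp⟩
      | cons x t =>
        rcases hs [daimon] x ⟨t, by simp⟩ with ⟨h, _⟩ | ⟨b, hb, hb2, _⟩
        · simp at h
        · simp at hb; exact absurd hb.symm hb2
    · simp at hb
theorem chr_dai_last {ξ : Address} {pos : Bool} {c : List Action}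
    (h : Steps (ChrStep ξ pos) c) {w : List Action} (hw : w ++ [daimon] <+: c) :
    w ++ [daimon] = c := by
  obtain ⟨t, rfl⟩ := hw
  cases t with
  | nil => simp
  | cons x t =>
    rcases h (w ++ [daimon]) x ⟨t, by simp⟩ with ⟨h, _⟩ | ⟨b, hb, hb2, _⟩
    · simp at h
    · simp at hb; exact absurd hb.symm hb2
theorem isChronicle_of_chr {ξ : Address} {pos : Bool} {c : List Action}
    (h : Chr ξ pos c) : IsChronicle (simpleBase ξ pos) c := by
  obtain ⟨hne, hs⟩ := id h
  refine ⟨⟨?_, ?_, ?_, ?_, chr_nodup hs, fun w hw => chr_dai_last hs hw, ?_, ?_⟩, hne, ?_⟩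
  · clear h hne
    show List.IsChain _ c
    induction c using List.reverseRecOn with
    | nil => simp
    | append_singleton w a ih =>
      obtain ⟨h1, h2⟩ := steps_snoc.mp hs
      rw [List.isChain_append]
      refine ⟨ih h1, by simp, ?_⟩
      intro x hx y hy
      simp at hy; subst hy
      rcases h2 with ⟨rfl, _⟩ | ⟨b, hb, _, hn, _⟩
      · simp at hx
      · rw [hb] at hx; simp at hx; subst hx; exact hn.symm
  · intro w a hw had
    rcases hs w a hw with ⟨rfl, ⟨I, rfl⟩ | ⟨rfl, _⟩⟩ | ⟨b, hb, _, hn, _, hneg, hpos⟩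
    · left; exact initial_simple.mpr ⟨I, rfl⟩
    · exact absurd rfl had
    · right
      cases ha : a.isPositive with
      | true => exact hpos ha had
      | false => exact ⟨b, List.mem_of_getLast? hb, hneg ha⟩
  · intro w a b hw _ hb _
    rw [chr_view (hs.prefix ((List.prefix_append _ _).trans hw))]; exact hb
  · intro w a hw hap had σ hσ hf
    obtain ⟨f, hf1, hf2⟩ := hf
    cases pos with
    | false =>
      simp [simpleBase] at hσ; subst hσ; simp at hf2
    | true =>
      simp [simpleBase] at hσ; subst hσ
      simp at hf2; subst hf2
      left
      refine ⟨?_, rfl⟩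
      rcases hs w a hw with ⟨rfl, _⟩ | ⟨b, hb, _, hn, hfn, hneg, hpos⟩
      · rfl
      · exfalso
        apply hfn f hf1
        cases w with
        | nil => simp at hb
        | cons x t =>
          rcases chr_head h with ⟨I, t', rfl⟩ | ⟨rfl, _⟩
          · obtain ⟨r, hr⟩ := hw
            simp at hr
            exact mem_foci.mpr ⟨true, I, by simp [hr.1]⟩
          · have := hw.length_le
            simp at this
  · intro hd
    rw [isPositive_simple]
    rcases chr_head h with ⟨I, t', rfl⟩ | ⟨rfl, hpp⟩
    · simp at hd
    · exact hpp
  · intro hp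
    rw [isPositive_simple] at hp
    rcases chr_head h with ⟨I, t', rfl⟩ | ⟨rfl, h⟩
    · exact ⟨_, t', rfl, Or.inr ⟨hp, initial_simple.mpr ⟨I, rfl⟩⟩⟩
    · exact ⟨_, [], rfl, Or.inl rfl⟩
  · intro w a b hw hb
    rcases hs (w ++ [a]) b (by simpa using hw) with ⟨h, _⟩ | ⟨x, hx, _, hn, hfn, hneg, hpos⟩
    · simp at h
    · simp at hx; subst hx; right; exact hneg hb
theorem chr_iff {ξ : Address} {pos : Bool} {c : List Action} :
    IsChronicle (simpleBase ξ pos) c ↔ Chr ξ pos c :=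
  ⟨chr_of_isChronicle, isChronicle_of_chr⟩
end Part2
section Part3
open Action
abbrev DSet := Set (List Action)
def Play (X Y : DSet) (s : List Action) : Prop :=
  daimon ∉ s ∧ ∀ w, w <+: s → w ≠ [] → view w ∈ X ∧ view (w.map dual) ∈ Y
theorem play_nil (X Y : DSet) : Play X Y [] := by
  refine ⟨by simp, ?_⟩
  intro w hw hne
  exact absurd (List.prefix_nil.mp hw) hne
theorem Play.prefix {X Y : DSet} {s u : List Action} (h : Play X Y s) (hu : u <+: s) :
    Play X Y u :=
  ⟨fun hd => h.1 (hu.subset hd), fun w hw => h.2 w (hw.trans hu)⟩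
theorem play_snoc {X Y : DSet} {s : List Action} {k : Action} :
    Play X Y (s ++ [k]) ↔ Play X Y s ∧ k ≠ daimon ∧ view (s ++ [k]) ∈ X ∧
      view ((s ++ [k]).map dual) ∈ Y := by
  constructor
  · intro h
    have := h.2 _ (List.prefix_refl _) (by simp)
    refine ⟨h.prefix (List.prefix_append _ _), ?_, this.1, this.2⟩
    rintro rfl
    exact h.1 (by simp)
  · rintro ⟨h, hk, hX, hY⟩
    refine ⟨?_, ?_⟩
    · intro hd
      rcases List.mem_append.mp hd with hd | hd
      · exact h.1 hd
      · exact hk (List.mem_singleton.mp hd).symm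
    · intro w hw hne
      rcases prefix_snoc hw with hw | rfl
      · exact h.2 w hw hne
      · exact ⟨hX, hY⟩
theorem prefix_map_dual {w s : List Action} (h : w <+: s.map dual) : w.map dual <+: s := by
  have := h.map dual
  rwa [map_dual_dual] at this
theorem Play.symm {X Y : DSet} {s : List Action} (h : Play X Y s) : Play Y X (s.map dual) := by
  refine ⟨fun hd => h.1 (dai_mem_map_dual.mp hd), ?_⟩
  intro w hw hne
  have := h.2 _ (prefix_map_dual hw) (by simpa using hne)
  rw [map_dual_dual] at this
  exact this.symm
def OrthP (X Y : DSet) : Prop :=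
  (∃ N, ∀ s, Play X Y s → s.length ≤ N) ∧
  (∀ s k, Play X Y s → k ≠ daimon → k.isPositive = true → view (s ++ [k]) ∈ X →
    view ((s ++ [k]).map dual) ∈ Y) ∧
  (∀ s k, Play X Y s → k.isPositive = false → view ((s ++ [k]).map dual) ∈ Y →
    view (s ++ [k]) ∈ X)
theorem OrthP.symm {X Y : DSet} (h : OrthP X Y) : OrthP Y X := by
  obtain ⟨⟨N, hN⟩, h1, h2⟩ := h
  refine ⟨⟨N, ?_⟩, ?_, ?_⟩
  · intro s hs
    simpa using hN _ hs.symm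
  · intro s k hs hk hp hv
    have := h2 (s.map dual) k.dual hs.symm (by rw [pol_dual hk, hp]; rfl)
      (by rw [List.map_append, map_dual_dual, List.map_singleton, dual_dual]; exact hv)
    rw [List.map_append]; exact this
  · intro s k hs hp hv
    have hk := neg_ne_dai hp
    have := h1 (s.map dual) k.dual hs.symm (dual_ne_dai hk) (by rw [pol_dual hk, hp]; rfl)
      (by rw [List.map_append] at hv; exact hv)
    rw [List.map_append, map_dual_dual, List.map_singleton, dual_dual] at this
    exact this
section designs
variable {ξ : Address} {pos : Bool} {X : DSet}
theorem des_chr (h : IsDesign (simpleBase ξ pos) X) {c : List Action} (hc : c ∈ X) :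
    Chr ξ pos c := chr_iff.mp (h.chron c hc)
theorem des_det (h : IsDesign (simpleBase ξ pos) X) {c : List Action} {k k' : Action}
    (h1 : c ++ [k] ∈ X) (h2 : c ++ [k'] ∈ X) (hk : k.isPositive = true) : k = k' := by
  rcases (h.coherent _ h1 _ h2).1 c k k' (List.prefix_refl _) (List.prefix_refl _) with h | ⟨h, _⟩
  · exact h
  · rw [hk] at h; cases h
theorem des_turn (h : IsDesign (simpleBase ξ pos) X) {c : List Action} {k : Action}
    (h1 : c ++ [k] ∈ X) :
    (c = [] ∧ k.isPositive = pos ∧ (k = daimon ∨ ∃ I, k = proper pos ξ I)) ∨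
      ∃ b, c.getLast? = some b ∧ b ≠ daimon ∧ k.isPositive = !b.isPositive := by
  rcases (des_chr h h1).2 c k (List.prefix_refl _) with ⟨h, ⟨I, rfl⟩ | ⟨rfl, hp⟩⟩ |
    ⟨b, hb, hbd, hn, _⟩
  · left; exact ⟨h, rfl, Or.inr ⟨I, rfl⟩⟩
  · left; exact ⟨h, hp.symm, Or.inl rfl⟩
  · right
    refine ⟨b, hb, hbd, ?_⟩
    cases hk : k.isPositive <;> cases hb : b.isPositive <;> simp_all
theorem des_reply (h : IsDesign (simpleBase ξ pos) X) {c : List Action} {b : Action}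
    (hc : c ∈ X) (hb : c.getLast? = some b) (hn : b.isPositive = false) :
    ∃ k, k.isPositive = true ∧ c ++ [k] ∈ X := by
  by_contra hcon
  push Not at hcon
  obtain ⟨a, ha, hap⟩ := h.maxPos c hc (by
    intro k hk
    rcases des_turn h hk with ⟨h0, _⟩ | ⟨b', hb', _, h3⟩
    · rw [h0] at hb; simp at hb
    · rw [hb] at hb'
      cases hb'
      rw [hn] at h3
      exact hcon k h3 hk)
  rw [hb] at ha; cases ha; rw [hn] at hap; cases hap
end designs
section conv
variable {ξ : Address} {D E : DSet}
theorem turn_iff {s : List Action} : TurnD True s ↔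
    s = [] ∨ ∃ b, s.getLast? = some b ∧ b.isPositive = false := by
  rcases List.eq_nil_or_concat' s with rfl | ⟨u, b, rfl⟩
  · simp [TurnD]
  · simp [TurnD]
theorem turn_D (hD : IsDesign (simpleBase ξ true) D) {s : List Action} {k : Action}
    (hk : k.isPositive = true) (h : view (s ++ [k]) ∈ D) : TurnD True s := by
  rw [view_pos s hk] at h
  rw [turn_iff]
  rcases des_turn hD h with ⟨h, _⟩ | ⟨b, hb, _, h3⟩
  · left; exact view_eq_nil h
  · right; rw [view_getLast?] at hb; exact ⟨b, hb, by rw [hk] at h3; simpa using h3⟩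
theorem turn_E (hE : IsDesign (simpleBase ξ false) E) {s : List Action} {k : Action}
    (hk : k.dual.isPositive = true) (h : view ((s ++ [k]).map dual) ∈ E) : ¬ TurnD True s := by
  rw [List.map_append, List.map_singleton, view_pos _ hk] at h
  rw [turn_iff]
  rcases des_turn hE h with ⟨h, h2, _⟩ | ⟨b, hb, hbd, h3⟩
  · rw [hk] at h2; cases h2
  · rw [view_getLast?, List.getLast?_map] at hb
    rintro (rfl | ⟨b', hb', hn⟩)
    · simp at hb
    · rw [hb'] at hb
      simp at hb
      subst hb
      rw [pol_dual (neg_ne_dai hn), hn] at h3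
      rw [hk] at h3; simp at h3
theorem ext_cases {s s' : List Action} (h : s <+: s') : s' = s ∨ ∃ k, s ++ [k] <+: s' := by
  obtain ⟨t, rfl⟩ := h
  cases t with
  | nil => left; simp
  | cons k t => right; exact ⟨k, t, by simp⟩
theorem conv_orth_aux (hD : IsDesign (simpleBase ξ true) D) (hE : IsDesign (simpleBase ξ false) E)
    {s : List Action} (h : Conv D E True s) :
    ∃ N, ∀ s', s <+: s' → Play D E s' → s'.length ≤ N ∧
      (∀ k, k ≠ daimon → k.isPositive = true → view (s' ++ [k]) ∈ D →
        view ((s' ++ [k]).map dual) ∈ E) ∧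
      (∀ k, k.isPositive = false → view ((s' ++ [k]).map dual) ∈ E → view (s' ++ [k]) ∈ D) := by
  have detD : ∀ s k k', k.isPositive = true → k'.isPositive = true → view (s ++ [k]) ∈ D →
      view (s ++ [k']) ∈ D → k = k' := by
    intro s k k' hk hk' h1 h2
    rw [view_pos _ hk] at h1; rw [view_pos _ hk'] at h2
    exact des_det hD h1 h2 hk
  have detE : ∀ s k k', k.dual.isPositive = true → k'.dual.isPositive = true →
      view ((s ++ [k]).map dual) ∈ E →
      view ((s ++ [k']).map dual) ∈ E → k = k' := by
    intro s k k' hk hk' h1 h2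
    rw [List.map_append, List.map_singleton, view_pos _ hk] at h1
    rw [List.map_append, List.map_singleton, view_pos _ hk'] at h2
    have := des_det hE h1 h2 hk
    rw [← dual_dual k, this, dual_dual]
  have negdual : ∀ k : Action, k.isPositive = false → k.dual.isPositive = true := by
    intro k hk; rw [pol_dual (neg_ne_dai hk), hk]; rfl
  induction h with
  | @daiD s ht hv =>
    refine ⟨s.length, ?_⟩
    intro s' hs' hp
    rcases ext_cases hs' with rfl | ⟨k, hk⟩
    · refine ⟨le_rfl, ?_, ?_⟩
      · intro k hkd hkp hkv
        exact absurd (detD _ _ _ hkp rfl hkv hv) hkd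
      · intro k hkn hkv
        exact absurd ht (turn_E hE (negdual k hkn) hkv)
    · exfalso
      obtain ⟨_, hkd, h1, h2⟩ := play_snoc.mp (hp.prefix hk)
      cases hkp : k.isPositive with
      | true => exact hkd (detD _ _ _ hkp rfl h1 hv)
      | false => exact turn_E hE (negdual k hkp) h2 ht
  | @daiR s ht hv =>
    have hv' : view ((s ++ [daimon]).map dual) ∈ E := by
      rw [List.map_append]; exact hv
    refine ⟨s.length, ?_⟩
    intro s' hs' hp
    rcases ext_cases hs' with rfl | ⟨k, hk⟩
    · refine ⟨le_rfl, ?_, ?_⟩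
      · intro k hkd hkp hkv
        exact absurd (turn_D hD hkp hkv) ht
      · intro k hkn hkv
        exact absurd (detE _ _ _ (negdual k hkn) rfl hkv hv') (neg_ne_dai hkn)
    · exfalso
      obtain ⟨_, hkd, h1, h2⟩ := play_snoc.mp (hp.prefix hk)
      cases hkp : k.isPositive with
      | true => exact ht (turn_D hD hkp h1)
      | false => exact neg_ne_dai hkp (detE _ _ _ (negdual k hkp) rfl h2 hv')
  | @stepD s κ ht hκp hκd hv1 hv2 _ ih =>
    obtain ⟨N, hN⟩ := ih
    refine ⟨max N s.length, ?_⟩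
    intro s' hs' hp
    rcases ext_cases hs' with rfl | ⟨k, hk⟩
    · refine ⟨le_max_right _ _, ?_, ?_⟩
      · intro k hkd hkp hkv
        rw [detD _ _ _ hkp hκp hkv hv1]; exact hv2
      · intro k hkn hkv
        exact absurd ht (turn_E hE (negdual k hkn) hkv)
    · obtain ⟨_, hkd, h1, h2⟩ := play_snoc.mp (hp.prefix hk)
      cases hkp : k.isPositive with
      | true =>
        have := detD _ _ _ hkp hκp h1 hv1
        subst this
        obtain ⟨a, b⟩ := hN s' hk hp
        exact ⟨a.trans (le_max_left _ _), b⟩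
      | false => exact absurd ht (turn_E hE (negdual k hkp) h2)
  | @stepR s κ ht hκn hv1 hv2 _ ih =>
    obtain ⟨N, hN⟩ := ih
    refine ⟨max N s.length, ?_⟩
    intro s' hs' hp
    rcases ext_cases hs' with rfl | ⟨k, hk⟩
    · refine ⟨le_max_right _ _, ?_, ?_⟩
      · intro k hkd hkp hkv
        exact absurd (turn_D hD hkp hkv) ht
      · intro k hkn hkv
        rw [detE _ _ _ (negdual k hkn) (negdual κ hκn) hkv hv1]; exact hv2
    · obtain ⟨_, hkd, h1, h2⟩ := play_snoc.mp (hp.prefix hk)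
      cases hkp : k.isPositive with
      | true => exact absurd (turn_D hD hkp h1) ht
      | false =>
        have := detE _ _ _ (negdual k hkp) (negdual κ hκn) h2 hv1
        subst this
        obtain ⟨a, b⟩ := hN s' hk hp
        exact ⟨a.trans (le_max_left _ _), b⟩
theorem conv_iff (hD : IsDesign (simpleBase ξ true) D) (hE : IsDesign (simpleBase ξ false) E) :
    Conv D E True [] ↔ OrthP D E := by
  constructor
  · intro h
    obtain ⟨N, hN⟩ := conv_orth_aux hD hE h
    refine ⟨⟨N, fun s hs => (hN s List.nil_prefix hs).1⟩, ?_, ?_⟩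
    · intro s k hs; exact (hN s List.nil_prefix hs).2.1 k
    · intro s k hs; exact (hN s List.nil_prefix hs).2.2 k
  · rintro ⟨⟨N, hN⟩, h1, h2⟩
    have : ∀ n s, N - s.length = n → Play D E s → Conv D E True s := by
      intro n
      induction n using Nat.strong_induction_on with
      | _ n ih =>
        intro s hn hs
        have step : ∀ k, k ≠ daimon → view (s ++ [k]) ∈ D → view ((s ++ [k]).map dual) ∈ E →
            Conv D E True (s ++ [k]) := by
          intro k hk hx hy
          have hp := play_snoc.mpr ⟨hs, hk, hx, hy⟩
          have := hN _ hp
          simp at this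
          refine ih (N - (s ++ [k]).length) ?_ _ rfl hp
          simp; omega
        by_cases ht : TurnD True s
        · have : ∃ k, k.isPositive = true ∧ view (s ++ [k]) ∈ D := by
            rcases turn_iff.mp ht with rfl | ⟨b, hb, hbn⟩
            · obtain ⟨c, hc⟩ := hD.posNonempty (isPositive_simple.mpr rfl)
              rcases chr_head (des_chr hD hc) with ⟨I, t, rfl⟩ | ⟨rfl, _⟩
              · refine ⟨proper true ξ I, rfl, ?_⟩
                rw [view_pos _ rfl]
                exact hD.prefixClosed _ hc _ ⟨t, by simp [view_nil]⟩ (by simp)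
              · exact ⟨daimon, rfl, hc⟩
            · have hv := (hs.2 s (List.prefix_refl _) (by rintro rfl; simp at hb)).1
              obtain ⟨k, hk, hv⟩ := des_reply hD hv (by rw [view_getLast?]; exact hb) hbn
              exact ⟨k, hk, by rw [view_pos _ hk]; exact hv⟩
          obtain ⟨k, hk, hv⟩ := this
          by_cases hkd : k = daimon
          · subst hkd; exact Conv.daiD ht hv
          · have hE' := h1 s k hs hkd hk hv
            exact Conv.stepD ht hk hkd hv hE' (step k hkd hv hE')
        · have ht' := ht
          rw [turn_iff] at ht'
          push Not at ht'
          obtain ⟨hne, hb'⟩ := ht'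
          rcases List.eq_nil_or_concat' s with rfl | ⟨u, b, rfl⟩
          · exact absurd rfl hne
          · have hbp : b.isPositive = true := by simpa using hb' b (by simp)
            have hbd : b ≠ daimon := by rintro rfl; exact hs.1 (by simp)
            have hv := (hs.2 _ (List.prefix_refl _) hne).2
            obtain ⟨k, hk, hv⟩ := des_reply hE hv (b := b.dual)
              (by rw [view_getLast?]; simp) (by rw [pol_dual hbd, hbp]; rfl)
            rw [← view_pos _ hk] at hv
            by_cases hkd : k = daimon
            · subst hkd; exact Conv.daiR ht hv
            · have hkn : k.dual.isPositive = false := by rw [pol_dual hkd, hk]; rfl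
              have hv' : view ((u ++ [b] ++ [k.dual]).map dual) ∈ E := by
                rw [List.map_append (l₁ := u ++ [b]), List.map_singleton, dual_dual]; exact hv
              have hD' := h2 _ k.dual hs hkn hv'
              exact Conv.stepR ht hkn hv' hD' (step _ (dual_ne_dai hkd) hD' hv')
    exact this _ [] rfl (play_nil _ _)
end conv
end Part3
section Part4
open Action
def cov (w : List Action) : List Action := (view (w.map dual)).map dual
theorem cov_dual (w : List Action) : (cov w).map dual = view (w.map dual) := map_dual_dual _
theorem view_dual (w : List Action) : view (w.map dual) = (cov w).map dual := (map_dual_dual _).symm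
theorem cov_map_dual (w : List Action) : cov (w.map dual) = (view w).map dual := by
  rw [cov, map_dual_dual]
theorem cov_subset {w : List Action} {a : Action} (h : a ∈ cov w) : a ∈ w := by
  simp only [cov, List.mem_map] at h
  obtain ⟨x, hx, rfl⟩ := h
  have := view_subset hx
  simp only [List.mem_map] at this
  obtain ⟨y, hy, rfl⟩ := this
  rwa [dual_dual]
theorem cov_nil : cov [] = [] := rfl
theorem cov_ne_nil {w : List Action} (h : w ≠ []) : cov w ≠ [] := by
  simp only [cov, ne_eq, List.map_eq_nil_iff]
  exact view_ne_nil (by simpa using h)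
theorem cov_getLast? (w : List Action) : (cov w).getLast? = w.getLast? := by
  rw [cov, List.getLast?_map, view_getLast?, List.getLast?_map, Option.map_map]
  cases w.getLast? <;> simp [dual_dual]
theorem mem_cov_iff {w : List Action} {a : Action} : a ∈ cov w ↔ a.dual ∈ view (w.map dual) := by
  rw [cov, List.mem_map]
  constructor
  · rintro ⟨x, hx, rfl⟩; rwa [dual_dual]
  · intro h; exact ⟨_, h, dual_dual a⟩
theorem cov_neg (w : List Action) {a : Action} (h : a.isPositive = false) :
    cov (w ++ [a]) = cov w ++ [a] := by
  rw [cov, List.map_append, List.map_singleton, view_pos, List.map_append, List.map_singleton,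
    dual_dual, cov]
  rw [pol_dual (neg_ne_dai h), h]; rfl
theorem prefix_dual {u w : List Action} : u.map dual <+: w.map dual ↔ u <+: w := by
  constructor
  · intro h
    have := prefix_map_dual h
    rwa [map_dual_dual] at this
  · exact fun h => h.map dual
def LegalStep (ξ : Address) (pos : Bool) (w : List Action) (a : Action) : Prop :=
  ∃ b f L, a = proper b f L ∧ f ∉ foci w ∧ ((w = [] ∧ b = pos ∧ f = ξ) ∨
    ∃ n m, w.getLast? = some n ∧ n.isPositive = !b ∧ m ∈ w ∧ m.justifies a ∧
      m.isPositive = !b ∧ (b = true → m ∈ view w) ∧ (b = false → m ∈ cov w))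
def Legal (ξ : Address) (pos : Bool) (s : List Action) : Prop := Steps (LegalStep ξ pos) s
variable {ξ : Address} {pos : Bool} {s u w : List Action} {a m : Action}
theorem legal_nil : Legal ξ pos [] := steps_nil _
theorem Legal.pre (h : Legal ξ pos s) (hu : u <+: s) : Legal ξ pos u := Steps.prefix h hu
theorem legal_snoc : Legal ξ pos (w ++ [a]) ↔ Legal ξ pos w ∧ LegalStep ξ pos w a := steps_snoc
theorem Legal.dai (h : Legal ξ pos s) : daimon ∉ s := by
  intro hd
  obtain ⟨u, hu⟩ := mem_split_prefix hd
  obtain ⟨b, f, L, hh, _⟩ := h _ _ hu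
  cases hh
theorem Legal.prop (h : Legal ξ pos s) (ha : a ∈ s) : ∃ b f L, a = proper b f L :=
  focus_none (fun hd => h.dai (hd ▸ ha))
theorem legalStep_dual (h : LegalStep ξ pos w a) (hd : daimon ∉ w) :
    LegalStep ξ (!pos) (w.map dual) a.dual := by
  obtain ⟨b, f, L, rfl, hf, h⟩ := h
  refine ⟨!b, f, L, rfl, by rwa [foci_dual], ?_⟩
  rcases h with ⟨rfl, rfl, rfl⟩ | ⟨n, m, hn, hnb, hm, hj, hmb, h1, h2⟩
  · left; exact ⟨rfl, rfl, rfl⟩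
  · right
    have hnd : n ≠ daimon := fun h => hd (h ▸ List.mem_of_getLast? hn)
    have hmd : m ≠ daimon := fun h => hd (h ▸ hm)
    refine ⟨n.dual, m.dual, by simp [hn], by rw [pol_dual hnd, hnb], List.mem_map_of_mem hm,
      justifies_dual.mpr hj, by rw [pol_dual hmd, hmb], ?_, ?_⟩
    · intro hb
      rw [← mem_cov_iff]
      exact h2 (by simpa using hb)
    · intro hb
      rw [cov_map_dual]
      exact List.mem_map_of_mem (h1 (by simpa using hb))
theorem Legal.dual (h : Legal ξ pos s) : Legal ξ (!pos) (s.map Action.dual) := by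
  intro w a hw
  have h1 := prefix_map_dual hw
  rw [List.map_append, List.map_singleton] at h1
  have := legalStep_dual (h _ _ h1) (fun hd => h.dai (h1.subset (by simp [hd])))
  rwa [map_dual_dual, dual_dual] at this
theorem Legal.fresh (h : Legal ξ pos s) (hw : w ++ [a] <+: s) {f : Address}
    (hf : a.focus? = some f) : f ∉ foci w := by
  obtain ⟨b, g, L, rfl, hg, _⟩ := h _ _ hw
  simp [focus?] at hf; subst hf; exact hg
theorem Legal.at_unique (h : Legal ξ pos s) {w' : List Action} {a' : Action}
    (hw : w ++ [a] <+: s) (hw' : w' ++ [a'] <+: s) (hf : a.focus? = a'.focus?) :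
    w = w' ∧ a = a' := by
  have key : ∀ {w w' : List Action} {a a' : Action}, w ++ [a] <+: s → w' ++ [a'] <+: s →
      a.focus? = a'.focus? → w ++ [a] <+: w' ++ [a'] → w = w' ∧ a = a' := by
    intro w w' a a' hw hw' hf hp
    rcases prefix_snoc hp with h1 | h1
    · exfalso
      obtain ⟨b, g, L, rfl, hg, _⟩ := h _ _ hw
      refine h.fresh hw' hf.symm (mem_foci.mpr ⟨b, L, h1.subset (by simp)⟩)
    · simpa using h1
  rcases List.prefix_or_prefix_of_prefix hw hw' with hp | hp
  · exact key hw hw' hf hp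
  · obtain ⟨h1, h2⟩ := key hw' hw hf.symm hp
    exact ⟨h1.symm, h2.symm⟩
theorem Legal.mem_unique (h : Legal ξ pos s) {a' : Action} (ha : a ∈ s) (ha' : a' ∈ s)
    (hf : a.focus? = a'.focus?) : a = a' := by
  obtain ⟨u, hu⟩ := mem_split_prefix ha
  obtain ⟨u', hu'⟩ := mem_split_prefix ha'
  exact (h.at_unique hu hu' hf).2
theorem just_focus {m m' a : Action} (h : m.justifies a) (h' : m'.justifies a) :
    m.focus? = m'.focus? := by
  obtain ⟨p, f, L, q, i, M, rfl, _, rfl⟩ := justifies_iff.mp h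
  obtain ⟨p', f', L', q', i', M', rfl, _, hh⟩ := justifies_iff.mp h'
  simp only [proper.injEq] at hh
  have := List.append_inj' hh.2.1 rfl
  simp [focus?, this.1]
theorem Legal.just_unique (h : Legal ξ pos s) {m m' : Action} (hm : m ∈ s) (hm' : m' ∈ s)
    (h1 : m.justifies a) (h2 : m'.justifies a) : m = m' :=
  h.mem_unique hm hm' (just_focus h1 h2)
theorem Legal.ext (h : Legal ξ pos s) : ∀ f ∈ foci s, ξ <+: f := by
  induction s using List.reverseRecOn with
  | nil => simp [foci]
  | append_singleton w a ih =>
    obtain ⟨h1, b, f, L, rfl, _, h2⟩ := legal_snoc.mp h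
    intro g hg
    rw [foci_append, List.mem_append] at hg
    rcases hg with hg | hg
    · exact ih h1 g hg
    · simp [foci, focus?] at hg
      subst hg
      rcases h2 with ⟨_, _, rfl⟩ | ⟨n, m, _, _, hm, hj, _⟩
      · exact List.prefix_refl _
      · obtain ⟨p, f', L', q, i, M, rfl, _, hh⟩ := justifies_iff.mp hj
        simp only [proper.injEq] at hh
        rw [hh.2.1]
        exact (ih h1 _ (mem_foci.mpr ⟨_, _, hm⟩)).trans (List.prefix_append _ _)
theorem Legal.init_not_just (h : Legal ξ pos s) (hm : m ∈ s) (hf : a.focus? = some ξ) :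
    ¬ m.justifies a := by
  intro hj
  obtain ⟨p, f', L', q, i, M, rfl, _, rfl⟩ := justifies_iff.mp hj
  have := h.ext _ (mem_foci.mpr ⟨_, _, hm⟩)
  simp [focus?] at hf
  have := this.length_le
  rw [← hf] at this
  simp at this
theorem Legal.head (h : Legal ξ pos (a :: s)) : ∃ L, a = proper pos ξ L := by
  obtain ⟨b, f, L, rfl, _, h2⟩ := h [] a (by simp)
  rcases h2 with ⟨_, rfl, rfl⟩ | ⟨n, m, hn, _⟩
  · exact ⟨L, rfl⟩
  · simp at hn
theorem Legal.step (h : Legal ξ pos s) (hw : w ++ [a] <+: s) (hne : w ≠ []) :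
    ∃ n m, w.getLast? = some n ∧ n.isPositive = !a.isPositive ∧ m ∈ w ∧ m.justifies a ∧
      m.isPositive = !a.isPositive ∧ (a.isPositive = true → m ∈ view w) ∧
      (a.isPositive = false → m ∈ cov w) := by
  obtain ⟨b, f, L, rfl, _, h2⟩ := h _ _ hw
  rcases h2 with ⟨rfl, _⟩ | ⟨n, m, h⟩
  · exact absurd rfl hne
  · exact ⟨n, m, h⟩
theorem Legal.just_before (h : Legal ξ pos s) (hw : w ++ [a] <+: s) (hm : m ∈ s)
    (hj : m.justifies a) : m ∈ w ∧ m.isPositive = !a.isPositive ∧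
      (a.isPositive = true → m ∈ view w) ∧ (a.isPositive = false → m ∈ cov w) := by
  by_cases hne : w = []
  · subst hne
    obtain ⟨b, f, L, rfl, _, h2⟩ := h _ _ hw
    rcases h2 with ⟨_, _, rfl⟩ | ⟨n, m, hn, _⟩
    · exact absurd hj (h.init_not_just hm rfl)
    · simp at hn
  · obtain ⟨n, m', hn, hnp, hm', hj', hmp, h1, h2⟩ := h.step hw hne
    have hm's : m' ∈ s := hw.subset (by simp [hm'])
    obtain rfl := h.just_unique hm hm's hj hj'
    exact ⟨hm', hmp, h1, h2⟩
theorem Legal.view_neg (h : Legal ξ pos s) (hw : w ++ [a] <+: s) (ha : a.isPositive = false)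
    (hm : u ++ [m] <+: s) (hj : m.justifies a) : view (w ++ [a]) = view (u ++ [m]) ++ [a] := by
  have hmw := (h.just_before hw (hm.subset (by simp)) hj).1
  obtain ⟨u', v', rfl⟩ := List.append_of_mem hmw
  have hu' : u' ++ [m] <+: s := (List.IsPrefix.trans ⟨v' ++ [a], by simp⟩ hw)
  obtain ⟨rfl, _⟩ := h.at_unique hm hu' rfl
  apply view_neg_just _ _ ha hj
  intro x hx hjx
  have hxs : x ∈ s := hw.subset (by simp [hx])
  obtain rfl := h.just_unique hxs (hm.subset (by simp)) hjx hj
  obtain ⟨v1, v2, rfl⟩ := List.append_of_mem hx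
  have := (h.at_unique hm (w' := u ++ x :: v1) (a' := x)
    (List.IsPrefix.trans ⟨v2 ++ [a], by simp⟩ hw) rfl).1
  have := congrArg List.length this
  simp at this
theorem Legal.cov_pos (h : Legal ξ pos s) (hw : w ++ [a] <+: s) (ha : a.isPositive = true)
    (hm : u ++ [m] <+: s) (hj : m.justifies a) : cov (w ++ [a]) = cov (u ++ [m]) ++ [a] := by
  have had : a ≠ daimon := fun hd => h.dai (hd ▸ hw.subset (by simp))
  have := h.dual.view_neg (w := w.map Action.dual) (a := a.dual) (u := u.map Action.dual)
    (m := m.dual)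
    (by simpa using hw.map Action.dual) (by rw [pol_dual had, ha]; rfl)
    (by simpa using hm.map Action.dual) (justifies_dual.mpr hj)
  rw [cov, cov, List.map_append, List.map_append, List.map_singleton, List.map_singleton, this,
    List.map_append, List.map_singleton, dual_dual]
theorem view_single (a : Action) : view [a] = [a] := by
  obtain ⟨c, hc⟩ := view_snoc [] a
  have := (view_sublist [a]).length_le
  simp only [List.nil_append] at hc
  rw [hc] at this ⊢
  simp at this
  simp [this]
theorem cov_single (a : Action) : cov [a] = [a] := by
  simp [cov, view_single, dual_dual]
end Part4
section Part5
open Action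
theorem isPositive_proper (b : Bool) (f : Address) (L : Finset ℕ) :
    (proper b f L).isPositive = b := rfl
theorem diverge (c1 c2 : List Action) : c1 <+: c2 ∨ c2 <+: c1 ∨
    ∃ d x y, x ≠ y ∧ d ++ [x] <+: c1 ∧ d ++ [y] <+: c2 := by
  induction c1 generalizing c2 with
  | nil => left; simp
  | cons a t ih =>
    cases c2 with
    | nil => right; left; simp
    | cons b t2 =>
      by_cases hab : a = b
      · subst hab
        rcases ih t2 with h | h | ⟨d, x, y, h1, h2, h3⟩
        · left; simpa using h
        · right; left; simpa using h
        · right; right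
          exact ⟨a :: d, x, y, h1, by simpa using h2, by simpa using h3⟩
      · right; right
        exact ⟨[], a, b, hab, by simp, by simp⟩
theorem pre_mid {d c : List Action} {x k : Action} (h : d ++ [x] <+: c ++ [k]) (hne : x ≠ k) :
    ∃ w, c ++ [k] = d ++ x :: w ++ [k] := by
  rcases prefix_snoc h with ⟨w, h1⟩ | h1
  · exact ⟨w, by rw [← h1]; simp⟩
  · simp at h1; exact absurd h1.2 hne
variable {ξ : Address} {pos : Bool} {s u w : List Action} {a m : Action} {X Y : DSet}
theorem legal_ext_pos (hX : IsDesign (simpleBase ξ pos) X) (hY : IsDesign (simpleBase ξ (!pos)) Y)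
    (hp : Play X Y (w ++ [a])) (hw : Legal ξ pos w) (ha : a.isPositive = true) :
    LegalStep ξ pos w a := by
  obtain ⟨hpw, had, hvX, hvY⟩ := play_snoc.mp hp
  rw [view_pos w ha] at hvX
  have hchr := des_chr hX hvX
  have hst := hchr.2 _ _ (List.prefix_refl _)
  obtain ⟨b, f, L, rfl⟩ := focus_none had
  simp only [isPositive_proper] at ha
  subst ha
  by_cases hne : w = []
  · subst hne
    rcases hst with ⟨_, ⟨I, h⟩ | ⟨h, _⟩⟩ | ⟨b, hb, _⟩
    · cases h
      exact ⟨true, ξ, L, rfl, by simp [foci], Or.inl ⟨rfl, rfl, rfl⟩⟩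
    · cases h
    · simp [view_nil] at hb
  rcases hst with ⟨hh, _⟩ | ⟨n, hn, hnd, hnp, hfr, _, hj⟩
  · exact absurd hh (view_ne_nil hne)
  rw [view_getLast?] at hn
  simp [isPositive_proper] at hnp
  obtain ⟨m, hmv, hmj⟩ := hj rfl (by simp)
  have hmw := view_subset hmv
  have hmp : m.isPositive = false := by
    rw [List.map_append, List.map_singleton] at hvY
    rcases view_cases (w.map Action.dual) (proper true f L).dual with ⟨h, _⟩ | ⟨_, h, _⟩ |
      ⟨_, w1, m', w2, he, hj', hv⟩
    · simp [Action.dual, isPositive_proper] at h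
    · exact absurd (justifies_dual.mpr hmj) (h _ (List.mem_map_of_mem hmw))
    · rw [hv] at hvY
      have hst := (des_chr hY hvY).2 _ _ (List.prefix_refl _)
      rcases hst with ⟨hh, _⟩ | ⟨n', hn', hnd', hnp', _⟩
      · exact absurd hh (view_ne_nil (by simp))
      rw [view_getLast?] at hn'
      simp at hn'; subst hn'
      have hm'w : m'.dual ∈ w := by
        have : m' ∈ w.map Action.dual := by rw [he]; simp
        rw [List.mem_map] at this
        obtain ⟨y, hy, rfl⟩ := this
        rwa [dual_dual]
      have hj2 : m'.dual.justifies (proper true f L) := by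
        rw [← justifies_dual, dual_dual]; exact hj'
      obtain rfl := hw.just_unique hmw hm'w hmj hj2
      rw [pol_dual hnd']
      simp [Action.dual, isPositive_proper] at hnp'
      simp [hnp']
  refine ⟨true, f, L, rfl, ?_, Or.inr ⟨n, m, hn, hnp, hmw, hmj, hmp, fun _ => hmv, by simp⟩⟩
  intro hf
  obtain ⟨b', L', hk⟩ := mem_foci.mp hf
  obtain ⟨u, hu⟩ := mem_split_prefix hk
  have hlen : u.length + 1 ≤ w.length := by simpa using hu.length_le
  cases b' with
  | false =>
    by_cases hune : u = []
    · subst hune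
      obtain ⟨_, _, _, he, _, h2⟩ := hw _ _ hu
      rcases h2 with ⟨_, _, rfl⟩ | ⟨n, m, hn, _⟩
      · cases he
        exact hw.init_not_just hmw rfl hmj
      · simp at hn
    · obtain ⟨n', m', _, _, hm', hj', hmp', _⟩ := hw.step hu hune
      have : m = m' := by
        apply hw.mem_unique hmw (hu.subset (by simp [hm']))
        apply just_focus hmj
        obtain ⟨p, f, L, q, i, M, rfl, hi, hh⟩ := justifies_iff.mp hj'
        cases hh
        exact justifies_iff.mpr ⟨_, _, _, _, _, _, rfl, hi, rfl⟩
      subst this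
      simp [isPositive_proper, hmp] at hmp'
  | true =>
    have hc1 := (hpw.2 _ hu (by simp)).1
    rw [view_pos u rfl] at hc1
    have hchr1 := des_chr hX hc1
    rcases diverge (view u ++ [proper true f L']) (view w ++ [proper true f L]) with
      h | h | ⟨d, x, y, hxy, hx, hy⟩
    · rcases prefix_snoc h with h | h
      · exact hfr f rfl (mem_foci.mpr ⟨true, _, h.subset (List.mem_append_right _ (List.mem_singleton.mpr rfl))⟩)
      · have h1 := (List.append_inj' h rfl).1
        have hul : u.getLast? = some n := by rw [← view_getLast?, h1, view_getLast?, hn]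
        obtain ⟨u0, rfl⟩ := List.getLast?_eq_some_iff.mp hul
        obtain ⟨w0, rfl⟩ := List.getLast?_eq_some_iff.mp hn
        have := (hw.at_unique (List.IsPrefix.trans (List.prefix_append _ _) hu)
          (List.prefix_refl _) rfl).1
        subst this
        omega
    · rcases prefix_snoc h with h | h
      · have hst := hchr1.2 _ _ (List.prefix_refl _)
        rcases hst with ⟨hh, _⟩ | ⟨_, _, _, _, hfr', _⟩
        · rw [hh] at h; simp at h
        · exact hfr' f rfl (mem_foci.mpr ⟨true, _, h.subset (List.mem_append_right _ (List.mem_singleton.mpr rfl))⟩)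
      · have h1 := (List.append_inj' h rfl).1.symm
        have hul : u.getLast? = some n := by rw [← view_getLast?, h1, view_getLast?, hn]
        obtain ⟨u0, rfl⟩ := List.getLast?_eq_some_iff.mp hul
        obtain ⟨w0, rfl⟩ := List.getLast?_eq_some_iff.mp hn
        have := (hw.at_unique (List.IsPrefix.trans (List.prefix_append _ _) hu)
          (List.prefix_refl _) rfl).1
        subst this
        omega
    · obtain ⟨hcomp, hprop⟩ := hX.coherent _ hc1 _ hvX
      rcases hcomp d x y hx hy with h | ⟨hxn, hyn⟩
      · exact hxy h
      obtain ⟨_, fx, Lx, rfl⟩ := focus_none (neg_ne_dai hxn)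
      obtain ⟨_, fy, Ly, rfl⟩ := focus_none (neg_ne_dai hyn)
      simp only [isPositive_proper] at hxn hyn
      subst hxn hyn
      obtain ⟨w1, h1⟩ := pre_mid hx (by simp)
      obtain ⟨w2, h2⟩ := pre_mid hy (by simp)
      by_cases hff : fx = fy
      · subst hff
        apply hxy
        refine hw.mem_unique ?_ ?_ (show (proper false fx Lx).focus? = (proper false fx Ly).focus? from rfl)
        · have : proper false fx Lx ∈ view u ++ [proper true f L'] := hx.subset (by simp)
          simp only [List.mem_append, List.mem_singleton] at this
          rcases this with h | h
          · exact hu.subset (by simp [view_subset h])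
          · cases h
        · have : proper false fx Ly ∈ view w ++ [proper true f L] := hy.subset (by simp)
          simp only [List.mem_append, List.mem_singleton] at this
          rcases this with h | h
          · exact view_subset h
          · cases h
      · exact hprop d fx Lx w1 _ fy Ly w2 _ (by rw [h1]) (by rw [h2]) hff f rfl rfl
theorem play_legal (hX : IsDesign (simpleBase ξ pos) X) (hY : IsDesign (simpleBase ξ (!pos)) Y)
    (hp : Play X Y s) : Legal ξ pos s := by
  induction s using List.reverseRecOn with
  | nil => exact legal_nil
  | append_singleton w a ih =>
    have hw := ih (hp.prefix (List.prefix_append _ _))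
    refine legal_snoc.mpr ⟨hw, ?_⟩
    cases ha : a.isPositive with
    | true => exact legal_ext_pos hX hY hp hw ha
    | false =>
      have hp' := hp.symm
      rw [List.map_append, List.map_singleton] at hp'
      have := legal_ext_pos (pos := !pos) hY (by rwa [Bool.not_not]) hp' hw.dual
        (by rw [pol_dual (neg_ne_dai ha), ha]; rfl)
      have := legalStep_dual this (by rw [dai_mem_map_dual]; exact hw.dai)
      rwa [Bool.not_not, map_dual_dual, dual_dual] at this
end Part5
section Part6
open Action
def VV (q c : List Action) : Prop := ∃ w, w <+: q ∧ w ≠ [] ∧ c = view w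
def NN (ξ : Address) (pos : Bool) (q c : List Action) : Prop :=
  ∃ c0 f L, c = c0 ++ [proper false f L] ∧ ((c0 = [] ∧ pos = false ∧ f = ξ) ∨
    (VV q c0 ∧ ∃ b, c0.getLast? = some b ∧ b.isPositive = true ∧ b.justifies (proper false f L)))
def DN (ξ : Address) (pos : Bool) (q c : List Action) : Prop :=
  ∃ c0, c = c0 ++ [daimon] ∧ (NN ξ pos q c0 ∨ (c0 = [] ∧ pos = true)) ∧
    ∀ κ : Action, κ.isPositive = true → ¬ VV q (c0 ++ [κ])
def CD (ξ : Address) (pos : Bool) (q : List Action) : DSet :=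
  {c | VV q c ∨ NN ξ pos q c ∨ DN ξ pos q c}
variable {ξ : Address} {pos : Bool} {q s u w c d : List Action} {a m : Action}
theorem legal_view_steps (h : Legal ξ pos w) : Steps (ChrStep ξ pos) (view w) := by
  induction w using prefix_induction with
  | h w ih =>
    rcases List.eq_nil_or_concat' w with rfl | ⟨u, a, rfl⟩
    · exact steps_nil _
    by_cases hu : u = []
    · subst hu
      simp only [List.nil_append] at h ⊢
      obtain ⟨L, rfl⟩ := h.head
      rw [view_single]
      have := (steps_snoc (R := ChrStep ξ pos) (c := []) (x := proper pos ξ L)).mpr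
        ⟨steps_nil _, Or.inl ⟨rfl, Or.inl ⟨L, rfl⟩⟩⟩
      simpa using this
    · obtain ⟨n, m, hn, hnp, hm, hj, hmp, h1, h2⟩ := h.step (List.prefix_refl _) hu
      have hnd : n ≠ daimon := fun hd => h.dai (by simp [hd ▸ List.mem_of_getLast? hn])
      have hmd : m ≠ daimon := fun hd => h.dai (by simp [hd ▸ hm])
      cases ha : a.isPositive with
      | true =>
        rw [view_pos u ha, steps_snoc]
        refine ⟨ih u (by simp) (h.pre (List.prefix_append _ _)), Or.inr ⟨n, by rwa [view_getLast?],
          hnd, by simp [hnp], ?_, by simp [ha], fun _ _ => ⟨m, h1 ha, hj⟩⟩⟩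
        intro f hf hfv
        obtain ⟨b, L, hb⟩ := mem_foci.mp hfv
        exact h.fresh (List.prefix_refl _) hf (mem_foci.mpr ⟨b, L, view_subset hb⟩)
      | false =>
        obtain ⟨u', hu'⟩ := mem_split_prefix hm
        rw [h.view_neg (List.prefix_refl _) ha (hu'.trans (List.prefix_append _ _)) hj, steps_snoc]
        refine ⟨ih _ (Nat.lt_of_le_of_lt hu'.length_le (by simp))
          (h.pre (hu'.trans (List.prefix_append _ _))),
          Or.inr ⟨m, by simp [view_getLast?], hmd, by simp [hmp],
            ?_, fun _ => hj, by simp [ha]⟩⟩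
        intro f hf hfv
        obtain ⟨b, L, hb⟩ := mem_foci.mp hfv
        exact h.fresh (List.prefix_refl _) hf (mem_foci.mpr ⟨b, L, hu'.subset (view_subset hb)⟩)
theorem Legal.view_inj (h : Legal ξ pos q) (hu : u <+: q) (hw : w <+: q) (he : view u = view w) :
    u = w := by
  rcases List.eq_nil_or_concat' u with rfl | ⟨u0, a, rfl⟩
  · exact (view_eq_nil (he.symm)).symm
  have hl : w.getLast? = some a := by rw [← view_getLast?, ← he, view_getLast?]; simp
  obtain ⟨w0, rfl⟩ := List.getLast?_eq_some_iff.mp hl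
  rw [(h.at_unique hu hw rfl).1]
theorem vv_prefix (h : VV q c) (hd : d <+: c) (hne : d ≠ []) : VV q d := by
  obtain ⟨w, hw, hwne, rfl⟩ := h
  obtain ⟨x, hx, rfl⟩ := prefix_view w d hd
  exact ⟨x, hx.trans hw, fun h => hne (by rw [h, view_nil]), rfl⟩
theorem vv_snoc (h : VV q (c ++ [a])) : ∃ w, w ++ [a] <+: q ∧ view (w ++ [a]) = c ++ [a] := by
  obtain ⟨w, hw, hwne, he⟩ := h
  have hl : w.getLast? = some a := by rw [← view_getLast?, ← he]; simp
  obtain ⟨w0, rfl⟩ := List.getLast?_eq_some_iff.mp hl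
  exact ⟨w0, hw, he.symm⟩
theorem vv_snoc_pos (h : VV q (c ++ [a])) (ha : a.isPositive = true) :
    ∃ w, w ++ [a] <+: q ∧ view w = c := by
  obtain ⟨w, hw, he⟩ := vv_snoc h
  rw [view_pos w ha] at he
  exact ⟨w, hw, (List.append_inj' he rfl).1⟩
theorem vv_neg_nn (h : Legal ξ pos q) (hc : VV q (c ++ [a])) (ha : a.isPositive = false) :
    NN ξ pos q (c ++ [a]) := by
  obtain ⟨w, hw, he⟩ := vv_snoc hc
  obtain ⟨b, f, L, rfl⟩ := h.prop (hw.subset (List.mem_append_right _ (List.mem_singleton.mpr rfl)))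
  simp only [isPositive_proper] at ha
  subst ha
  by_cases hwne : w = []
  · subst hwne
    simp only [List.nil_append] at he hw
    rw [view_single] at he
    obtain ⟨L', hL⟩ := (h.pre hw).head
    have : c = [] := (List.append_inj' (s₁ := []) he rfl).1.symm
    subst this
    cases hL
    exact ⟨[], ξ, L, rfl, Or.inl ⟨rfl, rfl, rfl⟩⟩
  · obtain ⟨n, m, hn, hnp, hm, hj, hmp, h1, h2⟩ := h.step hw hwne
    obtain ⟨u', hu'⟩ := mem_split_prefix hm
    have hu'q := hu'.trans ((List.prefix_append w [_]).trans hw)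
    rw [h.view_neg hw rfl hu'q hj] at he
    have := (List.append_inj' he rfl).1
    exact ⟨c, f, L, rfl, Or.inr ⟨⟨_, hu'q, by simp, this.symm⟩, m, by rw [← this, view_getLast?]; simp,
      hmp, hj⟩⟩
theorem nn_steps (h : Legal ξ pos q) (hc : NN ξ pos q c) : Steps (ChrStep ξ pos) c := by
  obtain ⟨c0, f, L, rfl, ⟨rfl, rfl, rfl⟩ | ⟨⟨w, hw, hwne, rfl⟩, b, hb, hbp, hj⟩⟩ := hc
  · exact steps_snoc.mpr ⟨steps_nil _, Or.inl ⟨rfl, Or.inl ⟨L, rfl⟩⟩⟩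
  · have hwl := h.pre hw
    rw [view_getLast?] at hb
    have hbd : b ≠ daimon := fun hd => hwl.dai (by simp [hd ▸ List.mem_of_getLast? hb])
    refine steps_snoc.mpr ⟨legal_view_steps hwl, Or.inr ⟨b, by rwa [view_getLast?], hbd,
      by simp [hbp, isPositive_proper], ?_, fun _ => hj, by simp [isPositive_proper]⟩⟩
    rintro _ ⟨⟩ hfv
    obtain ⟨b', L', hb'⟩ := mem_foci.mp hfv
    have hb'w := view_subset hb'
    obtain ⟨w', rfl⟩ := List.getLast?_eq_some_iff.mp hb
    obtain ⟨u, hu⟩ := mem_split_prefix hb'w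
    have hj' : b.justifies (proper b' f L') := by
      obtain ⟨_, _, _, _, _, _, rfl, hi, hh⟩ := justifies_iff.mp hj
      cases hh
      exact justifies_iff.mpr ⟨_, _, _, _, _, _, rfl, hi, rfl⟩
    have hbu := (hwl.just_before hu (by simp) hj').1
    obtain ⟨bb, g, LL, rfl⟩ := focus_none hbd
    refine hwl.fresh (List.prefix_refl _) rfl (mem_foci.mpr ⟨bb, LL, ?_⟩)
    rcases prefix_snoc hu with h1 | h1
    · exact h1.subset (List.mem_append_left _ hbu)
    · have := (List.append_inj' h1 rfl).1
      rw [← this]; exact hbu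
theorem nn_last (hc : NN ξ pos q c) : ∃ f L, c.getLast? = some (proper false f L) := by
  obtain ⟨c0, f, L, rfl, _⟩ := hc
  exact ⟨f, L, by simp⟩
theorem cd_chr (h : Legal ξ pos q) (hc : c ∈ CD ξ pos q) : Chr ξ pos c := by
  rcases hc with hc | hc | hc
  · obtain ⟨w, hw, hwne, rfl⟩ := hc
    exact ⟨view_ne_nil hwne, legal_view_steps (h.pre hw)⟩
  · refine ⟨?_, nn_steps h hc⟩
    obtain ⟨c0, f, L, rfl, _⟩ := hc
    simp
  · obtain ⟨c0, rfl, h1, h2⟩ := hc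
    refine ⟨by simp, ?_⟩
    rcases h1 with h1 | ⟨rfl, rfl⟩
    · obtain ⟨f, L, hl⟩ := nn_last h1
      exact steps_snoc.mpr ⟨nn_steps h h1, Or.inr ⟨_, hl, by simp, by simp [isPositive],
        by simp [focus?], by simp [isPositive], by simp⟩⟩
    · exact steps_snoc.mpr ⟨steps_nil _, Or.inl ⟨rfl, Or.inr ⟨rfl, rfl⟩⟩⟩
theorem nn_prefix (hc : NN ξ pos q c) (hd : d <+: c) (hne : d ≠ []) : VV q d ∨ NN ξ pos q d := by
  have hc' := hc
  obtain ⟨c0, f, L, rfl, h⟩ := hc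
  rcases prefix_snoc hd with h1 | rfl
  · rcases h with ⟨rfl, _⟩ | ⟨h, _⟩
    · exact absurd (List.prefix_nil.mp h1) hne
    · exact Or.inl (vv_prefix h h1 hne)
  · exact Or.inr hc'
theorem cd_prefix (hc : c ∈ CD ξ pos q) (hd : d <+: c) (hne : d ≠ []) : d ∈ CD ξ pos q := by
  rcases hc with hc | hc | hc
  · exact Or.inl (vv_prefix hc hd hne)
  · rcases nn_prefix hc hd hne with h | h
    · exact Or.inl h
    · exact Or.inr (Or.inl h)
  · have hc' := hc
    obtain ⟨c0, rfl, h1, h2⟩ := hc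
    rcases prefix_snoc hd with h3 | rfl
    · rcases h1 with h1 | ⟨rfl, _⟩
      · rcases nn_prefix h1 h3 hne with h | h
        · exact Or.inl h
        · exact Or.inr (Or.inl h)
      · exact absurd (List.prefix_nil.mp h3) hne
    · exact Or.inr (Or.inr hc')
theorem chr_turn {k k' : Action} (h1 : Chr ξ pos (c ++ [k])) (h2 : Chr ξ pos (c ++ [k'])) :
    k.isPositive = k'.isPositive := by
  have h1 := h1.2 _ _ (List.prefix_refl _)
  have h2 := h2.2 _ _ (List.prefix_refl _)
  have key : ∀ k, ChrStep ξ pos c k → (c = [] ∧ k.isPositive = pos) ∨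
      ∃ b, c.getLast? = some b ∧ k.isPositive ≠ b.isPositive := by
    rintro k (⟨rfl, ⟨I, rfl⟩ | ⟨rfl, rfl⟩⟩ | ⟨b, hb, _, h, _⟩)
    · exact Or.inl ⟨rfl, rfl⟩
    · exact Or.inl ⟨rfl, rfl⟩
    · exact Or.inr ⟨b, hb, h⟩
  rcases key _ h1 with ⟨h, g1⟩ | ⟨b, hb, g1⟩ <;> rcases key _ h2 with ⟨h', g2⟩ | ⟨b', hb', g2⟩
  · rw [g1, g2]
  · rw [h] at hb'; simp at hb'
  · rw [h'] at hb; simp at hb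
  · rw [hb] at hb'; cases hb'
    revert g1 g2
    cases k.isPositive <;> cases k'.isPositive <;> cases b.isPositive <;> simp
theorem cd_pos (hc : c ++ [a] ∈ CD ξ pos q) (ha : a.isPositive = true) :
    VV q (c ++ [a]) ∨ (a = daimon ∧ ∀ κ : Action, κ.isPositive = true → ¬ VV q (c ++ [κ])) := by
  rcases hc with hc | hc | hc
  · exact Or.inl hc
  · obtain ⟨c0, f, L, he, _⟩ := hc
    have := (List.append_inj' he rfl).2
    simp at this; subst this; simp [isPositive] at ha
  · obtain ⟨c0, he, _, h2⟩ := hc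
    obtain ⟨h1, h3⟩ := List.append_inj' he rfl
    simp at h3; subst h3 h1
    exact Or.inr ⟨rfl, h2⟩
theorem cd_proper (hc : c ++ [a] ∈ CD ξ pos q) (ha : a ≠ daimon) :
    VV q (c ++ [a]) ∨ NN ξ pos q (c ++ [a]) := by
  rcases hc with hc | hc | hc
  · exact Or.inl hc
  · exact Or.inr hc
  · obtain ⟨c0, he, _, h2⟩ := hc
    obtain ⟨h1, h3⟩ := List.append_inj' he rfl
    simp at h3; exact absurd h3 ha
theorem cd_neg (h : Legal ξ pos q) (hc : c ++ [a] ∈ CD ξ pos q) (ha : a.isPositive = false) :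
    NN ξ pos q (c ++ [a]) := by
  rcases cd_proper hc (neg_ne_dai ha) with h1 | h1
  · exact vv_neg_nn h h1 ha
  · exact h1
theorem just_of_focus {b a a' : Action} (h : b.justifies a) (hf : a.focus? = a'.focus?) :
    b.justifies a' := by
  obtain ⟨_, _, _, _, _, _, rfl, hi, rfl⟩ := justifies_iff.mp h
  cases a' with
  | daimon => simp [focus?] at hf
  | proper p g M =>
    simp [focus?] at hf; subst hf
    exact justifies_iff.mpr ⟨_, _, _, _, _, _, rfl, hi, rfl⟩
theorem cd_same_focus (h : Legal ξ pos q) (hc : c ++ [a] ∈ CD ξ pos q) (hd : d ++ [m] ∈ CD ξ pos q)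
    {f : Address} (hf : a.focus? = some f) (hf' : m.focus? = some f) :
    c = d := by
  have had : a ≠ daimon := by rintro rfl; simp [focus?] at hf
  have hmd : m ≠ daimon := by rintro rfl; simp [focus?] at hf'
  have hff : a.focus? = m.focus? := by rw [hf, hf']
  have key : ∀ {c d : List Action} {a m : Action}, NN ξ pos q (c ++ [a]) → VV q (d ++ [m]) →
      m.isPositive = true → a.focus? = m.focus? → d = c := by
    intro c d a m hc hd hm hff
    obtain ⟨c0, f, L, he, h1⟩ := hc
    obtain ⟨h2, h3⟩ := List.append_inj' he rfl
    simp at h3; subst h2 h3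
    obtain ⟨w, hw, hw2⟩ := vv_snoc_pos hd hm
    rcases h1 with ⟨rfl, rfl, rfl⟩ | ⟨⟨w', hw', _, rfl⟩, b, hb, hbp, hj⟩
    · by_cases hwne : w = []
      · subst hwne; exact hw2.symm
      · obtain ⟨n, m', hn, hnp, hm', hj, _⟩ := h.step hw hwne
        exact absurd hj (h.init_not_just (hw.subset (by simp [hm'])) hff.symm)
    · have := h.just_before hw (hw'.subset (List.mem_of_getLast? (by rwa [view_getLast?] at hb)))
        (just_of_focus hj hff)
      simp [hm, hbp] at this
  have key2 : ∀ {c d : List Action} {a m : Action}, NN ξ pos q (c ++ [a]) → NN ξ pos q (d ++ [m]) →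
      a.focus? = m.focus? → c = d := by
    intro c d a m hc hd hff
    obtain ⟨c0, f, L, he, h1⟩ := hc
    obtain ⟨h2, h3⟩ := List.append_inj' he rfl
    simp at h3; subst h2 h3
    obtain ⟨c0, f', L', he, h1'⟩ := hd
    obtain ⟨h2, h3⟩ := List.append_inj' he rfl
    simp at h3; subst h2 h3
    rcases h1 with ⟨rfl, rfl, rfl⟩ | ⟨⟨w, hw, _, rfl⟩, b, hb, hbp, hj⟩ <;>
      rcases h1' with ⟨rfl, _, rfl⟩ | ⟨⟨w', hw', _, rfl⟩, b', hb', hbp', hj'⟩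
    · rfl
    · rw [view_getLast?] at hb'
      exact absurd (just_of_focus hj' hff.symm)
        (h.init_not_just (hw'.subset (List.mem_of_getLast? hb')) rfl)
    · rw [view_getLast?] at hb
      exact absurd (just_of_focus hj hff)
        (h.init_not_just (hw.subset (List.mem_of_getLast? hb)) rfl)
    · rw [view_getLast?] at hb hb'
      obtain ⟨w0, rfl⟩ := List.getLast?_eq_some_iff.mp hb
      obtain ⟨w1, rfl⟩ := List.getLast?_eq_some_iff.mp hb'
      obtain ⟨rfl, rfl⟩ := h.at_unique hw hw' (just_focus (just_of_focus hj hff) hj')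
      rfl
  rcases cd_proper hc had with hc | hc <;> rcases cd_proper hd hmd with hd | hd
  · obtain ⟨w, hw, he⟩ := vv_snoc hc
    obtain ⟨w', hw', he'⟩ := vv_snoc hd
    obtain ⟨rfl, rfl⟩ := h.at_unique hw hw' hff
    exact (List.append_inj' (he.symm.trans he') rfl).1
  · cases ha : a.isPositive with
    | true => exact key hd hc ha hff.symm
    | false =>
      exact key2 (vv_neg_nn h hc ha) hd hff
  · cases ha : m.isPositive with
    | true => exact (key hc hd ha hff).symm
    | false =>
      exact key2 hc (vv_neg_nn h hd ha) hff
  · exact key2 hc hd hff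
theorem cd_design (h : Legal ξ pos q) : IsDesign (simpleBase ξ pos) (CD ξ pos q) where
  chron c hc := chr_iff.mpr (cd_chr h hc)
  prefixClosed c hc d hd hne := cd_prefix hc hd hne
  coherent c hc d hd := by
    constructor
    · intro w k1 k2 h1 h2
      have h1 := cd_prefix hc h1 (by simp)
      have h2 := cd_prefix hd h2 (by simp)
      have ht := chr_turn (cd_chr h h1) (cd_chr h h2)
      cases hk : k1.isPositive with
      | false => right; exact ⟨rfl, by rw [← ht, hk]⟩
      | true =>
        left
        rw [hk] at ht
        rcases cd_pos h1 hk with h1 | ⟨h1, h1'⟩ <;> rcases cd_pos h2 ht.symm with h2 | ⟨h2, h2'⟩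
        · obtain ⟨u, hu, he⟩ := vv_snoc_pos h1 hk
          obtain ⟨u', hu', he'⟩ := vv_snoc_pos h2 ht.symm
          have := h.view_inj ((List.prefix_append _ _).trans hu) ((List.prefix_append _ _).trans hu')
            (he.trans he'.symm)
          subst this
          rcases List.prefix_or_prefix_of_prefix hu hu' with hp | hp
          · simpa using hp
          · symm; simpa using hp
        · exact absurd h1 (h2' _ hk)
        · exact absurd h2 (h1' _ ht.symm)
        · rw [h1, h2]
    · intro w f1 I1 w1 s1 f2 I2 w2 s2 h1 h2 hne f hf1 hf2
      have h1 := cd_prefix hc h1 (by simp)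
      have h2 := cd_prefix hd h2 (by simp)
      have := cd_same_focus h h1 h2 hf1 hf2
      simp at this
      exact hne this.1.1
  maxPos c hc hmax := by
    rcases List.eq_nil_or_concat' c with rfl | ⟨u, a, rfl⟩
    · exact absurd rfl (cd_chr h hc).1
    refine ⟨a, by simp, ?_⟩
    cases ha : a.isPositive with
    | true => rfl
    | false =>
      exfalso
      have hn := cd_neg h hc ha
      by_cases hk : ∃ κ : Action, κ.isPositive = true ∧ VV q (u ++ [a] ++ [κ])
      · obtain ⟨κ, _, hk⟩ := hk
        exact hmax κ (Or.inl hk)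
      · push Not at hk
        exact hmax daimon (Or.inr (Or.inr ⟨_, rfl, Or.inl hn, hk⟩))
  posNonempty hp := by
    rw [isPositive_simple] at hp
    subst hp
    by_cases hq : q = []
    · subst hq
      refine ⟨[daimon], Or.inr (Or.inr ⟨[], rfl, Or.inr ⟨rfl, rfl⟩, ?_⟩)⟩
      rintro κ _ ⟨w, hw, hne, _⟩
      exact hne (List.prefix_nil.mp hw)
    · exact ⟨view q, Or.inl ⟨q, List.prefix_refl _, hq, rfl⟩⟩
end Part6
section Part7
open Action
def VE (s w : List Action) : Prop := ∃ u, u <+: s ∧ cov w = cov u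
variable {ξ : Address} {pos : Bool} {q s u v w c d : List Action} {a m κ : Action} {X Y : DSet}
theorem ve_vv (h : VE s w) (hne : w ≠ []) : VV (s.map dual) (view (w.map dual)) := by
  obtain ⟨u, hu, he⟩ := h
  refine ⟨u.map dual, hu.map _, ?_, ?_⟩
  · intro h
    simp at h; subst h
    rw [cov_nil] at he
    exact cov_ne_nil hne he
  · rw [view_dual, he, cov_dual]
theorem vv_ve (h : VV (s.map dual) (view (w.map dual))) : VE s w := by
  obtain ⟨u, hu, _, he⟩ := h
  refine ⟨u.map dual, prefix_map_dual hu, ?_⟩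
  rw [cov, he, cov_map_dual]
theorem ve_nil : VE s [] := ⟨[], by simp, rfl⟩
theorem Legal.nodup (h : Legal ξ pos s) : s.Nodup := by
  induction s using List.reverseRecOn with
  | nil => simp
  | append_singleton w a ih =>
    rw [List.nodup_append]
    refine ⟨ih (h.pre (List.prefix_append _ _)), by simp, ?_⟩
    rintro x hx y hy rfl
    simp at hy; subst hy
    obtain ⟨b, f, L, rfl⟩ := h.prop (a := x) (by simp)
    exact h.fresh (List.prefix_refl _) rfl (mem_foci.mpr ⟨b, L, hx⟩)
theorem ve_mem (h : VE s (w ++ [a])) : a ∈ s := by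
  obtain ⟨u, hu, he⟩ := h
  have : a ∈ u := by
    apply List.mem_of_getLast?
    rw [← cov_getLast? u, ← he, cov_getLast?]; simp
  exact hu.subset this
theorem Legal.alt (h : Legal ξ pos s) {b : Action} (hw : w ++ [b] ++ [a] <+: s) :
    b.isPositive = !a.isPositive := by
  obtain ⟨n, m, hn, hp, _⟩ := h.step hw (by simp)
  simp at hn; subst hn; exact hp
theorem play_ve_neg (hp : Play X (CD ξ pos (s.map dual)) (w ++ [κ])) (hk : κ.isPositive = false) :
    VE s (w ++ [κ]) ∧ VE s w := by
  obtain ⟨_, hd, _, hY⟩ := play_snoc.mp hp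
  have hkd : κ.dual.isPositive = true := by rw [pol_dual hd, hk]; rfl
  rw [List.map_append, List.map_singleton, view_pos _ hkd] at hY
  rcases cd_pos hY hkd with h | ⟨h, _⟩
  · constructor
    · apply vv_ve
      rwa [List.map_append, List.map_singleton, view_pos _ hkd]
    · by_cases hw : w = []
      · subst hw; exact ve_nil
      · exact vv_ve (vv_prefix h (List.prefix_append _ _) (view_ne_nil (by simpa using hw)))
  · exact absurd h (dual_ne_dai hd)
theorem play_ve (hl : Legal ξ pos v) (hp : Play X (CD ξ (!pos) (s.map dual)) v) (hu : u <+: v)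
    (h : u ≠ v ∨ ∀ b, v.getLast? = some b → b.isPositive = false) : VE s u := by
  rcases List.eq_nil_or_concat' u with rfl | ⟨u0, b, rfl⟩
  · exact ve_nil
  cases hb : b.isPositive with
  | false => exact (play_ve_neg (hp.prefix hu) hb).1
  | true =>
    rcases ext_cases hu with rfl | ⟨k, hk⟩
    · rcases h with h | h
      · exact absurd rfl h
      · have := h b (by simp)
        simp [hb] at this
    · have := hl.alt hk
      exact (play_ve_neg (hp.prefix hk) (by rw [hb] at this; simpa using this.symm)).2
theorem cd_orth (hs : Legal ξ pos s) (hX : IsDesign (simpleBase ξ pos) X)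
    (ha : ∀ v κ, Play X (CD ξ (!pos) (s.map dual)) v → Legal ξ pos v → (∀ u, u <+: v → VE s u) →
      κ.isPositive = false → VE s (v ++ [κ]) → view (v ++ [κ]) ∈ X)
    (hb : ∀ v κ, Play X (CD ξ (!pos) (s.map dual)) v → Legal ξ pos v → (∀ u, u <+: v → VE s u) →
      v ≠ [] → κ ≠ daimon → κ.isPositive = true → view (v ++ [κ]) ∈ X →
      ∃ m ∈ v, m.justifies κ ∧ m.isPositive = false) :
    OrthP X (CD ξ (!pos) (s.map dual)) := by
  have hY := cd_design hs.dual
  refine ⟨⟨s.length + 1, ?_⟩, ?_, ?_⟩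
  · intro v hv
    have hl := play_legal hX hY hv
    have hsub : v.dropLast ⊆ s := by
      intro x hx
      obtain ⟨u, hu⟩ := mem_split_prefix hx
      apply ve_mem (w := u)
      apply play_ve hl hv (hu.trans (List.dropLast_prefix v))
      left
      rintro rfl
      have := hu.length_le
      simp at this
    have := ((hl.pre (List.dropLast_prefix v)).nodup.subperm hsub).length_le
    simp at this
    omega
  · intro v κ hv hkd hkp hvX
    have hl := play_legal hX hY hv
    have hch := des_chr hX hvX
    have hkn : κ.dual.isPositive = false := by rw [pol_dual hkd, hkp]; rfl
    by_cases hne : v = []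
    · subst hne
      rw [List.nil_append, view_single] at hvX hch
      rcases chr_head hch with ⟨I, t, h⟩ | ⟨h, _⟩
      · simp at h
        obtain ⟨rfl, rfl⟩ := h
        simp only [isPositive_proper] at hkp
        subst hkp
        right; left
        refine ⟨[], ξ, I, ?_, Or.inl ⟨rfl, rfl, rfl⟩⟩
        simp [view_single, Action.dual]
      · simp at h; exact absurd h hkd
    · have hlast : ∀ b, v.getLast? = some b → b.isPositive = false := by
        intro b hb
        rw [view_pos v hkp] at hvX hch
        rcases hch.2 _ _ (List.prefix_refl _) with ⟨h, _⟩ | ⟨b', hb', _, hp, _⟩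
        · exact absurd h (view_ne_nil hne)
        · rw [view_getLast?, hb] at hb'
          cases hb'
          rw [hkp] at hp
          simpa using hp.symm
      have hve : ∀ u, u <+: v → VE s u := fun u hu => play_ve hl hv hu (Or.inr hlast)
      obtain ⟨m, hm, hj, hmp⟩ := hb v κ hv hl hve hne hkd hkp hvX
      right; left
      rw [List.map_append, List.map_singleton]
      obtain ⟨_, f, L, rfl⟩ := focus_none hkd
      simp only [isPositive_proper] at hkp
      subst hkp
      rcases view_cases (v.map dual) (proper true f L).dual with ⟨h, _⟩ | ⟨_, h, _⟩ |
        ⟨_, w1, m', w2, he, hj', hvw⟩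
      · rw [hkn] at h; cases h
      · exact absurd (justifies_dual.mpr hj) (h _ (List.mem_map_of_mem hm))
      · rw [hvw]
        have hpre : (w1 ++ [m']).map dual <+: v :=
          prefix_map_dual ⟨w2, by rw [he]; simp⟩
        have hm' : m'.dual ∈ v := hpre.subset (by simp)
        have : m'.dual = m := hl.just_unique hm' hm
          (by rw [← justifies_dual, dual_dual]; exact hj') hj
        have := ve_vv (hve _ hpre) (by simp)
        rw [map_dual_dual] at this
        refine ⟨_, f, L, rfl, Or.inr ⟨this, m', by simp [view_getLast?], ?_, hj'⟩⟩
        rw [← dual_dual m', ‹m'.dual = m›, pol_dual (neg_ne_dai hmp), hmp]; rfl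
  · intro v κ hv hkn hvY
    have hl := play_legal hX hY hv
    have hkd : κ.dual.isPositive = true := by rw [pol_dual (neg_ne_dai hkn), hkn]; rfl
    have hvY' := hvY
    rw [List.map_append, List.map_singleton, view_pos _ hkd] at hvY
    rcases cd_pos hvY hkd with h | ⟨h, _⟩
    · refine ha v κ hv hl ?_ hkn ?_
      · intro u hu
        by_cases huv : u = v
        · subst huv
          by_cases hw : u = []
          · subst hw; exact ve_nil
          · exact vv_ve (vv_prefix h (List.prefix_append _ _) (view_ne_nil (by simpa using hw)))
        · exact play_ve hl hv hu (Or.inl huv)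
      · apply vv_ve
        rwa [List.map_append, List.map_singleton, view_pos _ hkd]
    · exact absurd h (dual_ne_dai (neg_ne_dai hkn))
end Part7
section Part8
open Action
variable {ξ : Address} {pos : Bool} {q s u v w c d t : List Action} {a m κ : Action}
  {X Y D E : DSet}
theorem ve_view (h : VE s w) (hne : w ≠ [])
    (hE : ∀ u, u <+: s → u ≠ [] → view (u.map dual) ∈ E) : view (w.map dual) ∈ E := by
  obtain ⟨u, hu, he⟩ := h
  rw [view_dual, he, ← view_dual]
  apply hE u hu
  rintro rfl
  rw [cov_nil] at he
  exact cov_ne_nil hne he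
theorem cd_orth_of (hs : Legal ξ pos s) (hX : IsDesign (simpleBase ξ pos) X)
    (hE : IsDesign (simpleBase ξ (!pos)) E)
    (hsE : ∀ u, u <+: s → u ≠ [] → view (u.map dual) ∈ E) (ho : OrthP X E) :
    OrthP X (CD ξ (!pos) (s.map dual)) := by
  have hplay : ∀ v, Play X (CD ξ (!pos) (s.map dual)) v → (∀ u, u <+: v → VE s u) → Play X E v := by
    intro v hv hve
    exact ⟨hv.1, fun w hw hne => ⟨(hv.2 w hw hne).1, ve_view (hve w hw) hne hsE⟩⟩
  apply cd_orth hs hX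
  · intro v κ hv hl hve hk hvk
    exact ho.2.2 v κ (hplay v hv hve) hk (ve_view hvk (by simp) hsE)
  · intro v κ hv hl hve hne hkd hkp hvX
    have h1 := ho.2.1 v κ (hplay v hv hve) hkd hkp hvX
    have hl := play_legal hX hE (play_snoc.mpr ⟨hplay v hv hve, hkd, hvX, h1⟩)
    obtain ⟨n, m, _, _, hm, hj, hmp, _⟩ := hl.step (List.prefix_refl _) hne
    exact ⟨m, hm, hj, by rw [hmp, hkp]; rfl⟩
theorem cd_nil_orth (hX : IsDesign (simpleBase ξ pos) X) : OrthP X (CD ξ (!pos) []) := by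
  have := cd_orth (s := []) legal_nil hX (by
    rintro v κ _ _ _ _ ⟨u, hu, he⟩
    rw [List.prefix_nil.mp hu, cov_nil] at he
    exact absurd he (cov_ne_nil (by simp))) (by
    rintro v κ _ _ h hne
    obtain ⟨u, hu, he⟩ := h v (List.prefix_refl _)
    rw [List.prefix_nil.mp hu, cov_nil] at he
    exact absurd he (cov_ne_nil hne))
  exact this
def perp (A : Behaviour ξ true) : Set DSet := orthSet ξ true A.designs
theorem mem_perp {A : Behaviour ξ true} :
    E ∈ perp A ↔ IsDesign (simpleBase ξ false) E ∧ ∀ D ∈ A.designs, OrthP D E := by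
  simp only [perp, orthSet, Set.mem_ofPred_eq, if_true]
  constructor
  · rintro ⟨h1, h2⟩
    exact ⟨h1, fun D hD => (conv_iff (A.isDesign D hD) h1).mp (h2 D hD)⟩
  · rintro ⟨h1, h2⟩
    exact ⟨h1, fun D hD => (conv_iff (A.isDesign D hD) h1).mpr (h2 D hD)⟩
theorem mem_biorth {S : Set DSet} :
    D ∈ biorth ξ true S ↔ IsDesign (simpleBase ξ true) D ∧ ∀ E ∈ orthSet ξ true S, OrthP D E := by
  simp only [biorth]
  constructor
  · rintro ⟨h1, h2⟩
    refine ⟨h1, fun E hE => ?_⟩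
    have := h2 E hE
    simp at this
    exact (conv_iff h1 hE.1).mp this
  · rintro ⟨h1, h2⟩
    refine ⟨h1, fun E hE => ?_⟩
    simp
    exact (conv_iff h1 hE.1).mpr (h2 E hE)
theorem mem_beh {A : Behaviour ξ true} :
    D ∈ A.designs ↔ IsDesign (simpleBase ξ true) D ∧ ∀ E ∈ perp A, OrthP D E := by
  refine Iff.trans ?_ (mem_biorth (S := A.designs))
  have := A.closed
  constructor
  · intro h; rw [← this]; exact h
  · intro h; rw [this]; exact h
def VisS (A : Behaviour ξ true) (s : List Action) : Prop :=
  ∃ D ∈ A.designs, ∃ E ∈ perp A, Play D E s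
theorem perp_nil (A : Behaviour ξ true) : CD ξ false [] ∈ perp A :=
  mem_perp.mpr ⟨cd_design legal_nil, fun D hD => cd_nil_orth (A.isDesign D hD)⟩
theorem orth_cd_nil (hX : IsDesign (simpleBase ξ false) X) : OrthP (CD ξ true []) X :=
  (cd_nil_orth (pos := false) hX).symm
theorem beh_nil (A : Behaviour ξ true) : CD ξ true [] ∈ A.designs :=
  mem_beh.mpr ⟨cd_design legal_nil, fun E hE => orth_cd_nil (mem_perp.mp hE).1⟩
theorem VisS.legal {A : Behaviour ξ true} (h : VisS A s) : Legal ξ true s := by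
  obtain ⟨D, hD, E, hE, hp⟩ := h
  exact play_legal (A.isDesign D hD) (mem_perp.mp hE).1 hp
theorem VisS.cd_perp {A : Behaviour ξ true} (h : VisS A s) : CD ξ false (s.map dual) ∈ perp A := by
  have hl := h.legal
  obtain ⟨D, hD, E, hE, hp⟩ := h
  refine mem_perp.mpr ⟨cd_design hl.dual, fun D' hD' => ?_⟩
  exact cd_orth_of hl (A.isDesign D' hD') (mem_perp.mp hE).1 (fun u hu hne => (hp.2 u hu hne).2)
    ((mem_perp.mp hE).2 D' hD')
theorem VisS.cd_mem {A : Behaviour ξ true} (h : VisS A s) : CD ξ true s ∈ A.designs := by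
  have hl := h.legal
  obtain ⟨D, hD, E, hE, hp⟩ := h
  refine mem_beh.mpr ⟨cd_design hl, fun E' hE' => ?_⟩
  have := cd_orth_of (pos := false) (X := E') (E := D) hl.dual (mem_perp.mp hE').1
    (A.isDesign D hD) (fun u hu hne => (hp.symm.2 u hu hne).2)
    ((mem_beh.mp hD).2 E' hE').symm
  rw [map_dual_dual] at this
  exact this.symm
theorem cd_play (s : List Action) (hd : daimon ∉ s) :
    Play (CD ξ true s) (CD ξ false (s.map dual)) s := by
  refine ⟨hd, fun w hw hne => ⟨Or.inl ⟨w, hw, hne, rfl⟩, Or.inl ⟨w.map dual, hw.map _, ?_, rfl⟩⟩⟩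
  simpa using hne
theorem visS_of_cd {A : Behaviour ξ true} (hl : Legal ξ true s) (h1 : CD ξ true s ∈ A.designs)
    (h2 : CD ξ false (s.map dual) ∈ perp A) : VisS A s :=
  ⟨_, h1, _, h2, cd_play s hl.dai⟩
theorem VisS.pre {A : Behaviour ξ true} (h : VisS A s) (hu : u <+: s) : VisS A u := by
  obtain ⟨D, hD, E, hE, hp⟩ := h
  exact ⟨D, hD, E, hE, hp.prefix hu⟩
theorem visS_nil (A : Behaviour ξ true) : VisS A [] :=
  ⟨_, beh_nil A, _, perp_nil A, play_nil _ _⟩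
def inc (A : Behaviour ξ true) (D : DSet) : DSet :=
  {c | ∃ E ∈ perp A, ∃ s, Play D E s ∧ c ∈ D ∧ ((s ≠ [] ∧ c = view s) ∨ c = view s ++ [daimon])}
theorem inc_sub {A : Behaviour ξ true} : inc A D ⊆ D := by
  rintro c ⟨_, _, _, _, h, _⟩; exact h
theorem inc_view {A : Behaviour ξ true} (hE : E ∈ perp A) (hp : Play D E s) (hne : s ≠ []) :
    view s ∈ inc A D :=
  ⟨E, hE, s, hp, (hp.2 s (List.prefix_refl _) hne).1, Or.inl ⟨hne, rfl⟩⟩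
theorem inc_design {A : Behaviour ξ true} (hD : D ∈ A.designs) :
    IsDesign (simpleBase ξ true) (inc A D) where
  chron c hc := (A.isDesign D hD).chron c (inc_sub hc)
  prefixClosed := by
    intro c hc d hd hne
    have hdD := (A.isDesign D hD).prefixClosed c (inc_sub hc) d hd hne
    have key : ∀ E ∈ perp A, ∀ s, Play D E s → d <+: view s → d ∈ inc A D := by
      intro E hE s hp hd
      obtain ⟨x, hx, rfl⟩ := prefix_view s d hd
      exact inc_view hE (hp.prefix hx) (fun h => hne (by rw [h, view_nil]))
    obtain ⟨E, hE, s, hp, hcD, ⟨_, rfl⟩ | rfl⟩ := hc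
    · exact key E hE s hp hd
    · rcases prefix_snoc hd with hd | rfl
      · exact key E hE s hp hd
      · exact ⟨E, hE, s, hp, hdD, Or.inr rfl⟩
  coherent c hc d hd := (A.isDesign D hD).coherent c (inc_sub hc) d (inc_sub hd)
  maxPos := by
    intro c hc hmax
    have hcD := inc_sub hc
    rcases List.eq_nil_or_concat' c with rfl | ⟨u, a, rfl⟩
    · exact absurd rfl (des_chr (A.isDesign D hD) hcD).1
    refine ⟨a, by simp, ?_⟩
    cases ha : a.isPositive with
    | true => rfl
    | false =>
      exfalso
      obtain ⟨k, hk, hkD⟩ := des_reply (A.isDesign D hD) hcD (b := a) (by simp) ha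
      obtain ⟨E, hE, s, hp, _, ⟨hne, he⟩ | he⟩ := hc
      · rw [he] at hkD
        apply hmax k
        rw [he]
        by_cases hkd : k = daimon
        · subst hkd
          exact ⟨E, hE, s, hp, hkD, Or.inr rfl⟩
        · rw [← view_pos s hk] at hkD
          have := ((mem_perp.mp hE).2 D hD).2.1 s k hp hkd hk hkD
          rw [← view_pos s hk]
          exact inc_view hE (play_snoc.mpr ⟨hp, hkd, hkD, this⟩) (by simp)
      · have := (List.append_inj' he rfl).2
        simp at this; subst this; simp [isPositive] at ha
  posNonempty hp := by
    obtain ⟨c, hc⟩ := (A.isDesign D hD).posNonempty hp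
    have hE := perp_nil A
    rcases chr_head (des_chr (A.isDesign D hD) hc) with ⟨I, t, rfl⟩ | ⟨rfl, _⟩
    · have h1 : [proper true ξ I] ∈ D := (A.isDesign D hD).prefixClosed _ hc _ (by simp) (by simp)
      have := ((mem_perp.mp hE).2 D hD).2.1 [] (proper true ξ I) (play_nil _ _) (by simp) rfl
        (by simpa [view_single] using h1)
      exact ⟨_, inc_view (s := [proper true ξ I]) hE
        (play_snoc.mpr ⟨play_nil _ _, by simp, by simpa [view_single] using h1, this⟩) (by simp)⟩
    · exact ⟨[daimon], _, hE, [], play_nil _ _, hc, Or.inr rfl⟩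
theorem inc_mem {A : Behaviour ξ true} (hD : D ∈ A.designs) : inc A D ∈ A.designs := by
  refine mem_beh.mpr ⟨inc_design hD, fun E hE => ?_⟩
  obtain ⟨⟨N, hN⟩, h2, h3⟩ := (mem_perp.mp hE).2 D hD
  have hpl : ∀ s, Play (inc A D) E s → Play D E s := fun s hs =>
    ⟨hs.1, fun w hw hne => ⟨inc_sub (hs.2 w hw hne).1, (hs.2 w hw hne).2⟩⟩
  refine ⟨⟨N, fun s hs => hN s (hpl s hs)⟩, fun s k hs hk hkp hv => h2 s k (hpl s hs) hk hkp (inc_sub hv),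
    fun s k hs hk hv => ?_⟩
  have := h3 s k (hpl s hs) hk hv
  exact inc_view hE (play_snoc.mpr ⟨hpl s hs, neg_ne_dai hk, this, hv⟩) (by simp)
theorem sub_reply {A : Behaviour ξ true} {D' : DSet} (hD : D ∈ A.designs) (hD' : D' ∈ A.designs)
    (hsub : D' ⊆ D) (hp : Play D' E s) (hk : κ.isPositive = true)
    (hv : view s ++ [κ] ∈ D) : view s ++ [κ] ∈ D' := by
  have hde := A.isDesign D hD
  have hde' := A.isDesign D' hD'
  by_cases hs : s = []
  · subst hs
    obtain ⟨c, hc⟩ := hde'.posNonempty (isPositive_simple.mpr rfl)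
    cases c with
    | nil => exact absurd rfl (des_chr hde' hc).1
    | cons k t =>
      have h1 : [k] ∈ D' := hde'.prefixClosed _ hc _ (by simp) (by simp)
      rw [view_nil] at hv ⊢
      have := des_det hde (c := []) hv (hsub h1) hk
      rw [this]; exact h1
  · have h1 := (hp.2 s (List.prefix_refl _) hs).1
    obtain ⟨b, hb⟩ : ∃ b, s.getLast? = some b := by
      rcases List.eq_nil_or_concat' s with rfl | ⟨u, a, rfl⟩
      · exact absurd rfl hs
      · exact ⟨a, by simp⟩
    have hbn : b.isPositive = false := by
      rcases des_turn hde hv with ⟨h, _⟩ | ⟨b', hb', _, h⟩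
      · exact absurd h (view_ne_nil hs)
      · rw [view_getLast?, hb] at hb'
        cases hb'
        rw [hk] at h
        simpa using h.symm
    obtain ⟨k, hkp, hkD⟩ := des_reply hde' h1 (by rwa [view_getLast?]) hbn
    have := des_det hde hv (hsub hkD) hk
    rwa [this]
theorem inc_material {A : Behaviour ξ true} (hD : D ∈ A.designs) : Material A (inc A D) := by
  refine ⟨inc_mem hD, fun D' hD' hsub => Set.Subset.antisymm hsub ?_⟩
  have hsub' := hsub.trans inc_sub
  have key : ∀ E ∈ perp A, ∀ s, Play D E s → Play D' E s := by
    intro E hE s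
    induction s using List.reverseRecOn with
    | nil => intro _; exact play_nil _ _
    | append_singleton w a ih =>
      intro hp
      obtain ⟨h1, had, hv, hvE⟩ := play_snoc.mp hp
      refine play_snoc.mpr ⟨ih h1, had, ?_, hvE⟩
      cases ha : a.isPositive with
      | true =>
        rw [view_pos w ha] at hv ⊢
        exact sub_reply hD hD' hsub' (ih h1) ha hv
      | false =>
        exact ((mem_perp.mp hE).2 D' hD').2.2 w a (ih h1) ha hvE
  rintro c ⟨E, hE, s, hp, hcD, ⟨hne, rfl⟩ | rfl⟩
  · exact ((key E hE s hp).2 s (List.prefix_refl _) hne).1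
  · exact sub_reply hD hD' hsub' (key E hE s hp) rfl hcD
theorem JustChain.mono {β : Base} {p p' : List Action} (h : JustChain β p t)
    (hsub : ∀ x ∈ p, x ≠ daimon → x ∈ p') : JustChain β p' t := by
  induction h with
  | init h1 h2 =>
    refine .init (hsub _ h1 ?_) h2
    obtain ⟨_, _, _, rfl, _⟩ := h2
    simp
  | cons h1 h2 h3 ih =>
    refine .cons ih (hsub _ h2 ?_) h3
    rintro rfl
    obtain ⟨_, _, _, _, _, _, _, _, h⟩ := justifies_iff.mp h3
    cases h
theorem Legal.justChain_view {β : Base} (hl : Legal ξ pos s) (h : JustChain β s t) :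
    ∀ κ w, t.getLast? = some κ → w ++ [κ] <+: s → JustChain β (view (w ++ [κ])) t := by
  induction h with
  | @init κ0 h1 h2 =>
    intro κ w hk hw
    simp at hk; subst hk
    obtain ⟨c, hc⟩ := view_snoc w κ0
    exact .init (by rw [hc]; simp) h2
  | @cons t' k k' h1 h2 h3 ih =>
    intro κ w hk hw
    simp at hk; subst hk
    obtain ⟨c, hc⟩ := view_snoc w k'
    refine .cons ?_ (by rw [hc]; simp) h3
    have hks : k ∈ s := by
      generalize ht : t' ++ [k] = r at h1
      cases h1 with
      | init h _ => 
        have : t' = [] ∧ [k] = [_] := List.append_inj' (s₂ := []) ht rfl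
        simp at this; rw [this.2]; exact h
      | @cons t'' κ2 κ3 _ h _ =>
        have : t'' ++ [κ2, κ3] = (t'' ++ [κ2]) ++ [κ3] := by simp
        rw [this] at ht
        have := (List.append_inj' ht rfl).2
        simp at this; rw [this]; exact h
    have hkw : k ∈ view (w ++ [k']) := by
      obtain ⟨hkw, hp, h4, h5⟩ := hl.just_before hw hks h3
      cases hk' : k'.isPositive with
      | true => rw [view_pos _ hk']; simp [h4 hk']
      | false =>
        obtain ⟨u, hu⟩ := mem_split_prefix hks
        rw [hl.view_neg hw hk' hu h3]
        obtain ⟨c, hc⟩ := view_snoc u k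
        simp [hc]
    obtain ⟨u, hu, hu2⟩ := mem_view hkw
    exact (ih k u (by simp) (hu.trans hw)).mono (fun x hx _ => hu2.subset hx)
theorem justChain_last {β : Base} (h : JustChain β s t) : ∃ κ ∈ s, t.getLast? = some κ := by
  cases h with
  | init h _ => exact ⟨_, h, by simp⟩
  | cons _ h _ => exact ⟨_, h, by simp⟩
theorem trivial_iff {A : Behaviour ξ true} :
    TrivialChronicle A t ↔ ∃ s, VisS A s ∧ JustChain (simpleBase ξ true) s t := by
  constructor
  · rintro ⟨D, hM, c, hc, hj⟩
    have := hM.2 _ (inc_mem hM.1) inc_sub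
    rw [← this] at hc
    obtain ⟨E, hE, s, hp, _, h⟩ := hc
    refine ⟨s, ⟨D, hM.1, E, hE, hp⟩, hj.mono ?_⟩
    rcases h with ⟨_, rfl⟩ | rfl
    · intro x hx _; exact view_subset hx
    · intro x hx hxd
      simp [hxd] at hx
      exact view_subset hx
  · rintro ⟨s, hv, hj⟩
    have hl := hv.legal
    obtain ⟨D, hD, E, hE, hp⟩ := hv
    obtain ⟨κ, hk, hkt⟩ := justChain_last hj
    obtain ⟨w, hw⟩ := mem_split_prefix hk
    exact ⟨inc A D, inc_material hD, _, inc_view hE (hp.prefix hw) (by simp),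
      hl.justChain_view hj κ w hkt hw⟩
end Part8
section Part9
open Action
section P9
variable {ξ : Address} {pos : Bool} {q s u v w c d t tl : List Action} {a m κ : Action}
  {X Y D E : DSet}
def DaiTurn (pos : Bool) (s : List Action) : Prop :=
  (s = [] ∧ pos = true) ∨ ∃ n, s.getLast? = some n ∧ n.isPositive = false
theorem pre_tl (htl : tl = [] ∨ tl = [daimon]) (hw : w ++ [a] <+: s ++ tl) (ha : a ≠ daimon) :
    w ++ [a] <+: s := by
  rcases htl with rfl | rfl
  · simpa using hw
  · rcases prefix_snoc hw with h | h
    · exact h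
    · have := (List.append_inj' h rfl).2
      simp at this; exact absurd this ha
theorem legal_path (h : Legal ξ pos s)
    (htl : (tl = [] ∧ (s ≠ [] ∨ pos = false)) ∨ (tl = [daimon] ∧ DaiTurn pos s)) :
    IsPath (simpleBase ξ pos) (s ++ tl) := by
  have ht : tl = [] ∨ tl = [daimon] := by tauto
  refine ⟨?_, ?_, ?_, ?_, ?_, ?_, ?_, ?_⟩
  · show List.IsChain _ (s ++ tl)
    have h1 : List.IsChain (fun a b : Action => a.isPositive ≠ b.isPositive) s := by
      clear htl ht
      induction s using List.reverseRecOn with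
      | nil => simp
      | append_singleton w a ih =>
        rw [List.isChain_append]
        refine ⟨ih (h.pre (List.prefix_append _ _)), by simp, ?_⟩
        intro x hx y hy
        simp at hy; subst hy
        obtain ⟨w', rfl⟩ := List.getLast?_eq_some_iff.mp hx
        rw [h.alt (List.prefix_refl _)]; simp
    rcases htl with ⟨rfl, _⟩ | ⟨rfl, h2⟩
    · simpa using h1
    · rw [List.isChain_append]
      refine ⟨h1, by simp, ?_⟩
      intro x hx y hy
      simp at hy; subst hy
      rcases h2 with ⟨rfl, _⟩ | ⟨n, hn, hn2⟩
      · simp at hx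
      · rw [hn] at hx; simp at hx; subst hx; rw [hn2]; simp [isPositive]
  · intro w a hw ha
    have hw' := pre_tl ht hw ha
    by_cases hne : w = []
    · subst hne
      left
      obtain ⟨r, hr⟩ := hw'
      obtain ⟨L, rfl⟩ := Legal.head (s := r) (by rw [← hr] at h; simpa using h)
      exact initial_simple.mpr ⟨L, rfl⟩
    · obtain ⟨n, m, _, _, hm, hj, _⟩ := h.step hw' hne
      exact Or.inr ⟨m, hm, hj⟩
  · intro w a b hw hp hb hj
    have ha : a ≠ daimon := by
      rintro rfl
      obtain ⟨_, _, _, _, _, _, _, _, h⟩ := justifies_iff.mp hj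
      cases h
    have hw' := pre_tl ht hw ha
    exact (h.just_before hw' (hw'.subset (by simp [hb])) hj).2.2.1 hp
  · intro w a hw hp ha σ hσ hf
    obtain ⟨f, hf1, hf2⟩ := hf
    have hw' := pre_tl ht hw ha
    cases pos with
    | false => simp [simpleBase] at hσ; subst hσ; simp at hf2
    | true =>
      simp [simpleBase] at hσ; subst hσ
      simp at hf2; subst hf2
      left
      refine ⟨?_, rfl⟩
      by_contra hne
      obtain ⟨n, m, _, _, hm, hj, _⟩ := h.step hw' hne
      exact h.init_not_just (hw'.subset (by simp [hm])) hf1 hj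
  · have h1 : (foci s).Nodup := by
      clear htl ht
      induction s using List.reverseRecOn with
      | nil => simp [foci]
      | append_singleton w a ih =>
        rw [foci_append, List.nodup_append]
        refine ⟨ih (h.pre (List.prefix_append _ _)), ?_, ?_⟩
        · cases a with
          | daimon => simp [foci, List.filterMap_cons, focus?]
          | proper p f L => simp [foci, List.filterMap_cons, focus?]
        · intro x hx y hy hxy
          subst hxy
          simp only [foci, List.mem_filterMap, List.mem_singleton] at hy
          obtain ⟨a', rfl, hf⟩ := hy
          exact h.fresh (List.prefix_refl _) hf hx
    rcases ht with rfl | rfl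
    · simpa [foci] using h1
    · simpa [foci, List.filterMap_cons, focus?] using h1
  · intro w hw
    have : ∀ {w}, ¬ (w ++ [daimon] <+: s) := fun hw => h.dai (hw.subset (by simp))
    rcases ht with rfl | rfl
    · exact absurd (by simpa using hw) this
    · rcases prefix_snoc hw with h | h
      · exact absurd h this
      · exact h
  · intro hh
    rw [isPositive_simple]
    cases s with
    | nil =>
      rcases htl with ⟨rfl, _⟩ | ⟨rfl, h2⟩
      · simp at hh
      · rcases h2 with ⟨_, h⟩ | ⟨n, hn, _⟩
        · exact h
        · simp at hn
    | cons x r =>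
      simp at hh; subst hh
      exact absurd (by simp) h.dai
  · intro hp
    rw [isPositive_simple] at hp; subst hp
    cases s with
    | nil =>
      rcases htl with ⟨rfl, h⟩ | ⟨rfl, h2⟩
      · simp at h
      · exact ⟨daimon, [], rfl, Or.inl rfl⟩
    | cons x r =>
      obtain ⟨L, rfl⟩ := h.head
      exact ⟨_, _, rfl, Or.inr ⟨rfl, initial_simple.mpr ⟨L, rfl⟩⟩⟩
theorem cd_dai (h : Legal ξ pos s) (ht : DaiTurn pos s) : view s ++ [daimon] ∈ CD ξ pos s := by
  refine Or.inr (Or.inr ⟨view s, rfl, ?_, ?_⟩)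
  · rcases ht with ⟨rfl, rfl⟩ | ⟨n, hn, hn2⟩
    · right; exact ⟨view_nil, rfl⟩
    · left
      obtain ⟨c, hc⟩ := List.getLast?_eq_some_iff.mp (by rw [view_getLast?]; exact hn : (view s).getLast? = some n)
      rw [hc]
      apply vv_neg_nn h _ hn2
      rw [← hc]
      exact ⟨s, List.prefix_refl _, by rintro rfl; simp at hn, rfl⟩
  · intro κ hk hv
    obtain ⟨w, hw, he⟩ := vv_snoc_pos hv hk
    have := h.view_inj ((List.prefix_append _ _).trans hw) (List.prefix_refl _) he
    subst this
    have := hw.length_le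
    simp at this
def Trv (A : Behaviour ξ true) (s : List Action) : Prop :=
  ∀ κ ∈ s, ∃ t s', JustChain (simpleBase ξ true) s t ∧ t.getLast? = some κ ∧ VisS A s' ∧
    JustChain (simpleBase ξ true) s' t
theorem daiTurn_or (h : Legal ξ true s) :
    DaiTurn true s ∨ (s ≠ [] ∧ ∃ n, s.getLast? = some n ∧ n.isPositive = true ∧ n ≠ daimon) := by
  rcases List.eq_nil_or_concat' s with rfl | ⟨u, b, rfl⟩
  · left; left; exact ⟨rfl, rfl⟩
  · cases hb : b.isPositive with
    | false => left; right; exact ⟨b, by simp, hb⟩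
    | true => right; exact ⟨by simp, b, by simp, hb, fun hd => h.dai (by simp [hd])⟩
theorem dualSeq_dai (s : List Action) : dualSeq (s ++ [daimon]) = s.map dual := by
  simp [dualSeq]
theorem dualSeq_nd (h : daimon ∉ s) : dualSeq s = s.map dual ++ [daimon] := by
  rw [dualSeq, if_neg]
  intro hl; exact h (List.mem_of_getLast? hl)
theorem path_dual_tl (h : Legal ξ true s)
    (hn : s ≠ [] ∧ ∃ n, s.getLast? = some n ∧ n.isPositive = true ∧ n ≠ daimon) :
    DaiTurn false (s.map dual) := by
  obtain ⟨_, n, hn, hp, hd⟩ := hn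
  right
  exact ⟨n.dual, by simp [hn], by rw [pol_dual hd, hp]; rfl⟩
theorem regular_to {A : Behaviour ξ true} (hr : Regular A) (h : Legal ξ true s) (ht : Trv A s) :
    VisS A s := by
  have key : ∀ tl, (tl = [] ∨ tl = [daimon]) → IsPath (simpleBase ξ true) (s ++ tl) →
      IsPath (simpleBase ξ false) (dualSeq (s ++ tl)) → s.map dual <+: dualSeq (s ++ tl) →
      VisS A s := by
    intro tl htl h1 h2 h3
    obtain ⟨D, hD, E, hE, ⟨_, hpD⟩, ⟨_, hpE⟩⟩ := hr (s ++ tl) ⟨h1, h2, by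
      intro κ hk hkd
      have : κ ∈ s := by rcases htl with rfl | rfl <;> simpa [hkd] using hk
      obtain ⟨t, s', h4, h5, h6, h7⟩ := ht κ this
      exact ⟨t, h4.mono (fun x hx _ => by simp [hx]), h5, trivial_iff.mpr ⟨s', h6, h7⟩⟩⟩
    refine ⟨D, hD, E, hE, h.dai, fun w hw hne => ⟨hpD w (hw.trans (List.prefix_append _ _)) hne, ?_⟩⟩
    exact hpE _ ((hw.map _).trans h3) (by simpa using hne)
  rcases daiTurn_or h with hd | hd
  · apply key [daimon] (Or.inr rfl) (legal_path h (Or.inr ⟨rfl, hd⟩))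
    · rw [dualSeq_dai]
      simpa using legal_path (tl := []) h.dual (Or.inl ⟨rfl, Or.inr rfl⟩)
    · rw [dualSeq_dai]
  · apply key [] (Or.inl rfl) (legal_path h (Or.inl ⟨rfl, Or.inl hd.1⟩))
    · rw [List.append_nil, dualSeq_nd h.dai]
      exact legal_path h.dual (Or.inr ⟨rfl, path_dual_tl h hd⟩)
    · rw [List.append_nil, dualSeq_nd h.dai]; exact List.prefix_append _ _
theorem justChain_snoc {β : Base} (h : JustChain β s t) (hl : t.getLast? = some a) :
    (t = [a] ∧ a ∈ s ∧ Initial β a) ∨ (a ∈ s ∧ ∃ t' m, m ∈ s ∧ m.justifies a ∧ t = t' ++ [m, a] ∧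
      JustChain β s (t' ++ [m])) := by
  cases h with
  | init h1 h2 => simp at hl; subst hl; exact Or.inl ⟨rfl, h1, h2⟩
  | @cons t' m k h1 h2 h3 =>
    simp at hl; subst hl
    right
    obtain ⟨m', hm', hh⟩ := justChain_last h1
    simp at hh; subst hh
    exact ⟨h2, t', m, hm', h3, rfl, h1⟩
theorem nodup_foci_mem (h : (foci s).Nodup) {b : Action} {f : Address} (hw : w ++ [a] <+: s)
    (hb : b ∈ w) (ha : a.focus? = some f) (hb' : b.focus? = some f) : False := by
  obtain ⟨r, rfl⟩ := hw
  rw [foci_append, foci_append] at h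
  have h1 := (List.nodup_append.mp (List.nodup_append.mp h).1).2.2
  exact h1 f (List.mem_filterMap.mpr ⟨b, hb, hb'⟩) f
    (List.mem_filterMap.mpr ⟨a, by simp, ha⟩) rfl
theorem nodup_foci_eq (h : (foci s).Nodup) {b : Action} (ha : a ∈ s)
    (hb : b ∈ s) (had : a ≠ daimon) (hab : a.focus? = b.focus?) : a = b := by
  obtain ⟨p, f, L, rfl⟩ := focus_none had
  have hf : (proper p f L).focus? = some f := rfl
  obtain ⟨w, hw⟩ := mem_split_prefix ha
  obtain ⟨w', hw'⟩ := mem_split_prefix hb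
  by_contra hne
  rcases List.prefix_or_prefix_of_prefix hw hw' with h1 | h1
  · rcases prefix_snoc h1 with h2 | h2
    · exact nodup_foci_mem h hw' (h2.subset (by simp)) (by rw [← hab]; exact hf) hf
    · have := (List.append_inj' h2 rfl).2; simp at this; exact hne this
  · rcases prefix_snoc h1 with h2 | h2
    · exact nodup_foci_mem (b := b) h hw (h2.subset (by simp)) hf (by rw [← hab]; exact hf)
    · have := (List.append_inj' h2 rfl).2; simp at this; exact hne this.symm
theorem just_ne_dai (h : m.justifies a) : m ≠ daimon ∧ a ≠ daimon := by
  obtain ⟨_, _, _, _, _, _, rfl, _, rfl⟩ := justifies_iff.mp h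
  simp
theorem regPath_legal {A : Behaviour ξ true} {p : List Action} (hr : RegularPath A p)
    (hp : p = s ∨ p = s ++ [daimon]) (hd : daimon ∉ s) : Legal ξ true s := by
  obtain ⟨hp1, hp2, hch⟩ := hr
  have hsp : s <+: p := by rcases hp with rfl | rfl <;> simp
  have hsp2 : s.map dual <+: dualSeq p := by
    rcases hp with rfl | rfl
    · rw [dualSeq_nd hd]; simp
    · rw [dualSeq_dai]
  have hnd : (foci s).Nodup := by
    have := hp1.linearity
    obtain ⟨r, rfl⟩ := hsp
    have h2 : (foci (s ++ r)).Nodup := this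
    rw [foci_append] at h2
    exact (List.nodup_append.mp h2).1
  intro w a hw
  have had : a ≠ daimon := by rintro rfl; exact hd (hw.subset (by simp))
  have hwp := hw.trans hsp
  obtain ⟨b, f, L, rfl⟩ := focus_none had
  have hfresh : f ∉ foci w := by
    intro hf
    obtain ⟨b', L', hm⟩ := mem_foci.mp hf
    exact nodup_foci_mem hnd hw hm rfl rfl
  refine ⟨b, f, L, rfl, hfresh, ?_⟩
  by_cases hne : w = []
  · left
    subst hne
    rcases hp1.justified _ _ hwp had with h | ⟨m, hm, _⟩
    · obtain ⟨I, h⟩ := initial_simple.mp h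
      simp at h; exact ⟨rfl, h.1, h.2.1⟩
    · simp at hm
  right
  obtain ⟨x, r, hxr⟩ := List.exists_cons_of_ne_nil hne
  have hx : ∃ I, x = proper true ξ I := by
    obtain ⟨y, r', hy, h⟩ := hp1.totality (by rw [isPositive_simple])
    have : x = y := by
      obtain ⟨z, hz⟩ := hwp
      rw [hxr, hy] at hz; simp at hz; exact hz.1
    subst this
    rcases h with rfl | ⟨_, h⟩
    · exact absurd (hw.subset (by simp [hxr])) hd
    · exact initial_simple.mp h
  obtain ⟨I0, rfl⟩ := hx
  have hni : ¬ Initial (simpleBase ξ true) (proper b f L) := by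
    intro h
    obtain ⟨I, h⟩ := initial_simple.mp h
    simp at h
    exact hfresh (mem_foci.mpr ⟨true, I0, by rw [h.2.1, hxr]; simp⟩)
  obtain ⟨m, hm, hj⟩ := (hp1.justified _ _ hwp had).resolve_left hni
  obtain ⟨n, hn⟩ : ∃ n, w.getLast? = some n := by
    rw [List.getLast?_eq_some_getLast hne]; exact ⟨_, rfl⟩
  have hmp : m.isPositive = !b := by
    obtain ⟨t, h1, h2, h3⟩ := hch _ (hwp.subset (by simp)) had
    obtain ⟨s', hv, h4⟩ := trivial_iff.mp h3
    have hl := hv.legal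
    rcases justChain_snoc h4 h2 with ⟨_, _, h⟩ | ⟨has, t', m', hm', hj', rfl, _⟩
    · exact absurd h hni
    rcases justChain_snoc h1 h2 with ⟨_, _, h⟩ | ⟨_, t'', m'', hm'', hj'', he, _⟩
    · exact absurd h hni
    have : m' = m'' := by
      have := List.append_inj' he (by simp)
      simpa using this.2
    subst this
    have h5 : m = m' := nodup_foci_eq hp1.linearity (hwp.subset (by simp [hm])) hm''
      (just_ne_dai hj).1 (just_focus hj hj')
    subst h5
    obtain ⟨w', hw'⟩ := mem_split_prefix has
    exact (hl.just_before hw' hm' hj).2.1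
  refine ⟨n, m, hn, ?_, hm, hj, hmp, ?_, ?_⟩
  · obtain ⟨w', rfl⟩ := List.getLast?_eq_some_iff.mp hn
    have := hp1.alt hwp
    simp only [isPositive_proper] at this
    revert this; cases b <;> simp
  · rintro rfl
    exact hp1.negJump w _ m hwp rfl hm hj
  · rintro rfl
    rw [mem_cov_iff]
    have := hp2.negJump (w.map dual) (proper false f L).dual m.dual (by
      have := hw.map dual
      simp only [List.map_append, List.map_singleton] at this
      exact this.trans hsp2) rfl (List.mem_map_of_mem hm) (justifies_dual.mpr hj)
    exact this
theorem regular_of {A : Behaviour ξ true} (h : ∀ s, Legal ξ true s → Trv A s → VisS A s) :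
    Regular A := by
  intro p hr
  obtain ⟨s, hp, hd⟩ : ∃ s, (p = s ∨ p = s ++ [daimon]) ∧ daimon ∉ s := by
    by_cases hp : daimon ∈ p
    · obtain ⟨w, hw⟩ := mem_split_prefix hp
      have := hr.1.daimonLast w hw
      refine ⟨w, Or.inr this.symm, fun hd => ?_⟩
      obtain ⟨w', hw'⟩ := mem_split_prefix hd
      have h2 := hr.1.daimonLast w' (hw'.trans ((List.prefix_append _ _).trans hw))
      rw [← h2] at hw
      have h3 := (List.IsPrefix.trans hw' (List.prefix_append w [daimon])).length_le
      have h4 := hw.length_le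
      have h5 := hw'.length_le
      simp at h3 h4 h5; omega
    · exact ⟨p, Or.inl rfl, hp⟩
  have hl := regPath_legal hr hp hd
  have hv : VisS A s := by
    apply h s hl
    intro κ hk
    have hkp : κ ∈ p := by rcases hp with rfl | rfl <;> simp [hk]
    obtain ⟨t, h1, h2, h3⟩ := hr.2.2 κ hkp (fun h => hd (h ▸ hk))
    obtain ⟨s', h4, h5⟩ := trivial_iff.mp h3
    refine ⟨t, s', h1.mono ?_, h2, h4, h5⟩
    intro x hx hxd
    rcases hp with rfl | rfl
    · exact hx
    · simpa [hxd] using hx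
  have hpl := cd_play (ξ := ξ) s hd
  refine ⟨_, hv.cd_mem, _, hv.cd_perp, ⟨hr.1, ?_⟩, hr.2.1, ?_⟩
  · intro q hq hne
    rcases hp with rfl | rfl
    · exact (hpl.2 q hq hne).1
    · rcases prefix_snoc hq with h1 | rfl
      · exact (hpl.2 q h1 hne).1
      · rw [view_pos s rfl]
        apply cd_dai hl
        by_cases hs : s = []
        · left; exact ⟨hs, rfl⟩
        · right
          rcases List.eq_nil_or_concat' s with rfl | ⟨u, b, rfl⟩
          · simp at hs
          · have := hr.1.alt (List.prefix_refl _)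
            refine ⟨b, by simp, ?_⟩
            revert this; simp [isPositive]
  · intro q hq hne
    rcases hp with rfl | rfl
    · rw [dualSeq_nd hd] at hq
      rcases prefix_snoc hq with h1 | rfl
      · have := (hpl.2 _ (prefix_map_dual h1) (by simpa using hne)).2
        rwa [map_dual_dual] at this
      · rw [view_pos _ rfl]
        apply cd_dai hl.dual
        right
        rcases List.eq_nil_or_concat' p with rfl | ⟨u, b, rfl⟩
        · obtain ⟨a, t, h, _⟩ := hr.1.totality (by rw [isPositive_simple]); simp at h
        · have h2 := hr.2.1
          rw [dualSeq_nd hd, List.map_append, List.map_singleton] at h2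
          have := h2.alt (List.prefix_refl _)
          refine ⟨b.dual, by simp, ?_⟩
          revert this; simp [isPositive]
    · rw [dualSeq_dai] at hq
      have := (hpl.2 _ (prefix_map_dual hq) (by simpa using hne)).2
      rwa [map_dual_dual] at this
theorem regular_iff {A : Behaviour ξ true} :
    Regular A ↔ ∀ s, Legal ξ true s → Trv A s → VisS A s :=
  ⟨fun h _ h1 h2 => regular_to h h1 h2, regular_of⟩
end P9
end Part9
section Part10
open Action
section P10
def isIn (ξ : Address) : Action → Bool
  | daimon => false
  | proper _ f _ => decide (f = ξ)
open Classical in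
noncomputable def cls (ξ : Address) (I : Finset ℕ) : Action → Bool
  | daimon => false
  | proper _ f _ => decide (∃ i ∈ I, ξ ++ [i] <+: f)
noncomputable def pI (ξ : Address) (I : Finset ℕ) (a : Action) : Bool := isIn ξ a || cls ξ I a
variable {ξ : Address} {pos : Bool} {q s u v w c d t tl : List Action} {a b m n κ : Action}
  {X Y D E : DSet} {I J K L : Finset ℕ}
theorem isIn_iff : isIn ξ a = true ↔ a.focus? = some ξ := by
  cases a <;> simp [isIn, focus?]
theorem cls_just (hj : m.justifies a) (hm : isIn ξ m = false) : cls ξ I m = cls ξ I a := by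
  obtain ⟨p, f, L, q, i, M, rfl, _, rfl⟩ := justifies_iff.mp hj
  simp [isIn] at hm
  simp only [cls, decide_eq_decide]
  constructor
  · rintro ⟨k, hk, h⟩; exact ⟨k, hk, h.trans (List.prefix_append _ _)⟩
  · rintro ⟨k, hk, h⟩
    refine ⟨k, hk, ?_⟩
    rw [List.prefix_concat_iff] at h
    rcases h with h | h
    · exact absurd (List.append_inj' h rfl).1.symm hm
    · exact h
theorem Legal.isIn_nil (h : Legal ξ pos s) (hw : w ++ [a] <+: s) : isIn ξ a = true ↔ w = [] := by
  rw [isIn_iff]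
  constructor
  · intro hf
    by_contra hne
    obtain ⟨n, m, _, _, hm, hj, _⟩ := h.step hw hne
    exact h.init_not_just (hw.subset (by simp [hm])) hf hj
  · rintro rfl
    obtain ⟨r, hr⟩ := hw
    obtain ⟨L, rfl⟩ := Legal.head (s := r) (by rw [← hr] at h; simpa using h)
    rfl
theorem Legal.isIn_pos (h : Legal ξ true s) (ha : a ∈ s) (hi : isIn ξ a = true) :
    a.isPositive = true := by
  obtain ⟨w, hw⟩ := mem_split_prefix ha
  have := (h.isIn_nil hw).mp hi
  subst this
  obtain ⟨r, hr⟩ := hw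
  obtain ⟨L, rfl⟩ := Legal.head (s := r) (by rw [← hr] at h; simpa using h)
  rfl
theorem Legal.neg_isIn (h : Legal ξ true s) (ha : a ∈ s) (hi : a.isPositive = false) :
    isIn ξ a = false := by
  by_contra hh
  have := h.isIn_pos ha (by simpa using hh)
  rw [hi] at this; cases this
theorem Legal.just_isIn (h : Legal ξ pos s) (hm : m ∈ s) (hj : m.justifies a) :
    isIn ξ a = false := by
  by_contra hh
  exact h.init_not_just hm (isIn_iff.mp (by simpa using hh)) hj
theorem Legal.pI_just (h : Legal ξ pos s) (hm : m ∈ s) (hj : m.justifies a)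
    (ha : pI ξ I a = true) : pI ξ I m = true := by
  have h1 := h.just_isIn hm hj
  simp only [pI, h1, Bool.false_or] at ha
  cases hmi : isIn ξ m with
  | true => simp [pI, hmi]
  | false => simp [pI, cls_just hj hmi, ha]
theorem Legal.pI_just' (h : Legal ξ pos s) (hm : m ∈ s) (hj : m.justifies a)
    (hmi : isIn ξ m = false) : pI ξ I m = pI ξ I a := by
  simp [pI, h.just_isIn hm hj, hmi, cls_just hj hmi]
theorem dview_cls (h : Legal ξ true w) : ∀ w' a, w = w' ++ [a] → w' ≠ [] →
    ∀ x ∈ view w, isIn ξ x = true ∨ cls ξ I x = cls ξ I a := by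
  induction w using prefix_induction with
  | h w ih =>
    rintro w' a rfl hne x hx
    obtain ⟨n, m, hn, hnp, hm, hj, hmp, h1, h2⟩ := h.step (List.prefix_refl _) hne
    cases ha : a.isPositive with
    | true =>
      rw [view_pos w' ha] at hx
      simp only [List.mem_append, List.mem_singleton] at hx
      rcases hx with hx | rfl
      · obtain ⟨w0, rfl⟩ := List.getLast?_eq_some_iff.mp hn
        have hl' := h.pre (List.prefix_append _ [a])
        have hw0 : w0 ≠ [] := by
          rintro rfl
          have := hl'.isIn_pos (a := n) (by simp) ((hl'.isIn_nil (w := []) (by simp)).mpr rfl)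
          rw [this, ha] at hnp; cases hnp
        have ih' := ih (w0 ++ [n]) (by simp) hl' w0 n rfl hw0
        have hmi := hl'.neg_isIn hm (by rw [hmp, ha]; rfl)
        have h3 := (ih' m (h1 ha)).resolve_left (by simp [hmi])
        rw [← cls_just hj hmi, h3]
        exact ih' x hx
      · right; rfl
    | false =>
      obtain ⟨u, hu⟩ := mem_split_prefix hm
      have hu' := hu.trans (List.prefix_append w' [a])
      rw [h.view_neg (List.prefix_refl _) ha hu' hj] at hx
      simp only [List.mem_append, List.mem_singleton] at hx
      rcases hx with hx | rfl
      · by_cases hue : u = []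
        · subst hue
          simp [view_single] at hx
          subst hx
          left; exact (h.isIn_nil (w := []) (by simpa using hu')).mpr rfl
        · have hmi : isIn ξ m = false := by
            by_contra hh
            exact hue ((h.isIn_nil hu').mp (by simpa using hh))
          rw [← cls_just hj hmi]
          exact ih (u ++ [m]) (by have := hu.length_le; simp at this ⊢; omega) (h.pre hu') u m rfl hue x hx
      · right; rfl
theorem pos_prev (h : Legal ξ true (w ++ [n] ++ [a])) (ha : a.isPositive = true) :
    pI ξ I n = pI ξ I a ∧ isIn ξ n = false ∧ isIn ξ a = false := by
  obtain ⟨n', m, hn, hnp, hm, hj, hmp, h1, _⟩ := h.step (List.prefix_refl _) (by simp)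
  simp at hn; subst hn
  have hl' := h.pre (List.prefix_append _ [a])
  have hni := hl'.neg_isIn (a := n) (by simp) (by rw [hnp, ha]; rfl)
  have hmi := hl'.neg_isIn hm (by rw [hmp, ha]; rfl)
  have hai := hl'.just_isIn hm hj
  have hw : w ≠ [] := by
    intro hw
    rw [(hl'.isIn_nil (List.prefix_refl _)).mpr hw] at hni; cases hni
  have := (dview_cls (I := I) hl' w n rfl hw m (h1 ha)).resolve_left (by simp [hmi])
  rw [cls_just hj hmi] at this
  simp [pI, hni, hai, this]
theorem filter_single_true {p : Action → Bool} (h : p a = true) : (w ++ [a]).filter p = w.filter p ++ [a] := by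
  simp [List.filter_append, h]
theorem filter_single_false {p : Action → Bool} (h : p a = false) : (w ++ [a]).filter p = w.filter p := by
  simp [List.filter_append, h]
theorem view_filter (h : Legal ξ true w) : ∀ w' a, w = w' ++ [a] → pI ξ I a = true →
    view (w.filter (pI ξ I)) = view w := by
  induction w using prefix_induction with
  | h w ih =>
    rintro w' a rfl hpa
    rw [filter_single_true hpa]
    by_cases hne : w' = []
    · subst hne; rfl
    obtain ⟨n, m, hn, hnp, hm, hj, hmp, h1, h2⟩ := h.step (List.prefix_refl _) hne
    cases ha : a.isPositive with
    | true =>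
      obtain ⟨w0, rfl⟩ := List.getLast?_eq_some_iff.mp hn
      rw [view_pos _ ha, view_pos _ ha]
      rw [ih (w0 ++ [n]) (by simp) (h.pre (List.prefix_append _ _)) w0 n rfl
        (by rw [(pos_prev h ha).1, hpa])]
    | false =>
      obtain ⟨w1, w2, rfl⟩ := List.append_of_mem hm
      have hpm := h.pI_just (m := m) (by simp) hj hpa
      have hu' : w1 ++ [m] <+: w1 ++ m :: w2 ++ [a] := ⟨w2 ++ [a], by simp⟩
      rw [h.view_neg (List.prefix_refl _) ha hu' hj]
      have : (w1 ++ m :: w2).filter (pI ξ I) ++ [a] =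
          w1.filter (pI ξ I) ++ m :: w2.filter (pI ξ I) ++ [a] := by
        simp [List.filter_append, List.filter_cons, hpm]
      rw [this, view_neg_just _ _ ha hj, ← filter_single_true hpm,
        ih (w1 ++ [m]) (by simp) (h.pre hu') w1 m rfl hpm]
      intro x hx hxj
      have hx' := List.mem_filter.mp hx
      have := h.just_unique (m := m) (m' := x) (by simp) (by simp [hx'.1]) hj hxj
      subst this
      have h3 : (m :: w2).Nodup := h.nodup.sublist
        ((List.sublist_append_right w1 (m :: w2)).trans (List.sublist_append_left _ [a]))
      exact (List.nodup_cons.mp h3).1 hx'.1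
theorem filter_last_pos (h : Legal ξ true w) : ∀ w' a, w = w' ++ [a] → a.isPositive = true →
    ∃ b, (w.filter (pI ξ I)).getLast? = some b ∧ b.isPositive = true := by
  induction w using prefix_induction with
  | h w ih =>
    rintro w' a rfl ha
    cases hpa : pI ξ I a with
    | true => rw [filter_single_true hpa]; exact ⟨a, by simp, ha⟩
    | false =>
      rw [filter_single_false hpa]
      rcases List.eq_nil_or_concat' w' with rfl | ⟨w0, n, rfl⟩
      · have := (h.isIn_nil (w := []) (a := a) (by simp)).mpr rfl
        simp [pI, this] at hpa
      · obtain ⟨h1, h2, h3⟩ := pos_prev (I := I) h ha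
        rw [filter_single_false (by rw [h1, hpa])]
        have hl' := h.pre (List.prefix_append _ [a])
        rcases List.eq_nil_or_concat' w0 with rfl | ⟨w1, b, rfl⟩
        · have := (hl'.isIn_nil (w := []) (a := n) (by simp)).mpr rfl
          rw [this] at h2; cases h2
        · refine ih (w1 ++ [b]) (by simp) (hl'.pre (List.prefix_append _ [n])) w1 b rfl ?_
          have e1 := hl'.alt (List.prefix_refl _)
          have e2 := h.alt (List.prefix_refl _)
          rw [e1, e2, ha]; rfl
theorem pq (h : Legal ξ true w) :
    (∀ b u X, w = u ++ b :: X → b ∈ cov w → pI ξ I b = false →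
      cov (u.filter (pI ξ I)) <+: cov (w.filter (pI ξ I))) ∧
    (∀ w0 n m x, w = w0 ++ [n] → n.isPositive = false → pI ξ I n = false → m ∈ view w →
      pI ξ I m = false → x ++ [m] <+: w →
      cov ((x ++ [m]).filter (pI ξ I)) <+: cov (w.filter (pI ξ I))) := by
  induction w using prefix_induction with
  | h w ih =>
    constructor
    · intro b u X hw hb hpb
      rcases List.eq_nil_or_concat' w with rfl | ⟨u0, κ, rfl⟩
      · simp at hw
      by_cases hbk : b = κ
      · subst hbk
        have hu : u ++ [b] <+: u0 ++ [b] := by rw [hw]; exact ⟨X, by simp⟩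
        have := (h.at_unique hu (List.prefix_refl _) rfl).1
        subst this
        rw [filter_single_false hpb]
      have hX : ∃ X', u0 = u ++ b :: X' := by
        rcases List.eq_nil_or_concat' X with rfl | ⟨X', y, rfl⟩
        · have := (List.append_inj' hw rfl).2
          simp at this; exact absurd this.symm hbk
        · refine ⟨X', ?_⟩
          have : u0 ++ [κ] = (u ++ b :: X') ++ [y] := by rw [hw]; simp
          exact (List.append_inj' this rfl).1
      obtain ⟨X', rfl⟩ := hX
      have hl' := h.pre (List.prefix_append _ [κ])
      obtain ⟨n, m, hn, hnp, hm, hj, hmp, h1, h2⟩ := h.step (List.prefix_refl _) (by simp)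
      cases hk : κ.isPositive with
      | false =>
        rw [cov_neg _ hk] at hb
        simp [hbk] at hb
        have ih' := (ih _ (by simp) hl').1 b u X' rfl hb hpb
        cases hpk : pI ξ I κ with
        | false => rw [filter_single_false hpk]; exact ih'
        | true =>
          rw [filter_single_true hpk, cov_neg _ hk]
          exact ih'.trans (List.prefix_append _ _)
      | true =>
        obtain ⟨x, hx⟩ := mem_split_prefix hm
        have hx' := hx.trans (List.prefix_append _ [κ])
        rw [h.cov_pos (List.prefix_refl _) hk hx' hj] at hb
        simp only [List.mem_append, List.mem_singleton, hbk, or_false] at hb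
        obtain ⟨y, hy⟩ := mem_split_prefix (cov_subset hb)
        have hyu : y = u := (h.at_unique (hy.trans hx')
          (⟨X' ++ [κ], by simp⟩ : u ++ [b] <+: u ++ b :: X' ++ [κ]) rfl).1
        subst hyu
        obtain ⟨Z, hZ⟩ := hy
        have ih' := (ih (x ++ [m]) (by have := hx.length_le; simp at this ⊢; omega)
          (h.pre hx')).1 b y Z (by rw [← hZ]; simp) hb hpb
        obtain ⟨v0, hv0⟩ := List.getLast?_eq_some_iff.mp hn
        have hpp := pos_prev (I := I) (w := v0) (n := n) (a := κ) (by rw [← hv0]; exact h) hk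
        cases hpk : pI ξ I κ with
        | false =>
          rw [filter_single_false hpk]
          have hpm : pI ξ I m = false := by
            rw [h.pI_just' (hx'.subset (by simp)) hj, hpk]
            exact hl'.neg_isIn hm (by rw [hmp, hk]; rfl)
          refine ih'.trans ((ih _ (by simp) hl').2 v0 n m x hv0 (by rw [hnp, hk]; rfl) (by rw [hpp.1, hpk])
            (h1 hk) hpm hx)
        | true =>
          rw [filter_single_true hpk]
          have hpm := h.pI_just (hx'.subset (by simp)) hj hpk
          obtain ⟨w2, hw2⟩ := hx
          have e : (y ++ b :: X').filter (pI ξ I) = x.filter (pI ξ I) ++ m :: w2.filter (pI ξ I) := by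
            rw [← hw2]; simp [List.filter_append, hpm]
          have hke : ∀ z ∈ (y ++ b :: X'), z.justifies κ → z = m := fun z hz hzj =>
            h.just_unique (by simp only [List.mem_append, hz, true_or]) (hx'.subset (by simp)) hzj hj
          have hmw2 : m ∉ w2 := by
            have := hl'.nodup
            rw [← hw2] at this
            intro hm2
            exact (List.nodup_append.mp this).2.2 m (by simp) m hm2 rfl
          have hc : cov ((y ++ b :: X').filter (pI ξ I) ++ [κ]) = cov ((x ++ [m]).filter (pI ξ I)) ++ [κ] := by
            have hkd : κ ≠ daimon := (just_ne_dai hj).2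
            rw [e, filter_single_true hpm]
            simp only [cov, List.map_append, List.map_cons, List.map_nil]
            have := view_neg_just ((x.filter (pI ξ I)).map dual) ((w2.filter (pI ξ I)).map dual)
              (m := m.dual) (a := κ.dual) (by rw [pol_dual hkd, hk]; rfl) (justifies_dual.mpr hj) (by
                intro z hz hzj
                simp only [List.mem_map, List.mem_filter] at hz
                obtain ⟨z, ⟨hz1, hz2⟩, rfl⟩ := hz
                have := hke z (by rw [← hw2]; simp [hz1]) (justifies_dual.mp hzj)
                exact hmw2 (this ▸ hz1))
            rw [this]; simp [dual_dual]
          rw [hc]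
          exact ih'.trans (List.prefix_append _ _)
    · rintro w0 n m x rfl hn hpn hmv hpm hx
      by_cases hmn : m = n
      · subst hmn
        have := (h.at_unique hx (List.prefix_refl _) rfl).1
        subst this
        exact List.prefix_refl _
      have hl' := h.pre (List.prefix_append _ [n])
      have hw0 : w0 ≠ [] := by
        rintro rfl
        simp [view_single] at hmv; exact hmn hmv
      obtain ⟨n', m', hn', hnp, hm', hj, hmp, h1, h2⟩ := h.step (List.prefix_refl _) hw0
      obtain ⟨y, hy⟩ := mem_split_prefix hm'
      have hy' := hy.trans (List.prefix_append _ [n])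
      have hc := h.view_neg (List.prefix_refl _) hn hy' hj
      rw [hc] at hmv
      simp only [List.mem_append, List.mem_singleton, hmn, or_false] at hmv
      have hm'p : m'.isPositive = true := by rw [hmp, hn]; rfl
      have hmi : isIn ξ m = false := by
        cases hh : isIn ξ m with
        | false => rfl
        | true => simp [pI, hh] at hpm
      rcases List.eq_nil_or_concat' y with rfl | ⟨y0, n2, rfl⟩
      · simp [view_single] at hmv
        subst hmv
        rw [(h.isIn_nil hy').mpr rfl] at hmi; cases hmi
      have hly := h.pre hy'
      have hm'i := (pos_prev (I := I) hly hm'p)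
      have hpm' : pI ξ I m' = false := by rw [h.pI_just' (hy'.subset (by simp)) hj hm'i.2.2, hpn]
      have hlen := hy.length_le
      simp only [List.length_append, List.length_singleton] at hlen
      have hP : cov ((y0 ++ [n2]).filter (pI ξ I)) <+: cov (w0.filter (pI ξ I)) := by
        obtain ⟨Z, hZ⟩ := hy
        exact (ih w0 (by simp) hl').1 m' (y0 ++ [n2]) Z (by rw [← hZ]; simp) (h2 hn) hpm'
      rw [filter_single_false hpn]
      by_cases hmm : m = m'
      · subst hmm
        have := (h.at_unique hx hy' rfl).1
        subst this
        rw [filter_single_false hpm]; exact hP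
      rw [view_pos _ hm'p] at hmv
      simp only [List.mem_append, List.mem_singleton, hmm, or_false] at hmv
      have hn2 : n2.isPositive = false := by rw [hly.alt (List.prefix_refl _), hm'p]; rfl
      refine List.IsPrefix.trans ?_ hP
      obtain ⟨x', hx'⟩ := mem_split_prefix (view_subset hmv)
      have := (h.at_unique hx (hx'.trans ((List.prefix_append _ [m']).trans hy')) rfl).1
      subst this
      exact (ih (y0 ++ [n2]) (by simp; omega) (hly.pre (List.prefix_append _ _))).2 y0 n2 m x rfl hn2
        (by rw [hm'i.1, hpm']) hmv hpm hx'
theorem cov_filter (h : Legal ξ true w) : ∀ b, b ∈ cov w → pI ξ I b = true →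
    b ∈ cov (w.filter (pI ξ I)) := by
  induction w using prefix_induction with
  | h w ih =>
    intro b hb hpb
    rcases List.eq_nil_or_concat' w with rfl | ⟨w0, κ, rfl⟩
    · simp [cov_nil] at hb
    by_cases hbk : b = κ
    · subst hbk
      rw [filter_single_true hpb]
      have := cov_getLast? (w0.filter (pI ξ I) ++ [b])
      simp at this
      exact List.mem_of_getLast? this
    by_cases hne : w0 = []
    · subst hne
      simp [cov_single, hbk] at hb
    have hl' := h.pre (List.prefix_append _ [κ])
    obtain ⟨n, m, hn, hnp, hm, hj, hmp, h1, h2⟩ := h.step (List.prefix_refl _) hne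
    cases hk : κ.isPositive with
    | false =>
      rw [cov_neg _ hk] at hb
      simp [hbk] at hb
      have ih' := ih _ (by simp) hl' b hb hpb
      cases hpk : pI ξ I κ with
      | false => rw [filter_single_false hpk]; exact ih'
      | true => rw [filter_single_true hpk, cov_neg _ hk]; simp [ih']
    | true =>
      obtain ⟨x, hx⟩ := mem_split_prefix hm
      have hx' := hx.trans (List.prefix_append _ [κ])
      have hc := h.cov_pos (List.prefix_refl _) hk hx' hj
      rw [hc] at hb
      simp only [List.mem_append, List.mem_singleton, hbk, or_false] at hb
      have ih' := ih (x ++ [m]) (by have := hx.length_le; simp at this ⊢; omega) (h.pre hx') b hb hpb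
      cases hpk : pI ξ I κ with
      | false =>
        rw [filter_single_false hpk]
        obtain ⟨v0, rfl⟩ := List.getLast?_eq_some_iff.mp hn
        have hpp := pos_prev (I := I) h hk
        have hpm : pI ξ I m = false := by
          rw [h.pI_just' (hx'.subset (by simp)) hj, hpk]
          exact hl'.neg_isIn hm (by rw [hmp, hk]; rfl)
        exact ((pq hl').2 v0 n m x rfl (by rw [hnp, hk]; rfl) (by rw [hpp.1, hpk])
            (h1 hk) hpm hx).subset ih'
      | true =>
        rw [filter_single_true hpk]
        have hpm := h.pI_just (hx'.subset (by simp)) hj hpk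
        obtain ⟨w2, hw2⟩ := hx
        have e : w0.filter (pI ξ I) = x.filter (pI ξ I) ++ m :: w2.filter (pI ξ I) := by
          rw [← hw2]; simp [List.filter_append, hpm]
        have hmw2 : m ∉ w2 := by
          have := hl'.nodup
          rw [← hw2] at this
          intro hm2
          exact (List.nodup_append.mp this).2.2 m (by simp) m hm2 rfl
        have hc : cov (w0.filter (pI ξ I) ++ [κ]) = cov ((x ++ [m]).filter (pI ξ I)) ++ [κ] := by
          have hkd : κ ≠ daimon := (just_ne_dai hj).2
          rw [e, filter_single_true hpm]
          simp only [cov, List.map_append, List.map_cons, List.map_nil]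
          have := view_neg_just ((x.filter (pI ξ I)).map dual) ((w2.filter (pI ξ I)).map dual)
            (m := m.dual) (a := κ.dual) (by rw [pol_dual hkd, hk]; rfl) (justifies_dual.mpr hj) (by
              intro z hz hzj
              simp only [List.mem_map, List.mem_filter] at hz
              obtain ⟨z, ⟨hz1, hz2⟩, rfl⟩ := hz
              have hzw : z ∈ w0 := by rw [← hw2]; simp [hz1]
              have : z = m := h.just_unique (by simp [hzw])
                (hx'.subset (by simp)) (justifies_dual.mp hzj) hj
              exact hmw2 (this ▸ hz1))
          rw [this]; simp [dual_dual]
        rw [hc]; exact List.mem_append_left _ ih'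
theorem Legal.filter (h : Legal ξ true s) (I : Finset ℕ) : Legal ξ true (s.filter (pI ξ I)) := by
  induction s using List.reverseRecOn with
  | nil => exact legal_nil
  | append_singleton w a ih =>
    have hl' := h.pre (List.prefix_append _ [a])
    cases hpa : pI ξ I a with
    | false => rw [filter_single_false hpa]; exact ih hl'
    | true =>
      rw [filter_single_true hpa, legal_snoc]
      refine ⟨ih hl', ?_⟩
      obtain ⟨b, f, L, rfl, hf, h2⟩ := h _ _ (List.prefix_refl _)
      refine ⟨b, f, L, rfl, ?_, ?_⟩
      · intro hf'
        obtain ⟨b', L', hm⟩ := mem_foci.mp hf'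
        exact hf (mem_foci.mpr ⟨b', L', (List.mem_filter.mp hm).1⟩)
      rcases h2 with ⟨rfl, h3⟩ | ⟨n, m, hn, hnp, hm, hj, hmp, h1, h2⟩
      · left; exact ⟨rfl, h3⟩
      right
      have hpm := h.pI_just (by simp [hm]) hj hpa
      have hmf : m ∈ w.filter (pI ξ I) := List.mem_filter.mpr ⟨hm, hpm⟩
      obtain ⟨w0, rfl⟩ := List.getLast?_eq_some_iff.mp hn
      cases b with
      | true =>
        have hpn : pI ξ I n = true := by rw [(pos_prev h rfl).1, hpa]
        refine ⟨n, m, by rw [filter_single_true hpn]; simp, hnp, hmf, hj, hmp, ?_, by simp⟩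
        intro _
        rw [view_filter hl' w0 n rfl hpn]; exact h1 rfl
      | false =>
        obtain ⟨b, hb, hbp⟩ := filter_last_pos (I := I) hl' w0 n rfl hnp
        refine ⟨b, m, hb, hbp, hmf, hj, hmp, by simp, ?_⟩
        intro _
        exact cov_filter hl' m (h2 rfl) hpm
end P10
end Part10
section Part11
open Action
section P11
def rl (ξ : Address) (L : Finset ℕ) : Action → Action
  | daimon => daimon
  | proper b f M => if f = ξ then proper b f L else proper b f M
variable {ξ : Address} {pos : Bool} {q s u v w c d t tl : List Action} {a b m n κ : Action}
  {X Y D E : DSet} {I J K L M : Finset ℕ}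
theorem rl_init (p : Bool) : rl ξ L (proper p ξ M) = proper p ξ L := by simp [rl]
theorem rl_isPositive (a : Action) : (rl ξ L a).isPositive = a.isPositive := by
  cases a with
  | daimon => rfl
  | proper p f M => simp only [rl]; split <;> rfl
theorem rl_focus (a : Action) : (rl ξ L a).focus? = a.focus? := by
  cases a with
  | daimon => rfl
  | proper p f M => simp only [rl]; split <;> rfl
theorem rl_dual (a : Action) : rl ξ L a.dual = (rl ξ L a).dual := by
  cases a with
  | daimon => rfl
  | proper p f M => simp only [rl, dual]; split <;> rfl
theorem rl_isIn (a : Action) : isIn ξ (rl ξ L a) = isIn ξ a := by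
  cases a with
  | daimon => rfl
  | proper p f M => simp only [rl]; split <;> rfl
theorem rl_cls (a : Action) : cls ξ I (rl ξ L a) = cls ξ I a := by
  cases a with
  | daimon => rfl
  | proper p f M => simp only [rl]; split <;> rfl
theorem rl_pI (a : Action) : pI ξ I (rl ξ L a) = pI ξ I a := by
  simp [pI, rl_cls, rl_isIn]
theorem rl_rl (a : Action) : rl ξ L (rl ξ M a) = rl ξ L a := by
  cases a with
  | daimon => rfl
  | proper p f N => by_cases hf : f = ξ <;> simp [rl, hf]
theorem rl_not_in (h : isIn ξ a = false) : rl ξ L a = a := by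
  cases a with
  | daimon => rfl
  | proper p f N => simp [isIn] at h; simp [rl, h]
theorem rl_ne_dai : rl ξ L a = daimon ↔ a = daimon := by
  cases a with
  | daimon => simp [rl]
  | proper p f M => simp only [rl]; split <;> simp
theorem rl_map_dual (s : List Action) : (s.map dual).map (rl ξ L) = (s.map (rl ξ L)).map dual := by
  simp [rl_dual]
theorem rl_map_rl (s : List Action) : (s.map (rl ξ M)).map (rl ξ L) = s.map (rl ξ L) := by
  simp [rl_rl]
theorem rl_foci (s : List Action) : foci (s.map (rl ξ L)) = foci s := by
  simp only [foci, List.filterMap_map]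
  congr 1; funext a; exact rl_focus a
def RF (ξ : Address) (L : Finset ℕ) (s : List Action) : Prop :=
  ∀ b k M, proper b (ξ ++ [k]) M ∈ s → k ∈ L
def Rel (ξ : Address) (L : Finset ℕ) (s : List Action) : Prop :=
  RF ξ L s ∧ ∀ b M, proper b ξ M ∈ s → RF ξ M s
theorem RF.sub (h : RF ξ L s) (hu : ∀ x ∈ u, x ∈ s) : RF ξ L u :=
  fun b k M hm => h b k M (hu _ hm)
theorem Rel.sub (h : Rel ξ L s) (hu : ∀ x ∈ u, x ∈ s) : Rel ξ L u :=
  ⟨h.1.sub hu, fun b M hm => (h.2 b M (hu _ hm)).sub hu⟩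
theorem RF.mono (h : RF ξ L s) (hu : L ⊆ M) : RF ξ M s :=
  fun b k N hm => hu (h b k N hm)
theorem mem_map_dual : a ∈ s.map dual ↔ a.dual ∈ s := by
  constructor
  · intro h; obtain ⟨x, hx, rfl⟩ := List.mem_map.mp h; rwa [dual_dual]
  · intro h; exact List.mem_map.mpr ⟨_, h, dual_dual a⟩
theorem RF.dual (h : RF ξ L s) : RF ξ L (s.map dual) := by
  intro b k M hm
  exact h (!b) k M (mem_map_dual.mp hm)
theorem RF.rl (h : RF ξ L s) : RF ξ L (s.map (rl ξ K)) := by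
  intro b k M hm
  obtain ⟨x, hx, he⟩ := List.mem_map.mp hm
  rw [rl_not_in] at he
  · rw [he] at hx; exact h b k M hx
  · rw [← rl_isIn (L := K), he]; simp [isIn]
theorem Rel.dual (h : Rel ξ L s) : Rel ξ L (s.map dual) :=
  ⟨h.1.dual, fun b M hm => (h.2 (!b) M (mem_map_dual.mp hm)).dual⟩
theorem Legal.init_rf (h : Legal ξ pos s) (hi : proper b' ξ M ∈ s) : RF ξ M s := by
  intro b k N hm
  obtain ⟨w, hw⟩ := mem_split_prefix hm
  by_cases hne : w = []
  · have := (h.isIn_nil hw).mpr hne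
    simp [isIn] at this
  · obtain ⟨n, m, _, _, hm, hj, _⟩ := h.step hw hne
    obtain ⟨p, f, L, q, i, M', rfl, hi', he⟩ := justifies_iff.mp hj
    simp only [proper.injEq] at he
    have h2 := List.append_inj' he.2.1 rfl
    simp at h2
    have h3 := h.mem_unique (a := proper p f L) (hw.subset (by simp [hm])) hi (by simp [focus?, h2.1])
    simp at h3
    rw [h2.2, ← h3.2.2]; exact hi'
theorem Legal.rel (h : Legal ξ pos s) (hr : RF ξ L s) : Rel ξ L s :=
  ⟨hr, fun _ _ hm => h.init_rf hm⟩
theorem rl_just (h : Rel ξ L s) (ha : a ∈ s) (hb : b ∈ s) :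
    (rl ξ L a).justifiesB (rl ξ L b) = a.justifiesB b := by
  rw [Bool.eq_iff_iff]
  show (rl ξ L a).justifies (rl ξ L b) ↔ a.justifies b
  cases a with
  | daimon => simp [rl, justifies, justifiesB]
  | proper p f M =>
    cases b with
    | daimon => simp [rl, justifies, justifiesB]
    | proper q g N =>
      by_cases hg : g = ξ
      · subst hg
        by_cases hf : f = g
        · subst hf; simp [rl, justifies, justifiesB]
        · simp [rl, justifies, justifiesB, hf]
      · by_cases hf : f = ξ
        · subst hf
          simp only [rl, if_true, hg, if_false, justifies, justifiesB, decide_eq_true_eq]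
          constructor
          · rintro ⟨i, hi, rfl⟩; exact ⟨i, h.2 _ _ ha _ _ _ hb, rfl⟩
          · rintro ⟨i, hi, rfl⟩; exact ⟨i, h.1 _ _ _ hb, rfl⟩
        · simp [rl, hf, hg]
theorem view_rl (h : Rel ξ L s) : view (s.map (rl ξ L)) = (view s).map (rl ξ L) :=
  view_map _ _ (fun _ _ => rl_isPositive _) (fun _ ha _ hb => rl_just h ha hb)
theorem cov_rl (h : Rel ξ L s) : cov (s.map (rl ξ L)) = (cov s).map (rl ξ L) := by
  simp only [cov]
  rw [← rl_map_dual, view_rl h.dual, ← rl_map_dual]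
theorem Legal.rl (h : Legal ξ pos s) (hr : RF ξ L s) : Legal ξ pos (s.map (rl ξ L)) := by
  induction s using List.reverseRecOn with
  | nil => exact legal_nil
  | append_singleton w a ih =>
    have hl' := h.pre (List.prefix_append _ [a])
    have hr' : RF ξ L w := hr.sub (fun x hx => by simp [hx])
    rw [List.map_append, List.map_singleton, legal_snoc]
    refine ⟨ih hl' hr', ?_⟩
    have had : Ludics.rl ξ L a ≠ daimon := fun hh => h.dai (by simp [rl_ne_dai.mp hh])
    obtain ⟨b, f, N, hb⟩ := focus_none had
    have hfa : a.focus? = some f := by rw [← rl_focus (L := L) (ξ := ξ), hb]; rfl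
    have hpa : a.isPositive = b := by rw [← rl_isPositive (L := L) (ξ := ξ), hb]; rfl
    refine ⟨b, f, N, hb, by rw [rl_foci]; exact h.fresh (List.prefix_refl _) hfa, ?_⟩
    by_cases hne : w = []
    · subst hne
      left
      obtain ⟨L', rfl⟩ := Legal.head (s := []) (by simpa using h)
      simp [focus?] at hfa
      exact ⟨rfl, by rw [← hpa]; rfl, hfa.symm⟩
    right
    obtain ⟨n, m, hn, hnp, hm, hj, hmp, h1, h2⟩ := h.step (List.prefix_refl _) hne
    refine ⟨Ludics.rl ξ L n, Ludics.rl ξ L m, by simp [hn], by rw [rl_isPositive, hnp, hpa], List.mem_map_of_mem hm, ?_,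
      by rw [rl_isPositive, hmp, hpa], ?_, ?_⟩
    · show justifiesB _ _ = true
      rw [rl_just (h.rel hr) (by simp [hm]) (by simp)]; exact hj
    · rintro rfl
      rw [view_rl (hl'.rel hr')]
      exact List.mem_map_of_mem (h1 hpa)
    · rintro rfl
      rw [cov_rl (hl'.rel hr')]
      exact List.mem_map_of_mem (h2 hpa)
noncomputable def proj (ξ : Address) (I : Finset ℕ) (s : List Action) : List Action :=
  (s.filter (pI ξ I)).map (rl ξ I)
theorem filter_rf : RF ξ I (s.filter (pI ξ I)) := by
  intro b k M hm
  have := (List.mem_filter.mp hm).2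
  simp [pI, isIn, cls] at this
  exact this
theorem Legal.proj (h : Legal ξ true s) (I : Finset ℕ) : Legal ξ true (proj ξ I s) :=
  (h.filter I).rl filter_rf
theorem proj_nil : proj ξ I [] = [] := rfl
theorem proj_true (h : pI ξ I a = true) : proj ξ I (w ++ [a]) = proj ξ I w ++ [rl ξ I a] := by
  simp [proj, filter_single_true h]
theorem proj_false (h : pI ξ I a = false) : proj ξ I (w ++ [a]) = proj ξ I w := by
  simp [proj, filter_single_false h]
theorem view_proj (h : Legal ξ true (w ++ [a])) (ha : pI ξ I a = true) :
    view (proj ξ I (w ++ [a])) = (view (w ++ [a])).map (rl ξ I) := by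
  rw [proj, view_rl ((h.filter I).rel filter_rf), view_filter h w a rfl ha]
theorem mem_proj : κ ∈ proj ξ I s ↔ ∃ x ∈ s, pI ξ I x = true ∧ κ = rl ξ I x := by
  simp only [proj, List.mem_map, List.mem_filter]
  constructor
  · rintro ⟨x, ⟨h1, h2⟩, rfl⟩; exact ⟨x, h1, h2, rfl⟩
  · rintro ⟨x, h1, h2, rfl⟩; exact ⟨x, ⟨h1, h2⟩, rfl⟩
theorem prefix_proj (h : u ++ [κ] <+: proj ξ I s) : ∃ w a, w ++ [a] <+: s ∧ pI ξ I a = true ∧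
    u = proj ξ I w ∧ κ = rl ξ I a := by
  induction s using List.reverseRecOn with
  | nil => simp [proj_nil] at h
  | append_singleton w a ih =>
    cases ha : pI ξ I a with
    | false =>
      rw [proj_false ha] at h
      obtain ⟨w', a', h1, h2⟩ := ih h
      exact ⟨w', a', h1.trans (List.prefix_append _ _), h2⟩
    | true =>
      rw [proj_true ha] at h
      rcases prefix_snoc h with h | h
      · obtain ⟨w', a', h1, h2⟩ := ih h
        exact ⟨w', a', h1.trans (List.prefix_append _ _), h2⟩
      · have := List.append_inj' h rfl
        simp at this
        exact ⟨w, a, List.prefix_refl _, ha, this⟩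
theorem proj_prefix (h : u <+: s) : proj ξ I u <+: proj ξ I s := (h.filter _).map _
theorem justChain_filter (h : Legal ξ true s) (hc : JustChain (simpleBase ξ true) s t) :
    ∀ κ, t.getLast? = some κ → pI ξ I κ = true →
    JustChain (simpleBase ξ true) (s.filter (pI ξ I)) t := by
  induction hc with
  | init h1 h2 => 
    intro κ hk hp
    simp at hk; subst hk
    exact .init (List.mem_filter.mpr ⟨h1, hp⟩) h2
  | @cons t' k k' h1 h2 h3 ih =>
    intro κ hk hp
    simp at hk; subst hk
    obtain ⟨k0, hk0, hkk⟩ := justChain_last h1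
    simp at hkk; subst hkk
    exact .cons (ih k (by simp) (h.pI_just hk0 h3 hp)) (List.mem_filter.mpr ⟨h2, hp⟩) h3
theorem justChain_rl (h : Rel ξ L s) (hc : JustChain (simpleBase ξ true) s t) :
    JustChain (simpleBase ξ true) (s.map (rl ξ L)) (t.map (rl ξ L)) := by
  induction hc with
  | init h1 h2 =>
    obtain ⟨I, rfl⟩ := initial_simple.mp h2
    exact .init (List.mem_map_of_mem h1) (initial_simple.mpr ⟨L, rl_init _⟩)
  | @cons t' k k' h1 h2 h3 ih =>
    obtain ⟨k0, hk0, hkk⟩ := justChain_last h1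
    simp at hkk; subst hkk
    have := JustChain.cons (s := t'.map (rl ξ L)) (κ := rl ξ L k) (κ' := rl ξ L k')
      (by simpa using ih) (List.mem_map_of_mem h2) (by
        show justifiesB _ _ = true
        rw [rl_just h hk0 h2]; exact h3)
    simpa using this
theorem justChain_proj (h : Legal ξ true s) (hc : JustChain (simpleBase ξ true) s t)
    (hl : t.getLast? = some κ) (hp : pI ξ I κ = true) :
    JustChain (simpleBase ξ true) (proj ξ I s) (t.map (rl ξ I)) :=
  justChain_rl ((h.filter I).rel filter_rf) (justChain_filter h hc κ hl hp)
theorem justChain_sub (h : Legal ξ true s) (hv : Legal ξ true v) (hsub : ∀ x ∈ v, x ∈ s)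
    (hc : JustChain (simpleBase ξ true) s t) :
    ∀ κ, t.getLast? = some κ → κ ∈ v → JustChain (simpleBase ξ true) v t := by
  induction hc with
  | init h1 h2 => 
    intro κ hk hp
    simp at hk; subst hk
    exact .init hp h2
  | @cons t' k k' h1 h2 h3 ih =>
    intro κ hk hp
    simp at hk; subst hk
    obtain ⟨k0, hk0, hkk⟩ := justChain_last h1
    simp at hkk; subst hkk
    refine .cons (ih k (by simp) ?_) hp h3
    obtain ⟨w, hw⟩ := mem_split_prefix hp
    by_cases hne : w = []
    · have := (hv.isIn_nil hw).mpr hne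
      rw [h.just_isIn hk0 h3] at this; cases this
    · obtain ⟨_, m, _, _, hm, hj, _⟩ := hv.step hw hne
      have hmv : m ∈ v := hw.subset (by simp [hm])
      rw [h.just_unique hk0 (hsub m hmv) h3 hj]; exact hmv
end P11
end Part11
section Part12
open Action
section P12
variable {ξ : Address} {pos : Bool} {q s u v w c d t t1 t2 tl : List Action} {a b m n κ : Action}
  {X Y D E : DSet} {I J K L I' J' K' : Finset ℕ}
theorem cons_snoc_prefix (h : w ++ [a] <+: b :: t) : (w = [] ∧ a = b) ∨
    ∃ w', w = b :: w' ∧ w' ++ [a] <+: t := by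
  cases w with
  | nil =>
    left
    have := (List.cons_prefix_cons.mp h).1
    exact ⟨rfl, this⟩
  | cons x w' =>
    right
    rw [List.cons_append, List.cons_prefix_cons] at h
    exact ⟨w', by rw [h.1], h.2⟩
theorem chrStep_rl (h : ChrStep ξ pos (proper pos ξ I :: w) a) (hIK : I ⊆ K) :
    ChrStep ξ pos (proper pos ξ K :: w) a := by
  rcases h with ⟨h, _⟩ | ⟨b, hb, hbd, hp, hf, hn, hps⟩
  · cases h
  have hJ : (proper pos ξ I).justifies a → (proper pos ξ K).justifies a := by
    intro hj
    obtain ⟨p, f, L, q, i, M, he, hi, rfl⟩ := justifies_iff.mp hj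
    simp only [proper.injEq] at he
    obtain ⟨rfl, rfl, rfl⟩ := he
    exact justifies_iff.mpr ⟨_, _, _, _, _, _, rfl, hIK hi, rfl⟩
  refine Or.inr ?_
  have hf' : ∀ f, a.focus? = some f → f ∉ foci (proper pos ξ K :: w) := fun f h => hf f h
  have hps' : a.isPositive = true → a ≠ daimon → ∃ m ∈ (proper pos ξ K :: w), m.justifies a := by
    intro h1 h2
    obtain ⟨m, hm, hj⟩ := hps h1 h2
    rcases List.mem_cons.mp hm with rfl | hm
    · exact ⟨_, by simp, hJ hj⟩
    · exact ⟨m, by simp [hm], hj⟩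
  rcases List.eq_nil_or_concat' w with rfl | ⟨w', x, rfl⟩
  · simp at hb; subst hb
    exact ⟨proper pos ξ K, by simp, by simp, by simpa [isPositive] using hp, hf', fun h => hJ (hn h), hps'⟩
  · rw [← List.cons_append, List.getLast?_append] at hb
    simp at hb; subst hb
    exact ⟨x, by rw [← List.cons_append, List.getLast?_append]; simp, hbd, hp, hf', hn, hps'⟩
theorem chr_rl (h : Chr ξ pos (proper pos ξ I :: t)) (hIK : I ⊆ K) : Chr ξ pos (proper pos ξ K :: t) := by
  refine ⟨by simp, ?_⟩
  intro w a hw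
  rcases cons_snoc_prefix hw with ⟨rfl, rfl⟩ | ⟨w', rfl, hw'⟩
  · exact Or.inl ⟨rfl, Or.inl ⟨K, rfl⟩⟩
  · exact chrStep_rl (h.2 (proper pos ξ I :: w') a (by
      rw [List.cons_append]; exact List.cons_prefix_cons.mpr ⟨rfl, hw'⟩)) hIK
theorem just_cls_init (hj : (proper pos ξ I).justifies a) : cls ξ I a = true := by
  obtain ⟨p, f, L, q, i, M, he, hi, rfl⟩ := justifies_iff.mp hj
  simp only [proper.injEq] at he
  obtain ⟨rfl, rfl, rfl⟩ := he
  simp only [cls, decide_eq_true_eq]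
  exact ⟨i, hi, List.prefix_refl _⟩
theorem cls_just' (hj : m.justifies a) (hm : cls ξ I m = true) : cls ξ I a = true := by
  rw [← cls_just hj, hm]
  cases m with
  | daimon => rfl
  | proper p f M =>
    simp [cls] at hm
    obtain ⟨i, _, h⟩ := hm
    have := h.length_le
    simp only [isIn, decide_eq_false_iff_not]
    rintro rfl
    simp at this
theorem chr_cls (h : Chr ξ pos (proper pos ξ I :: t)) : ∀ a ∈ t, a ≠ daimon → cls ξ I a = true := by
  induction t using List.reverseRecOn with
  | nil => simp
  | append_singleton w x ih =>
    have ih := ih ⟨by simp, h.2.prefix (by rw [← List.cons_append]; exact List.prefix_append _ _)⟩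
    intro a ha had
    rcases List.mem_append.mp ha with ha | ha
    · exact ih a ha had
    simp at ha; subst ha
    rcases h.2 (proper pos ξ I :: w) a (List.prefix_refl _) with ⟨h, _⟩ | ⟨b, hb, hbd, hp, hf, hn, hps⟩
    · cases h
    have key : ∀ m ∈ proper pos ξ I :: w, m.justifies a → cls ξ I a = true := by
      intro m hm hj
      rcases List.mem_cons.mp hm with rfl | hm
      · exact just_cls_init hj
      · exact cls_just' hj (ih m hm (just_ne_dai hj).1)
    cases hpa : a.isPositive with
    | true => obtain ⟨m, hm, hj⟩ := hps hpa had; exact key m hm hj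
    | false => exact key b (List.mem_of_getLast? hb) (hn hpa)
theorem cls_isIn (h : cls ξ I a = true) : isIn ξ a = false := by
  cases a with
  | daimon => rfl
  | proper p f M =>
    simp [cls] at h
    obtain ⟨i, _, h⟩ := h
    have := h.length_le
    simp only [isIn, decide_eq_false_iff_not]
    rintro rfl
    simp at this
theorem cls_disj (hd : Disjoint I J) (h : cls ξ I a = true) : cls ξ J a = false := by
  cases a with
  | daimon => rfl
  | proper p f M =>
    by_contra hh
    simp [cls] at h hh
    obtain ⟨i, hi, h⟩ := h
    obtain ⟨j, hj, h'⟩ := hh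
    have := List.prefix_of_prefix_length_le h h' (by simp)
    have := this.eq_of_length (by simp)
    simp at this
    subst this
    exact Finset.disjoint_left.mp hd hi hj
theorem chr_not_in (h : Chr ξ pos (proper pos ξ I :: t)) : ∀ a ∈ t, isIn ξ a = false := by
  intro a ha
  by_cases had : a = daimon
  · subst had; rfl
  · exact cls_isIn (chr_cls h a ha had)
theorem map_rl_id (h : ∀ a ∈ t, isIn ξ a = false) : t.map (rl ξ L) = t := by
  conv_rhs => rw [← List.map_id t]
  exact List.map_congr_left (fun a ha => rl_not_in (h a ha))
theorem chr_map_rl (h : Chr ξ pos (proper pos ξ I :: t)) :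
    (proper pos ξ I :: t).map (rl ξ K) = proper pos ξ K :: t := by
  rw [List.map_cons, rl_init, map_rl_id (chr_not_in h)]
theorem coh_rl (h : Coherent (proper pos ξ I :: t1) (proper pos ξ I' :: t2))
    (h1 : K = K' → I = I') (h2 : K = K' ∨ pos = false) :
    Coherent (proper pos ξ K :: t1) (proper pos ξ K' :: t2) := by
  constructor
  · intro w κ₁ κ₂ hw1 hw2
    rcases cons_snoc_prefix hw1 with ⟨rfl, rfl⟩ | ⟨w1, rfl, hw1⟩
    · rcases cons_snoc_prefix hw2 with ⟨_, rfl⟩ | ⟨w', h, _⟩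
      · rcases h2 with rfl | rfl
        · left; rfl
        · right; exact ⟨rfl, rfl⟩
      · cases h
    · rcases cons_snoc_prefix hw2 with ⟨h, rfl⟩ | ⟨w', h', hw2⟩
      · cases h
      · simp only [List.cons.injEq, proper.injEq, true_and] at h'
        obtain ⟨hK, rfl⟩ := h'
        obtain rfl := h1 hK
        exact h.1 (proper pos ξ I :: w1) κ₁ κ₂ (by simpa using hw1) (by simpa using hw2)
  · intro w ξ₁ I₁ w₁ σ₁ ξ₂ I₂ w₂ σ₂ hw1 hw2 hne
    cases w with
    | nil =>
      simp only [List.nil_append, List.cons_append, List.cons_prefix_cons, proper.injEq] at hw1 hw2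
      exact absurd (hw1.1.2.1.trans hw2.1.2.1.symm) hne
    | cons x w =>
      simp only [List.cons_append, List.cons_prefix_cons] at hw1 hw2
      obtain ⟨rfl, hw1⟩ := hw1
      simp only [proper.injEq, true_and] at hw2
      obtain ⟨hK, hw2⟩ := hw2
      obtain rfl := h1 hK
      refine h.2 (proper pos ξ I :: w) ξ₁ I₁ w₁ σ₁ ξ₂ I₂ w₂ σ₂ ?_ ?_ hne
      · simpa using hw1
      · simpa using hw2
def TD (ξ : Address) (I J : Finset ℕ) (D E : DSet) : DSet :=
  {c | ∃ t, c = proper true ξ (I ∪ J) :: t ∧ (proper true ξ I :: t ∈ D ∨ proper true ξ J :: t ∈ E)}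
theorem TD_comm : TD ξ I J D E = TD ξ J I E D := by
  ext c
  simp only [TD, Set.mem_ofPred_eq, Finset.union_comm I J, or_comm]
theorem coh_cross (h1 : Chr ξ true (proper true ξ I :: t1)) (h2 : Chr ξ true (proper true ξ J :: t2))
    (hd : Disjoint I J) : Coherent (proper true ξ K :: t1) (proper true ξ K :: t2) := by
  have key : ∀ x ∈ t1, ∀ y ∈ t2, ∀ f, x.focus? = some f → y.focus? ≠ some f := by
    intro x hx y hy f hf hf'
    have hxd : x ≠ daimon := by rintro rfl; cases hf
    have hyd : y ≠ daimon := by rintro rfl; cases hf'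
    have e1 := cls_disj hd (chr_cls h1 x hx hxd)
    have e2 := chr_cls h2 y hy hyd
    obtain ⟨b, g, M, rfl⟩ := focus_none hxd
    obtain ⟨b', g', M', rfl⟩ := focus_none hyd
    simp only [focus?, Option.some.injEq] at hf hf'
    subst hf; subst hf'
    simp only [cls] at e1 e2
    rw [e1] at e2; cases e2
  have second : ∀ {I t x}, Chr ξ true (proper true ξ I :: t) → [x] <+: t → x.isPositive = false := by
    intro I t x h hx
    rcases h.2 [proper true ξ I] x (by simpa using hx) with ⟨h, _⟩ | ⟨b, hb, hbd, hp, hf, hn, hps⟩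
    · cases h
    simp at hb; subst hb
    simpa [isPositive_proper] using hp
  constructor
  · intro w κ₁ κ₂ hw1 hw2
    rcases cons_snoc_prefix hw1 with ⟨rfl, rfl⟩ | ⟨w1, rfl, hv1⟩
    · rcases cons_snoc_prefix hw2 with ⟨_, rfl⟩ | ⟨w', h, _⟩
      · left; rfl
      · cases h
    rcases cons_snoc_prefix hw2 with ⟨h, rfl⟩ | ⟨w', h', hv2⟩
    · cases h
    simp only [List.cons.injEq, true_and] at h'
    subst h'
    cases w1 with
    | nil => exact Or.inr ⟨second h1 hv1, second h2 hv2⟩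
    | cons x w1 =>
      exfalso
      have hx : x ∈ t1 := hv1.subset (by simp)
      have hx2 : x ∈ t2 := hv2.subset (by simp)
      have hxp : x.isPositive = false := second h1 (List.IsPrefix.trans (by simp) hv1)
      obtain ⟨b, g, M, rfl⟩ := focus_none (neg_ne_dai hxp)
      exact key _ hx _ hx2 g rfl rfl
  · intro w ξ₁ I₁ w₁ σ₁ ξ₂ I₂ w₂ σ₂ hw1 hw2 hne f hf
    rcases cons_snoc_prefix hw1 with ⟨h, _⟩ | ⟨w1, _, hw1⟩
    · simp at h
    rcases cons_snoc_prefix hw2 with ⟨h, _⟩ | ⟨w2, _, hw2⟩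
    · simp at h
    exact key σ₁ (hw1.subset (by simp)) σ₂ (hw2.subset (by simp)) f hf
theorem max_rl (hD : IsDesign (simpleBase ξ pos) D) (hc : proper pos ξ I :: t ∈ D)
    (h : ∀ κ, proper pos ξ I :: t ++ [κ] ∉ D) :
    ∃ a, (proper pos ξ K :: t).getLast? = some a ∧ a.isPositive = true := by
  obtain ⟨a, ha, hp⟩ := hD.maxPos _ hc h
  rcases List.eq_nil_or_concat' t with rfl | ⟨w', x, rfl⟩
  · simp at ha; subst ha
    exact ⟨_, rfl, by simpa [isPositive_proper] using hp⟩
  · refine ⟨a, ?_, hp⟩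
    rw [← ha, ← List.cons_append, ← List.cons_append, List.getLast?_append, List.getLast?_append]; simp
theorem TD_design (hD : IsDesign (simpleBase ξ true) D) (hE : IsDesign (simpleBase ξ true) E)
    (hI : [proper true ξ I] ∈ D) (hd : Disjoint I J) :
    IsDesign (simpleBase ξ true) (TD ξ I J D E) where
  chron := by
    rintro c ⟨t, rfl, h | h⟩
    · exact chr_iff.mpr (chr_rl (des_chr hD h) Finset.subset_union_left)
    · exact chr_iff.mpr (chr_rl (des_chr hE h) Finset.subset_union_right)
  prefixClosed := by
    rintro c ⟨t, rfl, h⟩ d hd' hne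
    cases d with
    | nil => exact absurd rfl hne
    | cons x d =>
      obtain ⟨rfl, hd2⟩ := List.cons_prefix_cons.mp hd'
      refine ⟨d, rfl, h.imp (fun h => ?_) (fun h => ?_)⟩
      · exact hD.prefixClosed _ h _ (List.cons_prefix_cons.mpr ⟨rfl, hd2⟩) (by simp)
      · exact hE.prefixClosed _ h _ (List.cons_prefix_cons.mpr ⟨rfl, hd2⟩) (by simp)
  coherent := by
    rintro c ⟨t, rfl, h | h⟩ c' ⟨t', rfl, h' | h'⟩
    · exact coh_rl (hD.coherent _ h _ h') (fun _ => rfl) (Or.inl rfl)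
    · exact coh_cross (des_chr hD h) (des_chr hE h') hd
    · exact coh_cross (des_chr hE h) (des_chr hD h') hd.symm
    · exact coh_rl (hE.coherent _ h _ h') (fun _ => rfl) (Or.inl rfl)
  maxPos := by
    rintro c ⟨t, rfl, h | h⟩ hm
    · exact max_rl hD h (fun κ hk => hm κ ⟨t ++ [κ], rfl, Or.inl hk⟩)
    · exact max_rl hE h (fun κ hk => hm κ ⟨t ++ [κ], rfl, Or.inr hk⟩)
  posNonempty := fun _ => ⟨_, [], rfl, Or.inl hI⟩
def lift (ξ : Address) (SA SB : Set (Finset ℕ)) (E : DSet) : DSet :=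
  {c | ∃ I ∈ SA, ∃ J ∈ SB, ∃ t, c = proper false ξ (I ∪ J) :: t ∧ proper false ξ I :: t ∈ E}
def AlienS (SA SB : Set (Finset ℕ)) : Prop := ∀ I ∈ SA, ∀ J ∈ SB, Disjoint I J
theorem AlienS.inj {SA SB : Set (Finset ℕ)} (h : AlienS SA SB) (hI : I ∈ SA) (hI' : I' ∈ SA)
    (hJ : J ∈ SB) (hJ' : J' ∈ SB) (he : I ∪ J = I' ∪ J') : I = I' ∧ J = J' := by
  have d1 := h I hI J hJ
  have d2 := h I hI J' hJ'
  have d3 := h I' hI' J hJ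
  have d4 := h I' hI' J' hJ'
  simp only [Finset.ext_iff, Finset.mem_union, Finset.disjoint_left] at *
  constructor
  · intro x; have := he x; have := @d1 x; have := @d2 x; have := @d3 x; have := @d4 x; tauto
  · intro x; have := he x; have := @d1 x; have := @d2 x; have := @d3 x; have := @d4 x; tauto
theorem lift_design {SA SB : Set (Finset ℕ)} (h : AlienS SA SB) (hE : IsDesign (simpleBase ξ false) E) :
    IsDesign (simpleBase ξ false) (lift ξ SA SB E) where
  chron := by
    rintro c ⟨I, hI, J, hJ, t, rfl, ht⟩
    exact chr_iff.mpr (chr_rl (des_chr hE ht) Finset.subset_union_left)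
  prefixClosed := by
    rintro c ⟨I, hI, J, hJ, t, rfl, h⟩ d hd' hne
    cases d with
    | nil => exact absurd rfl hne
    | cons x d =>
      obtain ⟨rfl, hd2⟩ := List.cons_prefix_cons.mp hd'
      exact ⟨I, hI, J, hJ, d, rfl, hE.prefixClosed _ h _ (List.cons_prefix_cons.mpr ⟨rfl, hd2⟩) (by simp)⟩
  coherent := by
    rintro c ⟨I, hI, J, hJ, t, rfl, ht⟩ c' ⟨I', hI', J', hJ', t', rfl, ht'⟩
    exact coh_rl (hE.coherent _ ht _ ht') (fun he => (h.inj hI hI' hJ hJ' he).1) (Or.inr rfl)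
  maxPos := by
    rintro c ⟨I, hI, J, hJ, t, rfl, ht⟩ hm
    exact max_rl hE ht (fun κ hk => hm κ ⟨I, hI, J, hJ, t ++ [κ], rfl, hk⟩)
  posNonempty := fun hp => by simp [isPositive_simple] at hp
end P12
end Part12
section Part13
open Action
section P13
variable {ξ : Address} {pos : Bool} {q s u v w c d t t1 t2 tl x : List Action} {a b m n κ k : Action}
  {X Y D E F : DSet} {I J K L I' J' K' : Finset ℕ} {A B C : Behaviour ξ true} {SA SB : Set (Finset ℕ)}
abbrev dir (A : Behaviour ξ true) : Set (Finset ℕ) := directory ξ A.designs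
theorem dai_eq : CD ξ true [] = DaiDesign := by
  have hv : ∀ c, ¬ VV [] c := by
    rintro c ⟨w, hw, hne, _⟩; exact hne (List.prefix_nil.mp hw)
  have hn : ∀ c, ¬ NN ξ true [] c := by
    rintro c ⟨c0, f, L, rfl, ⟨_, h, _⟩ | ⟨h, _⟩⟩
    · cases h
    · exact hv _ h
  ext c
  show (VV [] c ∨ NN ξ true [] c ∨ DN ξ true [] c) ↔ c = [daimon]
  constructor
  · rintro (h | h | ⟨c0, rfl, h | ⟨rfl, _⟩, _⟩)
    · exact absurd h (hv _)
    · exact absurd h (hn _)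
    · exact absurd h (hn _)
    · rfl
  · rintro rfl
    exact Or.inr (Or.inr ⟨[], rfl, Or.inr ⟨rfl, rfl⟩, fun κ _ => hv _⟩)
theorem dai_orth (hX : IsDesign (simpleBase ξ false) X) : OrthP DaiDesign X := by
  rw [← dai_eq (ξ := ξ)]; exact orth_cd_nil hX
theorem hd_unique (hD : IsDesign (simpleBase ξ true) D) (h1 : [proper true ξ I] ∈ D)
    (h2 : [proper true ξ I'] ∈ D) : I = I' := by
  have := des_det (c := []) hD h1 h2 rfl
  simpa using this
theorem first_mem (hD : IsDesign (simpleBase ξ true) D) (h : firstAction D κ) : [κ] ∈ D := by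
  obtain ⟨c, hc, hh⟩ := h
  cases c with
  | nil => simp at hh
  | cons y c =>
    simp at hh; subst hh
    exact hD.prefixClosed _ hc _ (by simp) (by simp)
theorem des_cases (hD : IsDesign (simpleBase ξ true) D) : D = DaiDesign ∨ ∃ I, [proper true ξ I] ∈ D := by
  by_cases h : ∃ I, [proper true ξ I] ∈ D
  · exact Or.inr h
  left
  have key : ∀ c ∈ D, c = [daimon] := by
    intro c hc
    rcases chr_head (des_chr hD hc) with ⟨I, t, rfl⟩ | ⟨h, _⟩
    · exact absurd ⟨I, hD.prefixClosed _ hc _ (by simp) (by simp)⟩ h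
    · exact h
  obtain ⟨c, hc⟩ := hD.posNonempty (isPositive_simple.mpr rfl)
  ext d
  constructor
  · exact key d
  · rintro rfl; rw [← key c hc]; exact hc
theorem hd_ne_dai (h : [proper true ξ I] ∈ D) : D ≠ DaiDesign := by
  rintro rfl
  have : [proper true ξ I] = [daimon] := h
  simp at this
theorem hd_form (hD : IsDesign (simpleBase ξ true) D) (h : [proper true ξ I] ∈ D) (hc : c ∈ D) :
    ∃ t, c = proper true ξ I :: t := by
  rcases chr_head (des_chr hD hc) with ⟨I', t, rfl⟩ | ⟨rfl, _⟩
  · have := hd_unique (I' := I') hD h (hD.prefixClosed _ hc _ (by simp) (by simp))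
    subst this; exact ⟨t, rfl⟩
  · have := des_det (c := []) hD hc h rfl
    cases this
theorem tensorD_eq (hD : IsDesign (simpleBase ξ true) D) (hE : IsDesign (simpleBase ξ true) E)
    (h1 : [proper true ξ I] ∈ D) (h2 : [proper true ξ J] ∈ E) : tensorD ξ D E = TD ξ I J D E := by
  unfold tensorD
  rw [if_neg (by rintro (h | h); exacts [hd_ne_dai h1 h, hd_ne_dai h2 h])]
  ext c
  constructor
  · rintro ⟨I', J', hI, hJ, t, ht, rfl⟩
    have e1 := hd_unique hD (first_mem hD hI) h1
    have e2 := hd_unique hE (first_mem hE hJ) h2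
    subst e1; subst e2
    exact ⟨t, rfl, ht⟩
  · rintro ⟨t, rfl, ht⟩
    exact ⟨I, J, ⟨_, h1, rfl⟩, ⟨_, h2, rfl⟩, t, ht, rfl⟩
theorem tensorD_comm : tensorD ξ D E = tensorD ξ E D := by
  have key : ∀ D E : DSet, tensorD ξ D E ⊆ tensorD ξ E D := by
    intro D E
    unfold tensorD
    by_cases h : D = DaiDesign ∨ E = DaiDesign
    · rw [if_pos h, if_pos h.symm]
    · rw [if_neg h, if_neg (fun h' => h h'.symm)]
      rintro c ⟨I, J, hI, hJ, t, ht, rfl⟩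
      exact ⟨J, I, hJ, hI, t, ht.symm, by rw [Finset.union_comm]⟩
  exact Set.Subset.antisymm (key _ _) (key _ _)
theorem tensor_comm (h : IsTensorOf C A B) : IsTensorOf C B A := by
  unfold IsTensorOf at *
  rw [h]
  congr 1
  ext G
  constructor
  · rintro ⟨D, hD, E, hE, rfl⟩; exact ⟨E, hE, D, hD, tensorD_comm⟩
  · rintro ⟨D, hD, E, hE, rfl⟩; exact ⟨E, hE, D, hD, tensorD_comm⟩
theorem alien_symm (h : Alien ξ A B) : Alien ξ B A := fun I hI J hJ => (h J hJ I hI).symm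
theorem hd_dir (hD : D ∈ A.designs) (h : [proper true ξ I] ∈ D) : I ∈ dir A :=
  ⟨D, hD, _, h, rfl⟩
theorem dir_hd (h : I ∈ dir A) : ∃ D ∈ A.designs, [proper true ξ I] ∈ D := by
  obtain ⟨D, hD, h⟩ := h
  exact ⟨D, hD, first_mem (A.isDesign D hD) h⟩
theorem tensorD_design (hal : Alien ξ A B) (hD : D ∈ A.designs) (hE : E ∈ B.designs) :
    IsDesign (simpleBase ξ true) (tensorD ξ D E) := by
  rcases des_cases (A.isDesign D hD) with h | ⟨I, hI⟩
  · unfold tensorD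
    rw [if_pos (Or.inl h), ← dai_eq (ξ := ξ)]; exact cd_design legal_nil
  rcases des_cases (B.isDesign E hE) with h | ⟨J, hJ⟩
  · unfold tensorD
    rw [if_pos (Or.inr h), ← dai_eq (ξ := ξ)]; exact cd_design legal_nil
  rw [tensorD_eq (A.isDesign D hD) (B.isDesign E hE) hI hJ]
  exact TD_design (A.isDesign D hD) (B.isDesign E hE) hI (hal I (hd_dir hD hI) J (hd_dir hE hJ))
theorem TD_mem (h : IsTensorOf C A B) (hal : Alien ξ A B) (hD : D ∈ A.designs) (hE : E ∈ B.designs)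
    (hI : [proper true ξ I] ∈ D) (hJ : [proper true ξ J] ∈ E) : TD ξ I J D E ∈ C.designs := by
  unfold IsTensorOf at h
  rw [h, mem_biorth, ← tensorD_eq (A.isDesign D hD) (B.isDesign E hE) hI hJ]
  refine ⟨tensorD_design hal hD hE, fun X hX => ?_⟩
  have := hX.2 _ ⟨D, hD, E, hE, rfl⟩
  rw [if_pos rfl] at this
  exact (conv_iff (tensorD_design hal hD hE) hX.1).mp this
theorem mem_perp_of (h : IsTensorOf C A B) (hal : Alien ξ A B) (hX : IsDesign (simpleBase ξ false) X)
    (ho : ∀ D ∈ A.designs, ∀ E ∈ B.designs, ∀ I J, [proper true ξ I] ∈ D → [proper true ξ J] ∈ E →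
      OrthP (TD ξ I J D E) X) : X ∈ perp C := by
  rw [mem_perp]
  refine ⟨hX, fun G hG => ?_⟩
  unfold IsTensorOf at h
  rw [h, mem_biorth] at hG
  apply hG.2
  refine ⟨hX, ?_⟩
  rintro G ⟨D, hD, E, hE, rfl⟩
  rw [if_pos rfl]
  refine (conv_iff (tensorD_design hal hD hE) hX).mpr ?_
  rcases des_cases (A.isDesign D hD) with h | ⟨I, hI⟩
  · unfold tensorD
    rw [if_pos (Or.inl h)]; exact dai_orth hX
  rcases des_cases (B.isDesign E hE) with h | ⟨J, hJ⟩
  · unfold tensorD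
    rw [if_pos (Or.inr h)]; exact dai_orth hX
  rw [tensorD_eq (A.isDesign D hD) (B.isDesign E hE) hI hJ]
  exact ho D hD E hE I J hI hJ
theorem pI_RF (h : ∀ a ∈ v, pI ξ I a = true) : RF ξ I v := by
  have := filter_rf (ξ := ξ) (I := I) (s := v)
  rwa [List.filter_eq_self.mpr h] at this
theorem Legal.all_pI (h : Legal ξ true v) (hi : proper true ξ I ∈ v) : ∀ a ∈ v, pI ξ I a = true := by
  induction v using List.reverseRecOn with
  | nil => simp
  | append_singleton w x ih =>
    intro a ha
    by_cases hne : w = []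
    · subst hne
      simp at hi ha; subst ha; subst hi
      simp [pI, isIn]
    have hiw : proper true ξ I ∈ w := by
      rcases List.mem_append.mp hi with h' | h'
      · exact h'
      · simp at h'; subst h'
        have := (h.isIn_nil (List.prefix_refl _)).mp (by simp [isIn])
        exact absurd this hne
    have ih := ih (h.pre (List.prefix_append _ _)) hiw
    rcases List.mem_append.mp ha with ha | ha
    · exact ih a ha
    simp at ha; subst ha
    obtain ⟨n, m, _, _, hm, hj, _⟩ := h.step (List.prefix_refl _) hne
    cases hmi : isIn ξ m with
    | false => rw [← h.pI_just' (by simp [hm]) hj hmi]; exact ih m hm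
    | true =>
      have := h.mem_unique (a := m) (a' := proper true ξ I) (by simp [hm]) (by simp [hiw])
        (by rw [isIn_iff.mp hmi]; rfl)
      subst this
      simp [pI, just_cls_init hj]
theorem Legal.view_head (h : Legal ξ true v) (hi : proper true ξ I ∈ v) :
    ∃ t, view v = proper true ξ I :: t := by
  have hne : v ≠ [] := by rintro rfl; simp at hi
  rcases chr_head ⟨view_ne_nil hne, legal_view_steps h⟩ with ⟨I', t, ht⟩ | ⟨h', _⟩
  · have := h.mem_unique (a := proper true ξ I') (view_subset (by rw [ht]; simp)) hi rfl
    simp at this; subst this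
    exact ⟨t, ht⟩
  · exact absurd (view_subset (by rw [h']; simp)) h.dai
theorem Legal.dview_head (h : Legal ξ true v) (hi : proper true ξ I ∈ v) :
    ∃ t, view (v.map Action.dual) = proper false ξ I :: t := by
  have hne : v ≠ [] := by rintro rfl; simp at hi
  have hd := h.dual
  rcases chr_head ⟨view_ne_nil (by simpa using hne), legal_view_steps hd⟩ with ⟨I', t, ht⟩ | ⟨h', h2⟩
  · have := hd.mem_unique (a := proper false ξ I') (view_subset (by rw [ht]; simp))
      (List.mem_map_of_mem (f := Action.dual) hi) rfl
    simp [Action.dual] at this; subst this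
    exact ⟨t, ht⟩
  · cases h2
theorem Legal.up (h : Legal ξ true v) (hi : proper true ξ I ∈ v) (hIK : I ⊆ K) :
    RF ξ K v := (pI_RF (h.all_pI hi)).mono hIK
theorem up_view (h : Legal ξ true v) (hi : proper true ξ I ∈ v) (hIK : I ⊆ K) :
    view (v.map (rl ξ K)) = (view v).map (rl ξ K) := view_rl (h.rel (h.up hi hIK))
theorem up_dview (h : Legal ξ true v) (hi : proper true ξ I ∈ v) (hIK : I ⊆ K) :
    view ((v.map (rl ξ K)).map dual) = (view (v.map dual)).map (rl ξ K) := by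
  rw [← rl_map_dual, view_rl (h.rel (h.up hi hIK)).dual]
theorem up_chr_iff (hX : IsDesign (simpleBase ξ false) E) (hal : AlienS SA SB) (hI : I ∈ SA) (hJ : J ∈ SB) :
    (proper false ξ (I ∪ J) :: t ∈ lift ξ SA SB E) ↔ proper false ξ I :: t ∈ E := by
  constructor
  · rintro ⟨I', hI', J', hJ', t', he, h⟩
    simp only [List.cons.injEq, proper.injEq, true_and] at he
    obtain ⟨he, rfl⟩ := he
    have := (hal.inj hI hI' hJ hJ' he).1
    rw [this]; exact h
  · intro h; exact ⟨I, hI, J, hJ, t, rfl, h⟩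
theorem up_E (hE : IsDesign (simpleBase ξ false) E) (hal : AlienS SA SB) (hI : I ∈ SA) (hJ : J ∈ SB)
    (h : Legal ξ true v) (hi : proper true ξ I ∈ v) :
    view ((v.map (rl ξ (I ∪ J))).map dual) ∈ lift ξ SA SB E ↔ view (v.map dual) ∈ E := by
  rw [up_dview h hi Finset.subset_union_left]
  have hc : Chr ξ false (view (v.map dual)) :=
    ⟨view_ne_nil (by rintro he; simp at he; subst he; simp at hi), legal_view_steps h.dual⟩
  obtain ⟨t, ht⟩ := h.dview_head hi
  rw [ht] at hc ⊢
  rw [chr_map_rl hc, up_chr_iff hE hal hI hJ]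
theorem up_D (hD : IsDesign (simpleBase ξ true) D) (hI : [proper true ξ I] ∈ D) (hc : c ∈ D) :
    c.map (rl ξ (I ∪ J)) ∈ TD ξ I J D F := by
  obtain ⟨t, rfl⟩ := hd_form hD hI hc
  rw [chr_map_rl (des_chr hD hc)]
  exact ⟨t, rfl, Or.inl hc⟩
theorem down_D (hD : IsDesign (simpleBase ξ true) D) (hF : IsDesign (simpleBase ξ true) F)
    (hdis : Disjoint I J) (hc : c ∈ TD ξ I J D F) (ha : a ∈ c) (hcl : cls ξ I a = true) :
    ∃ t, c = proper true ξ (I ∪ J) :: t ∧ proper true ξ I :: t ∈ D ∧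
      ∀ x ∈ t, x ≠ daimon → cls ξ I x = true := by
  obtain ⟨t, rfl, h | h⟩ := hc
  · exact ⟨t, rfl, h, chr_cls (des_chr hD h)⟩
  · exfalso
    have hai := cls_isIn hcl
    have had : a ≠ daimon := by rintro rfl; simp [cls] at hcl
    rcases List.mem_cons.mp ha with rfl | ha
    · simp [isIn] at hai
    · have := chr_cls (des_chr hF h) a ha had
      rw [cls_disj hdis hcl] at this; cases this
theorem of_lift (hE : IsDesign (simpleBase ξ false) E) (hal : AlienS SA SB) (hI : I ∈ SA) (hJ : J ∈ SB)
    (hc : c ∈ lift ξ SA SB E) (hi : c.head? = some (proper false ξ (I ∪ J))) :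
    ∃ t, c = proper false ξ (I ∪ J) :: t ∧ proper false ξ I :: t ∈ E ∧
      ∀ x ∈ t, x ≠ daimon → cls ξ I x = true := by
  obtain ⟨I', hI', J', hJ', t, rfl, h⟩ := hc
  simp at hi
  have := (hal.inj hI' hI hJ' hJ hi).1
  subst this
  exact ⟨t, by rw [hi], h, chr_cls (des_chr hE h)⟩
theorem cls_dual : cls ξ I a.dual = cls ξ I a := by cases a <;> rfl
theorem isIn_dual : isIn ξ a.dual = isIn ξ a := by cases a <;> rfl
theorem pI_dual : pI ξ I a.dual = pI ξ I a := by simp [pI, cls_dual, isIn_dual]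
theorem lift_all (hE : IsDesign (simpleBase ξ false) E) (hal : AlienS SA SB) (hI : I ∈ SA) (hJ : J ∈ SB)
    (h : Legal ξ true x) (hx : ∀ w, w <+: x → w ≠ [] → view (w.map dual) ∈ lift ξ SA SB E)
    (hi : proper true ξ (I ∪ J) ∈ x) : ∀ a ∈ x, pI ξ I a = true := by
  intro a ha
  obtain ⟨w, hw⟩ := mem_split_prefix ha
  by_cases hne : w = []
  · have := (h.isIn_nil hw).mpr hne
    simp [pI, this]
  have hl := h.pre hw
  have hiw : proper true ξ (I ∪ J) ∈ w ++ [a] := by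
    obtain ⟨r, hr⟩ := hw
    cases w with
    | nil => exact absurd rfl hne
    | cons y w =>
      obtain ⟨M, rfl⟩ := Legal.head (s := w ++ [a]) hl
      have := h.mem_unique (a := proper true ξ M) (by rw [← hr]; simp) hi rfl
      rw [this]; simp
  obtain ⟨t, ht⟩ := hl.dview_head hiw
  obtain ⟨t', ht', _, hcl⟩ := of_lift hE hal hI hJ (hx _ hw (by simp)) (by rw [ht]; rfl)
  obtain ⟨c0, hc0⟩ := view_snoc (w.map dual) a.dual
  have had : a ≠ daimon := fun hd => h.dai (hd ▸ ha)
  have : a.dual ∈ proper false ξ (I ∪ J) :: t' := by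
    rw [← ht', List.map_append, List.map_singleton, hc0]; simp
  rcases List.mem_cons.mp this with h1 | h1
  · rw [← pI_dual, h1]; simp [pI, isIn]
  · rw [← pI_dual, pI, hcl _ h1 (by rwa [Ne, dual_eq_dai])]; simp
end P13
end Part13
section Part14
open Action
section P14
variable {ξ : Address} {pos : Bool} {q s u v w c d t t1 t2 tl x : List Action} {a b m n κ k : Action}
  {X Y D E F : DSet} {I J K L I' J' K' : Finset ℕ} {A B C : Behaviour ξ true} {SA SB : Set (Finset ℕ)}
theorem snoc_map (hk : isIn ξ k = false) : (v ++ [k]).map (rl ξ L) = v.map (rl ξ L) ++ [k] := by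
  rw [List.map_append, List.map_singleton, rl_not_in hk]
theorem lift_step (hD : IsDesign (simpleBase ξ true) D) (hF : IsDesign (simpleBase ξ true) F)
    (hE : IsDesign (simpleBase ξ false) E) (hal : AlienS SA SB) (hI : I ∈ SA) (hJ : J ∈ SB)
    (hID : [proper true ξ I] ∈ D) (ho : OrthP D E) (hv : Play D E v) (hi : proper true ξ I ∈ v)
    (hkd : k ≠ daimon)
    (hk : (k.isPositive = true ∧ view (v.map (rl ξ (I ∪ J)) ++ [k]) ∈ TD ξ I J D F) ∨
      (k.isPositive = false ∧ view ((v.map (rl ξ (I ∪ J)) ++ [k]).map dual) ∈ lift ξ SA SB E)) :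
    isIn ξ k = false ∧ Play D E (v ++ [k]) := by
  have hl := play_legal hD hE hv
  have hsub : I ⊆ I ∪ J := Finset.subset_union_left
  have hne : v ≠ [] := by rintro rfl; simp at hi
  rcases hk with ⟨hp, hk⟩ | ⟨hp, hk⟩
  · obtain ⟨t0, ht0⟩ := hl.view_head hi
    have hc : Chr ξ true (view v) := ⟨view_ne_nil hne, legal_view_steps hl⟩
    have htd := TD_design (E := F) hD hF hID (hal I hI J hJ)
    rw [view_pos _ hp, up_view hl hi hsub] at hk
    obtain ⟨b, hb, hbd, hbp⟩ : ∃ b, ((view v).map (rl ξ (I ∪ J))).getLast? = some b ∧ b ≠ daimon ∧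
        k.isPositive = !b.isPositive := by
      rcases des_turn htd hk with ⟨h, _⟩ | h
      · rw [ht0] at h; simp at h
      · exact h
    obtain ⟨w, n, rfl⟩ := (List.eq_nil_or_concat' v).resolve_left hne
    rw [List.getLast?_map, view_getLast?] at hb
    simp at hb
    subst hb
    rw [rl_isPositive, hp] at hbp
    have hnp : n.isPositive = false := by simpa using hbp
    have hni := hl.neg_isIn (a := n) (by simp) hnp
    have hnc : cls ξ I n = true := by
      have := hl.all_pI hi n (by simp)
      simpa [pI, hni] using this
    obtain ⟨t, ht, htD, hcl⟩ := down_D (a := n) hD hF (hal I hI J hJ) hk (by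
      obtain ⟨c0, hc0⟩ := view_snoc w n
      rw [hc0]; simp [rl_not_in hni]) hnc
    rw [ht0] at hc
    rw [ht0, chr_map_rl hc] at ht
    simp only [List.cons_append, List.cons.injEq, true_and] at ht
    subst ht
    have hkD : view (w ++ [n] ++ [k]) ∈ D := by
      rw [view_pos _ hp, ht0]; exact htD
    refine ⟨cls_isIn (hcl k (by simp) hkd), play_snoc.mpr ⟨hv, hkd, hkD, ?_⟩⟩
    exact ho.2.1 _ _ hv hkd hp hkD
  · obtain ⟨t0, ht0⟩ := hl.dview_head hi
    have hc : Chr ξ false (view (v.map dual)) := ⟨view_ne_nil (by simpa using hne), legal_view_steps hl.dual⟩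
    have hp' : k.dual.isPositive = true := by rw [pol_dual hkd, hp]; rfl
    rw [List.map_append, List.map_singleton, view_pos _ hp', up_dview hl hi hsub] at hk
    rw [ht0] at hc
    rw [ht0, chr_map_rl hc] at hk
    obtain ⟨t, ht, htE, hcl⟩ := of_lift hE hal hI hJ hk (by simp)
    simp only [List.cons_append, List.cons.injEq, true_and] at ht
    subst ht
    have hkE : view ((v ++ [k]).map dual) ∈ E := by
      rw [List.map_append, List.map_singleton, view_pos _ hp', ht0]; exact htE
    refine ⟨?_, play_snoc.mpr ⟨hv, hkd, ?_, hkE⟩⟩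
    · rw [← isIn_dual]; exact cls_isIn (hcl k.dual (by simp) (by rwa [Ne, dual_eq_dai]))
    · exact ho.2.2 _ _ hv hp hkE
theorem head_mem_prefix (h : Legal ξ true s) (hi : proper true ξ I ∈ s) (hw : w <+: s) (hne : w ≠ []) :
    proper true ξ I ∈ w := by
  cases w with
  | nil => exact absurd rfl hne
  | cons y w =>
    obtain ⟨M, rfl⟩ := Legal.head (s := w) (h.pre hw)
    have := h.mem_unique (a := proper true ξ M) (hw.subset (by simp)) hi rfl
    rw [this]; simp
theorem lift_up (hE : IsDesign (simpleBase ξ false) E) (hal : AlienS SA SB) (hI : I ∈ SA) (hJ : J ∈ SB)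
    (hl : Legal ξ true v) (hi : proper true ξ I ∈ v)
    (hX : ∀ w, w <+: v → w ≠ [] → view (w.map (rl ξ (I ∪ J))) ∈ X)
    (hv : ∀ w, w <+: v → w ≠ [] → view (w.map dual) ∈ E) :
    Play X (lift ξ SA SB E) (v.map (rl ξ (I ∪ J))) := by
  refine ⟨?_, ?_⟩
  · intro hd
    obtain ⟨y, hy, he⟩ := List.mem_map.mp hd
    exact hl.dai (rl_ne_dai.mp he ▸ hy)
  · intro w hw hne
    obtain ⟨w, hw', rfl⟩ := List.prefix_map_iff.mp hw
    have hne' : w ≠ [] := by rintro rfl; simp at hne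
    exact ⟨hX w hw' hne', (up_E hE hal hI hJ (hl.pre hw') (head_mem_prefix hl hi hw' hne')).mpr (hv w hw' hne')⟩
theorem lift_up_TD (hD : IsDesign (simpleBase ξ true) D)
    (hE : IsDesign (simpleBase ξ false) E) (hal : AlienS SA SB) (hI : I ∈ SA) (hJ : J ∈ SB)
    (hID : [proper true ξ I] ∈ D) (hv : Play D E v) (hi : proper true ξ I ∈ v) :
    Play (TD ξ I J D F) (lift ξ SA SB E) (v.map (rl ξ (I ∪ J))) := by
  have hl := play_legal hD hE hv
  refine lift_up hE hal hI hJ hl hi (fun w hw hne => ?_) (fun w hw hne => (hv.2 w hw hne).2)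
  rw [up_view (hl.pre hw) (head_mem_prefix hl hi hw hne) Finset.subset_union_left]
  exact up_D hD hID (hv.2 w hw hne).1
theorem TD_single (h : [k] ∈ TD ξ I J D F) : k = proper true ξ (I ∪ J) := by
  obtain ⟨t, ht, _⟩ := h
  simp at ht; exact ht.1
theorem lift_sim (hD : IsDesign (simpleBase ξ true) D) (hF : IsDesign (simpleBase ξ true) F)
    (hE : IsDesign (simpleBase ξ false) E) (hal : AlienS SA SB) (hI : I ∈ SA) (hJ : J ∈ SB)
    (hID : [proper true ξ I] ∈ D) (ho : OrthP D E) :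
    ∀ x, Play (TD ξ I J D F) (lift ξ SA SB E) x →
      x = [] ∨ ∃ v, Play D E v ∧ proper true ξ I ∈ v ∧ x = v.map (rl ξ (I ∪ J)) := by
  intro x
  induction x using List.reverseRecOn with
  | nil => exact fun _ => Or.inl rfl
  | append_singleton w k ih =>
    intro hx
    right
    obtain ⟨hw, hkd, h1, h2⟩ := play_snoc.mp hx
    rcases ih hw with rfl | ⟨v, hv, hi, rfl⟩
    · simp only [List.nil_append, view_single] at h1
      have := TD_single h1
      subst this
      refine ⟨[proper true ξ I], ?_, by simp, by simp [rl]⟩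
      have h3 : view ([] ++ [proper true ξ I]) ∈ D := by simpa [view_single] using hID
      exact play_snoc (s := []).mpr ⟨play_nil _ _, by simp, h3, ho.2.1 [] _ (play_nil _ _) (by simp) rfl h3⟩
    · obtain ⟨hki, hp⟩ := lift_step hD hF hE hal hI hJ hID ho hv hi hkd (by
        cases hkp : k.isPositive with
        | true => exact Or.inl ⟨rfl, h1⟩
        | false => exact Or.inr ⟨rfl, h2⟩)
      exact ⟨v ++ [k], hp, by simp [hi], by rw [snoc_map hki]⟩
theorem lift_orth (hD : IsDesign (simpleBase ξ true) D) (hF : IsDesign (simpleBase ξ true) F)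
    (hE : IsDesign (simpleBase ξ false) E) (hal : AlienS SA SB) (hI : I ∈ SA) (hJ : J ∈ SB)
    (hID : [proper true ξ I] ∈ D) (ho : OrthP D E) :
    OrthP (TD ξ I J D F) (lift ξ SA SB E) := by
  have sim := lift_sim (F := F) hD hF hE hal hI hJ hID ho
  refine ⟨?_, ?_, ?_⟩
  · obtain ⟨N, hN⟩ := ho.1
    refine ⟨N, fun s hs => ?_⟩
    rcases sim s hs with rfl | ⟨v, hv, _, rfl⟩
    · simp
    · simpa using hN v hv
  · intro s k hs hkd hkp hk
    rcases sim s hs with rfl | ⟨v, hv, hi, rfl⟩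
    · simp only [List.nil_append, view_single] at hk
      have := TD_single hk
      subst this
      have h3 : view ([] ++ [proper true ξ I]) ∈ D := by simpa [view_single] using hID
      have := ho.2.1 [] _ (play_nil _ _) (by simp) rfl h3
      simp [view_single, dual] at this ⊢
      exact ⟨I, hI, J, hJ, [], rfl, this⟩
    · obtain ⟨hki, hp⟩ := lift_step hD hF hE hal hI hJ hID ho hv hi hkd (Or.inl ⟨hkp, hk⟩)
      have := lift_up_TD (F := F) hD hE hal hI hJ hID hp (by simp [hi])
      rw [snoc_map hki] at this
      exact (play_snoc.mp this).2.2.2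
  · intro s k hs hkn hk
    rcases sim s hs with rfl | ⟨v, hv, hi, rfl⟩
    · exfalso
      simp [view_single] at hk
      obtain ⟨I', hI', J', hJ', t, he, h⟩ := hk
      simp at he
      have : k = proper true ξ (I' ∪ J') := by rw [← dual_dual k, he.1]; rfl
      subst this; cases hkn
    · obtain ⟨hki, hp⟩ := lift_step (F := F) hD hF hE hal hI hJ hID ho hv hi (neg_ne_dai hkn) (Or.inr ⟨hkn, hk⟩)
      have := lift_up_TD (F := F) hD hE hal hI hJ hID hp (by simp [hi])
      rw [snoc_map hki] at this
      exact (play_snoc.mp this).2.2.1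
theorem lift_perp (h : IsTensorOf C A B) (hal : Alien ξ A B) (hE : E ∈ perp A) :
    lift ξ (dir A) (dir B) E ∈ perp C := by
  have hE' := mem_perp.mp hE
  refine mem_perp_of h hal (lift_design hal hE'.1) ?_
  intro D hD F hF I J hI hJ
  exact lift_orth (A.isDesign D hD) (B.isDesign F hF) hE'.1 hal (hd_dir hD hI) (hd_dir hF hJ) hI
    (hE'.2 D hD)
theorem dir_tensor (h : IsTensorOf C A B) (hal : Alien ξ A B) (hK : K ∈ dir C) :
    ∃ I ∈ dir A, ∃ J ∈ dir B, K = I ∪ J := by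
  obtain ⟨D, hD, hK⟩ := dir_hd hK
  have h1 := (mem_perp.mp (lift_perp h hal (perp_nil A))).2 D hD
  have h2 := h1.2.1 [] (proper true ξ K) (play_nil _ _) (by simp) rfl (by simpa [view_single] using hK)
  simp [view_single, dual] at h2
  obtain ⟨I, hI, J, hJ, t, he, _⟩ := h2
  simp at he
  exact ⟨I, hI, J, hJ, he.1⟩
theorem visS_dir (h : VisS A s) (hi : proper true ξ I ∈ s) : I ∈ dir A := by
  have hl := h.legal
  obtain ⟨w, hw⟩ := mem_split_prefix hi
  have := (hl.isIn_nil hw).mp (by simp [isIn])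
  subst this
  obtain ⟨D, hD, E, hE, hp⟩ := h
  have := (hp.2 _ hw (by simp)).1
  simp [view_single] at this
  exact hd_dir hD this
theorem T3 (h : IsTensorOf C A B) (hal : Alien ξ A B) (hs : VisS A s) (hi : proper true ξ I ∈ s)
    (hJ : J ∈ dir B) : VisS C (s.map (rl ξ (I ∪ J))) := by
  have hI := visS_dir hs hi
  obtain ⟨F, hF, hJF⟩ := dir_hd hJ
  have hl := hs.legal
  obtain ⟨w, hw⟩ := mem_split_prefix hi
  have := (hl.isIn_nil hw).mp (by simp [isIn])
  subst this
  obtain ⟨D, hD, E, hE, hp⟩ := hs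
  have hID := (hp.2 _ hw (by simp)).1
  simp [view_single] at hID
  exact ⟨_, TD_mem h hal hD hF hID hJF, _, lift_perp h hal hE,
    lift_up_TD (A.isDesign D hD) (mem_perp.mp hE).1 hal hI hJ hID hp hi⟩
end P14
end Part14
section Part15
open Action
section P15
variable {ξ : Address} {pos : Bool} {q s u v w c d t t1 t2 tl x y p : List Action} {a b m n κ k : Action}
  {X Y D E F G : DSet} {I J K L I' J' K' : Finset ℕ} {A B C : Behaviour ξ true} {SA SB : Set (Finset ℕ)}
theorem Legal.rl_self (h : Legal ξ true s) (hi : proper true ξ K ∈ s) (hsub : ∀ a ∈ t, a ∈ s) :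
    t.map (Ludics.rl ξ K) = t := by
  conv_rhs => rw [← List.map_id t]
  apply List.map_congr_left
  intro a ha
  cases hai : isIn ξ a with
  | false => exact rl_not_in hai
  | true =>
    have := h.mem_unique (hsub a ha) hi (by rw [isIn_iff.mp hai]; rfl)
    subst this
    exact rl_init _
theorem ve_proj (hs : Legal ξ true s) (hw : y ≠ []) (h : VE ((proj ξ I s).map dual) (y.map dual)) :
    ∃ p, p <+: s ∧ p ≠ [] ∧ view y = (view p).map (rl ξ I) := by
  have h1 := ve_vv h (by simpa using hw)
  rw [map_dual_dual, map_dual_dual] at h1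
  obtain ⟨q, hq, hne, he⟩ := h1
  obtain rfl | ⟨q, κ, rfl⟩ := List.eq_nil_or_concat' q
  · exact absurd rfl hne
  obtain ⟨w, a, hwa, ha, rfl, rfl⟩ := prefix_proj hq
  refine ⟨_, hwa, by simp, ?_⟩
  rw [he, ← view_proj (hs.pre hwa) ha, proj_true ha]
def Comp (ξ : Address) (I : Finset ℕ) (s y : List Action) : Prop :=
  ∀ w, w <+: y → w ≠ [] → ∃ p, p <+: s ∧ p ≠ [] ∧ view w = (view p).map (rl ξ I)
theorem Comp.fix (h : Comp ξ I s y) : y.map (rl ξ I) = y := by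
  conv_rhs => rw [← List.map_id y]
  apply List.map_congr_left
  intro a ha
  obtain ⟨u, hu⟩ := mem_split_prefix ha
  obtain ⟨p, _, _, hv⟩ := h _ hu (by simp)
  have h1 := view_getLast? (u ++ [a])
  rw [hv, List.getLast?_map] at h1
  simp at h1
  obtain ⟨b, _, hb⟩ := h1
  rw [← hb, rl_rl]; rfl
theorem fix_head (hl : Legal ξ true y) (hne : y ≠ []) (hf : y.map (rl ξ I) = y) : proper true ξ I ∈ y := by
  cases y with
  | nil => exact absurd rfl hne
  | cons b y =>
    obtain ⟨L, rfl⟩ := hl.head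
    rw [List.map_cons, rl_init] at hf
    rw [← hf]; simp
theorem Comp.view_mem (h : Comp ξ I s y) (hs : Legal ξ true s) (hi : proper true ξ K ∈ s) (hIK : I ⊆ K)
    (hl : Legal ξ true y) (hw : w <+: y) (hne : w ≠ []) : view (w.map (rl ξ K)) ∈ CD ξ true s := by
  have hy : y ≠ [] := by rintro rfl; exact hne (List.prefix_nil.mp hw)
  have h1 := head_mem_prefix hl (fix_head hl hy h.fix) hw hne
  rw [up_view (hl.pre hw) h1 hIK]
  obtain ⟨p, hp, hpn, he⟩ := h w hw hne
  rw [he, rl_map_rl, hs.rl_self hi (fun a ha => hp.subset (view_subset ha))]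
  exact Or.inl ⟨p, hp, hpn, rfl⟩
theorem t2_legal (hE : IsDesign (simpleBase ξ false) E) (hal : AlienS SA SB) (hI : I ∈ SA) (hJ : J ∈ SB)
    (hX : IsDesign (simpleBase ξ true) X)
    (hp : Play X (lift ξ SA SB E) (y.map (rl ξ (I ∪ J)))) (hf : y.map (rl ξ I) = y) : Legal ξ true y := by
  have hl := play_legal hX (lift_design hal hE) hp
  by_cases hy : y = []
  · subst hy; exact hl
  have h1 := fix_head (I := I ∪ J) hl (by simpa using hy) (rl_map_rl y)
  have h2 := hl.rl (pI_RF (lift_all hE hal hI hJ hl (fun w hw hne => (hp.2 w hw hne).2) h1))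
  rwa [rl_map_rl, hf] at h2
theorem t2_mem (h : IsTensorOf C A B) (hal : Alien ξ A B) (hs : VisS C s) (hi : proper true ξ (I ∪ J) ∈ s)
    (hI : I ∈ dir A) (hJ : J ∈ dir B) : CD ξ true (proj ξ I s) ∈ A.designs := by
  have hl := hs.legal
  have hsub : I ⊆ I ∪ J := Finset.subset_union_left
  rw [mem_beh]
  refine ⟨cd_design (hl.proj I), fun E hE => ?_⟩
  have hEd := (mem_perp.mp hE).1
  have hCd := C.isDesign _ hs.cd_mem
  have ho : OrthP (CD ξ true s) (lift ξ (dir A) (dir B) E) :=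
    (mem_perp.mp (lift_perp h hal hE)).2 _ hs.cd_mem
  have hal' : AlienS (dir A) (dir B) := hal
  have key : OrthP E (CD ξ (!false) (((proj ξ I s).map dual).map dual)) := by
    have pre : ∀ v, Play E (CD ξ (!false) (((proj ξ I s).map dual).map dual)) v → Legal ξ false v →
        (∀ u, u <+: v → VE ((proj ξ I s).map dual) u) →
        Comp ξ I s (v.map dual) ∧ Legal ξ true (v.map dual) ∧
        Play (CD ξ true s) (lift ξ (dir A) (dir B) E) ((v.map dual).map (rl ξ (I ∪ J))) := by
      intro v hp hlv hve
      have hc : Comp ξ I s (v.map dual) := by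
        intro w hw hne
        refine ve_proj hl hne (hve _ (prefix_map_dual hw))
      have hly : Legal ξ true (v.map dual) := hlv.dual
      refine ⟨hc, hly, ?_⟩
      by_cases hv : v = []
      · subst hv; exact play_nil _ _
      refine lift_up hEd hal' hI hJ hly (fix_head hly (by simpa using hv) hc.fix)
        (fun w hw hne => hc.view_mem hl hi hsub hly hw hne) (fun w hw hne => ?_)
      exact (hp.2 _ (prefix_map_dual hw) (by simpa using hne)).1
    refine cd_orth (pos := false) (hl.proj I).dual hEd ?_ ?_
    · intro v κ hp hlv hve hκ hvk
      obtain ⟨hc, hly, hP⟩ := pre v hp hlv hve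
      have hkd : κ.dual ≠ daimon := dual_ne_dai (neg_ne_dai hκ)
      have hkp : κ.dual.isPositive = true := by rw [pol_dual (neg_ne_dai hκ), hκ]; rfl
      have hc' : Comp ξ I s (v.map dual ++ [κ.dual]) := by
        intro w hw hne
        rcases prefix_snoc hw with hw | rfl
        · exact hc w hw hne
        · refine ve_proj hl hne ?_
          rw [List.map_append, map_dual_dual]; simpa [dual_dual] using hvk
      obtain ⟨p, hp', hpn, he⟩ := hc' _ List.prefix_rfl (by simp)
      have hvm : view ((v.map dual).map (rl ξ (I ∪ J)) ++ [rl ξ (I ∪ J) κ.dual]) = view p := by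
        rw [view_pos _ (by rw [rl_isPositive]; exact hkp)]
        have : view ((v.map dual).map (rl ξ (I ∪ J))) = (view (v.map dual)).map (rl ξ (I ∪ J)) := by
          by_cases hv : v = []
          · subst hv; rfl
          · exact up_view hly (fix_head hly (by simpa using hv) hc.fix) hsub
        rw [this]
        have h2 : (view (v.map dual ++ [κ.dual])).map (rl ξ (I ∪ J)) = view p := by
          rw [he, rl_map_rl, hl.rl_self hi (fun a ha => hp'.subset (view_subset ha))]
        rw [← h2, view_pos _ hkp]; simp
      have hvm' : view ((v.map dual).map (rl ξ (I ∪ J)) ++ [rl ξ (I ∪ J) κ.dual]) ∈ CD ξ true s := by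
        rw [hvm]; exact Or.inl ⟨p, hp', hpn, rfl⟩
      have hrd : rl ξ (I ∪ J) κ.dual ≠ daimon := fun h => hkd (rl_ne_dai.mp h)
      have h3 := ho.2.1 _ _ hP hrd (by rw [rl_isPositive]; exact hkp) hvm'
      have hP' := play_snoc.mpr ⟨hP, hrd, hvm', h3⟩
      have hz : (v.map dual).map (rl ξ (I ∪ J)) ++ [rl ξ (I ∪ J) κ.dual] =
        (v.map dual ++ [κ.dual]).map (rl ξ (I ∪ J)) := by simp
      rw [hz] at hP' h3
      have hlz := t2_legal hEd hal' hI hJ hCd hP' hc'.fix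
      have := (up_E hEd hal' hI hJ hlz (fix_head hlz (by simp) hc'.fix)).mp h3
      rw [List.map_append, map_dual_dual] at this; simpa [dual_dual] using this
    · intro v κ hp hlv hve hv hκd hκ hvk
      obtain ⟨hc, hly, hP⟩ := pre v hp hlv hve
      have hin := fix_head hly (by simpa using hv) hc.fix
      have hkd : κ.dual ≠ daimon := dual_ne_dai hκd
      have hkp : κ.dual.isPositive = false := by rw [pol_dual hκd, hκ]; rfl
      obtain ⟨t, ht⟩ := hly.dview_head hin
      rw [map_dual_dual] at ht
      rw [view_pos _ hκ, ht] at hvk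
      have hch := des_chr hEd hvk
      have hki : isIn ξ κ = false := chr_not_in hch κ (by simp)
      have hvm : view (((v.map dual).map (rl ξ (I ∪ J)) ++ [κ.dual]).map dual) ∈ lift ξ (dir A) (dir B) E := by
        have : ((v.map dual).map (rl ξ (I ∪ J)) ++ [κ.dual]).map dual =
            ((v.map dual).map (rl ξ (I ∪ J))).map dual ++ [κ] := by simp [dual_dual]
        rw [this, view_pos _ hκ, up_dview hly hin hsub, map_dual_dual, ht]
        have h5 := (up_chr_iff hEd hal' hI hJ (t := t ++ [κ])).mpr hvk
        have h6 := chr_map_rl (K := I ∪ J) (t := t ++ [κ]) hch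
        rw [← h6] at h5
        simpa [rl_not_in hki] using h5
      have h3 := ho.2.2 _ _ hP hkp hvm
      have hP' := play_snoc.mpr ⟨hP, hkd, h3, hvm⟩
      have hkI : isIn ξ κ.dual = false := by rw [isIn_dual]; exact hki
      rw [← snoc_map hkI] at hP'
      have hlz := t2_legal hEd hal' hI hJ hCd hP' (by rw [snoc_map hkI, hc.fix])
      obtain ⟨_, m, _, _, hm, hj, hmp, _⟩ := hlz.step List.prefix_rfl (by simpa using hv)
      obtain ⟨m, hm', rfl⟩ := List.mem_map.mp hm
      refine ⟨m, hm', justifies_dual.mp hj, ?_⟩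
      have hmd : m ≠ daimon := fun h => hlv.dai (h ▸ hm')
      rw [pol_dual hmd, hkp] at hmp
      simpa using hmp
  rw [map_dual_dual] at key
  exact key.symm
end P15
end Part15
section Part16
open Action
section P16
variable {ξ : Address} {pos : Bool} {q s u v w c d t t1 t2 tl x y p : List Action} {a b m n κ k : Action}
  {X Y D E F G : DSet} {I J K L I' J' K' : Finset ℕ} {A B C : Behaviour ξ true} {SA SB : Set (Finset ℕ)}
theorem cls_union (h : cls ξ (I ∪ J) a = true) : cls ξ I a = true ∨ cls ξ J a = true := by
  cases a with
  | daimon => simp [cls] at h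
  | proper p f L =>
    simp only [cls, decide_eq_true_eq, Finset.mem_union] at h ⊢
    obtain ⟨i, hi | hi, h⟩ := h
    · exact Or.inl ⟨i, hi, h⟩
    · exact Or.inr ⟨i, hi, h⟩
theorem pI_other (hs : Legal ξ true s) (hi : proper true ξ (I ∪ J) ∈ s) (ha : a ∈ s)
    (h : pI ξ I a = false) : pI ξ J a = true := by
  have h1 := hs.all_pI hi a ha
  simp only [pI, Bool.or_eq_false_iff, Bool.or_eq_true] at *
  rcases h1 with h1 | h1
  · exact Or.inl h1
  · rcases cls_union h1 with h2 | h2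
    · rw [h.2] at h2; cases h2
    · exact Or.inr h2
def INV (ξ : Address) (I : Finset ℕ) (s x : List Action) : Prop :=
  ∀ w m, w ++ [m] <+: x → ∃ w', w' ++ [m] <+: s ∧ cov (w ++ [m]) = cov (w' ++ [m]) ∧
    (pI ξ I m = false → view (w ++ [m]) = view (w' ++ [m]))
theorem INV.mem (h : INV ξ I s x) (ha : a ∈ x) : a ∈ s := by
  obtain ⟨u, hu⟩ := mem_split_prefix ha
  obtain ⟨w', hw, _⟩ := h _ _ hu
  exact hw.subset (by simp)
theorem INV.last (hs : Legal ξ true s) (h : INV ξ I s (x ++ [n])) (hp : p ++ [n] <+: s) :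
    cov (x ++ [n]) = cov (p ++ [n]) ∧ (pI ξ I n = false → view (x ++ [n]) = view (p ++ [n])) := by
  obtain ⟨w', hw, h1, h2⟩ := h _ _ List.prefix_rfl
  obtain ⟨rfl, _⟩ := hs.at_unique hw hp rfl
  exact ⟨h1, h2⟩
theorem INV.snoc (h : INV ξ I s x) (hp : p ++ [b] <+: s) (h1 : cov (x ++ [b]) = cov (p ++ [b]))
    (h2 : pI ξ I b = false → view (x ++ [b]) = view (p ++ [b])) : INV ξ I s (x ++ [b]) := by
  intro w m hw
  rcases prefix_snoc hw with hw | he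
  · exact h w m hw
  · have he' := List.append_inj' he rfl
    simp at he'
    obtain ⟨rfl, rfl⟩ := he'
    exact ⟨p, hp, h1, h2⟩
theorem neg_step (hs : Legal ξ true s) (hG : IsDesign (simpleBase ξ true) G)
    (ho : OrthP G (CD ξ false (s.map dual))) (hx : Play G (CD ξ false (s.map dual)) x)
    (hinv : INV ξ I s x) (hne : x ≠ []) (hc : cov x = cov p) (hp : p ++ [b] <+: s)
    (hb : b.isPositive = false) :
    Play G (CD ξ false (s.map dual)) (x ++ [b]) ∧ INV ξ I s (x ++ [b]) := by
  have hcb : cov (x ++ [b]) = cov (p ++ [b]) := by rw [cov_neg _ hb, cov_neg _ hb, hc]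
  have h1 : view ((x ++ [b]).map dual) ∈ CD ξ false (s.map dual) := by
    rw [view_dual, hcb, ← view_dual]
    exact Or.inl ⟨_, prefix_dual.mpr hp, by simp, rfl⟩
  have h2 := ho.2.2 _ _ hx hb h1
  have hP := play_snoc.mpr ⟨hx, neg_ne_dai hb, h2, h1⟩
  refine ⟨hP, hinv.snoc hp hcb fun hpb => ?_⟩
  have hl : Legal ξ true (x ++ [b]) := play_legal hG (cd_design hs.dual) hP
  obtain ⟨_, m, _, _, hm, hj, _, _⟩ := hl.step List.prefix_rfl hne
  obtain ⟨u, hu⟩ := mem_split_prefix hm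
  obtain ⟨w', hw', hc', hv'⟩ := hinv _ _ hu
  have hu' : u ++ [m] <+: x ++ [b] := hu.trans (List.prefix_append _ _)
  rw [hl.view_neg List.prefix_rfl hb hu' hj, hs.view_neg hp hb hw' hj]
  cases hmi : isIn ξ m with
  | true =>
    rw [(hl.isIn_nil hu').mp hmi, (hs.isIn_nil hw').mp hmi]
  | false =>
    rw [hv' ((hl.pI_just' (List.mem_append_left _ hm) hj hmi).trans hpb)]
theorem pos_step (hs : Legal ξ true s) (hG : IsDesign (simpleBase ξ true) G)
    (ho : OrthP G (CD ξ false (s.map dual))) (hx : Play G (CD ξ false (s.map dual)) x)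
    (hinv : INV ξ I s x) (hne : x ≠ []) (hp : p ++ [b] <+: s)
    (hb : b.isPositive = true) (hbG : view (x ++ [b]) ∈ G)
    (hv : pI ξ I b = false → view (x ++ [b]) = view (p ++ [b])) :
    Play G (CD ξ false (s.map dual)) (x ++ [b]) ∧ INV ξ I s (x ++ [b]) := by
  have hbd : b ≠ daimon := fun h => hs.dai (h ▸ hp.subset (by simp))
  have h1 := ho.2.1 _ _ hx hbd hb hbG
  have hP := play_snoc.mpr ⟨hx, hbd, hbG, h1⟩
  refine ⟨hP, hinv.snoc hp ?_ hv⟩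
  have hl : Legal ξ true (x ++ [b]) := play_legal hG (cd_design hs.dual) hP
  obtain ⟨_, m, _, _, hm, hj, _, _⟩ := hl.step List.prefix_rfl hne
  obtain ⟨u, hu⟩ := mem_split_prefix hm
  obtain ⟨w', hw', hc', hv'⟩ := hinv _ _ hu
  have hu' : u ++ [m] <+: x ++ [b] := hu.trans (List.prefix_append _ _)
  rw [hl.cov_pos List.prefix_rfl hb hu' hj, hs.cov_pos hp hb hw' hj, hc']
theorem proj_hd (hs : Legal ξ true s) (hi : proper true ξ K ∈ s) : [proper true ξ J] ∈ CD ξ true (proj ξ J s) := by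
  obtain ⟨w, hw⟩ := mem_split_prefix hi
  have := (hs.isIn_nil hw).mp (by simp [isIn])
  subst this
  refine Or.inl ⟨[proper true ξ J], ?_, by simp, by rw [view_single]⟩
  have := proj_prefix (ξ := ξ) (I := J) hw
  rwa [proj_true (by simp [pI, isIn]), rl_init] at this
theorem other_G (hs : Legal ξ true s) (hi : proper true ξ (I ∪ J) ∈ s) (hp : p ++ [b] <+: s)
    (hb : pI ξ I b = false) : view (p ++ [b]) ∈ TD ξ I J D (CD ξ true (proj ξ J s)) := by
  have hbs : b ∈ s := hp.subset (by simp)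
  have h1 := pI_other hs hi hbs hb
  have h2 : view (proj ξ J (p ++ [b])) ∈ CD ξ true (proj ξ J s) :=
    Or.inl ⟨_, proj_prefix hp, by rw [proj_true h1]; simp, rfl⟩
  have h3 := up_D (J := I) (F := D) (cd_design (hs.proj J)) (proj_hd hs hi) h2
  rw [view_proj (hs.pre hp) h1, rl_map_rl, Finset.union_comm,
    hs.rl_self hi (fun a ha => hp.subset (view_subset ha)), TD_comm] at h3
  exact h3
theorem block_step (hs : Legal ξ true s) (hi : proper true ξ (I ∪ J) ∈ s)
    (hG : IsDesign (simpleBase ξ true) (TD ξ I J D (CD ξ true (proj ξ J s))))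
    (ho : OrthP (TD ξ I J D (CD ξ true (proj ξ J s))) (CD ξ false (s.map dual)))
    (hx : Play (TD ξ I J D (CD ξ true (proj ξ J s))) (CD ξ false (s.map dual)) (x ++ [a]))
    (hinv : INV ξ I s (x ++ [a])) :
    ∀ y, p ++ [a] ++ y <+: s → (∀ z ∈ y, pI ξ I z = false) →
      Play (TD ξ I J D (CD ξ true (proj ξ J s))) (CD ξ false (s.map dual)) (x ++ [a] ++ y) ∧
      INV ξ I s (x ++ [a] ++ y) ∧ cov (x ++ [a] ++ y) = cov (p ++ [a] ++ y) ∧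
      (∀ x0 n, x ++ [a] ++ y = x0 ++ [n] → pI ξ I n = false → 
        view (x ++ [a] ++ y) = view (p ++ [a] ++ y)) := by
  intro y
  induction y using List.reverseRecOn with
  | nil =>
    intro hp _
    simp only [List.append_nil] at *
    refine ⟨hx, hinv, (hinv.last hs hp).1, fun x0 n he hn => ?_⟩
    have he' := List.append_inj' he rfl
    simp at he'
    obtain ⟨rfl, rfl⟩ := he'
    exact (hinv.last hs hp).2 hn
  | append_singleton y b ih =>
    intro hp hy
    rw [← List.append_assoc] at hp
    have hbF : pI ξ I b = false := hy b (by simp)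
    obtain ⟨h1, h2, h3, h4⟩ := ih ((List.prefix_append _ _).trans hp) (fun z hz => hy z (by simp [hz]))
    have h5 : Play (TD ξ I J D (CD ξ true (proj ξ J s))) (CD ξ false (s.map dual)) (x ++ [a] ++ y ++ [b]) ∧
      INV ξ I s (x ++ [a] ++ y ++ [b]) := by
      cases hb : b.isPositive with
      | false => exact neg_step hs hG ho h1 h2 (by simp) h3 hp hb
      | true =>
        have hvv : view (x ++ [a] ++ y) = view (p ++ [a] ++ y) := by
          have : ∃ x0 p0 n, x ++ [a] ++ y = x0 ++ [n] ∧ p ++ [a] ++ y = p0 ++ [n] := by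
            obtain rfl | ⟨y, n, rfl⟩ := List.eq_nil_or_concat' y
            · exact ⟨x, p, a, by simp, by simp⟩
            · exact ⟨x ++ [a] ++ y, p ++ [a] ++ y, n, by simp, by simp⟩
          obtain ⟨x0, p0, n, e1, e2⟩ := this
          refine h4 x0 n e1 ?_
          rw [e2] at hp
          rw [(pos_prev (hs.pre hp) hb).1, hbF]
        have hvb : view (x ++ [a] ++ y ++ [b]) = view (p ++ [a] ++ y ++ [b]) := by
          rw [view_pos _ hb, view_pos _ hb, hvv]
        exact pos_step hs hG ho h1 h2 (by simp) hp hb (by rw [hvb]; exact other_G hs hi hp hbF) (fun _ => hvb)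
    rw [← List.append_assoc, ← List.append_assoc]
    obtain ⟨h6, h7⟩ := h5
    have h8 := h7.last hs hp
    refine ⟨h6, h7, h8.1, fun _ _ _ _ => h8.2 hbF⟩
theorem proj_last : ∀ w, proj ξ I w = u ++ [b] → ∃ w1 a y, w = w1 ++ [a] ++ y ∧ pI ξ I a = true ∧
    rl ξ I a = b ∧ ∀ z ∈ y, pI ξ I z = false := by
  intro w
  induction w using List.reverseRecOn with
  | nil => intro h; simp [proj_nil] at h
  | append_singleton w c ih =>
    intro h
    cases hc : pI ξ I c with
    | true =>
      rw [proj_true hc] at h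
      have he' := List.append_inj' h rfl
      simp at he'
      exact ⟨w, c, [], by simp, hc, he'.2, by simp⟩
    | false =>
      rw [proj_false hc] at h
      obtain ⟨w1, a, y, rfl, h1, h2, h3⟩ := ih h
      refine ⟨w1, a, y ++ [c], by simp, h1, h2, ?_⟩
      intro z hz
      simp at hz
      rcases hz with hz | rfl
      · exact h3 z hz
      · exact hc
theorem proj_app_false : ∀ y, (∀ z ∈ y, pI ξ I z = false) → proj ξ I (x ++ y) = proj ξ I x := by
  intro y
  induction y using List.reverseRecOn with
  | nil => simp
  | append_singleton y b ih =>
    intro h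
    rw [← List.append_assoc, proj_false (h b (by simp)), ih (fun z hz => h z (by simp [hz]))]
def Sim (ξ : Address) (I : Finset ℕ) (G : DSet) (s v : List Action) : Prop :=
  ∃ x a, Play G (CD ξ false (s.map dual)) (x ++ [a]) ∧ proj ξ I (x ++ [a]) = v ∧ pI ξ I a = true ∧
    INV ξ I s (x ++ [a])
theorem sim_neg (hs : Legal ξ true s) (hi : proper true ξ (I ∪ J) ∈ s)
    (hG : IsDesign (simpleBase ξ true) (TD ξ I J D (CD ξ true (proj ξ J s))))
    (ho : OrthP (TD ξ I J D (CD ξ true (proj ξ J s))) (CD ξ false (s.map dual)))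
    (h : Sim ξ I (TD ξ I J D (CD ξ true (proj ξ J s))) s v) (hk : κ.isPositive = false)
    (hve : VE (proj ξ I s) (v ++ [κ])) :
    ∃ x, Play (TD ξ I J D (CD ξ true (proj ξ J s))) (CD ξ false (s.map dual)) (x ++ [κ]) ∧ 
      proj ξ I (x ++ [κ]) = v ++ [κ] ∧ pI ξ I κ = true ∧ isIn ξ κ = false ∧ INV ξ I s (x ++ [κ]) := by
  obtain ⟨x, a, hx, rfl, ha, hinv⟩ := h
  obtain ⟨u, hu, hc⟩ := hve
  have hlast := cov_getLast? u
  rw [← hc, cov_getLast?] at hlast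
  simp at hlast
  obtain ⟨u, rfl⟩ := List.getLast?_eq_some_iff.mp hlast.symm
  rw [cov_neg _ hk, cov_neg _ hk] at hc
  have hc2 := List.append_cancel_right hc
  obtain ⟨w', κ', hw', hκ', rfl, rfl⟩ := prefix_proj hu
  have hκs : κ' ∈ s := hw'.subset (by simp)
  have hki : isIn ξ κ' = false := hs.neg_isIn hκs (by rwa [rl_isPositive] at hk)
  rw [rl_not_in hki] at *
  have hl1 := cov_getLast? (proj ξ I w')
  rw [← hc2, cov_getLast?, proj_true ha] at hl1
  simp at hl1
  obtain ⟨u1, hu1⟩ := List.getLast?_eq_some_iff.mp hl1.symm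
  obtain ⟨w1, a', y, rfl, ha', hra, hy⟩ := proj_last _ hu1
  have has : a ∈ s := hinv.mem (by simp)
  have : a' = a := hs.mem_unique (hw'.subset (by simp)) has (by
    rw [← rl_focus (ξ := ξ) (L := I) a', hra, rl_focus])
  subst this
  obtain ⟨h1, h2, h3, _⟩ := block_step (p := w1) hs hi hG ho hx hinv y ((List.prefix_append _ _).trans hw') hy
  obtain ⟨h4, h5⟩ := neg_step hs hG ho h1 h2 (by simp) h3 hw' hk
  refine ⟨_, h4, ?_, hκ', hki, h5⟩
  rw [proj_true hκ', proj_app_false y hy, rl_not_in hki]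
theorem sim_G (hs : Legal ξ true s) (hi : proper true ξ (I ∪ J) ∈ s) (hD : IsDesign (simpleBase ξ true) D)
    (hID : [proper true ξ I] ∈ D) (hl : Legal ξ true (x ++ [a])) (ha : pI ξ I a = true)
    (hsub : ∀ b ∈ x ++ [a], b ∈ s)
    (hk : κ.isPositive = true) (hki : isIn ξ κ = false) (hv : view (proj ξ I (x ++ [a]) ++ [κ]) ∈ D) :
    view (x ++ [a] ++ [κ]) ∈ TD ξ I J D F := by
  have h1 := up_D (J := J) (F := F) hD hID hv
  rw [view_pos _ hk, view_proj hl ha, List.map_append, rl_map_rl,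
    hs.rl_self hi (fun b hb => hsub b (view_subset hb))] at h1
  rw [view_pos _ hk]
  simpa [rl_not_in hki] using h1
theorem sim (hs : Legal ξ true s) (hi : proper true ξ (I ∪ J) ∈ s) (hD : IsDesign (simpleBase ξ true) D)
    (hID : [proper true ξ I] ∈ D)
    (hG : IsDesign (simpleBase ξ true) (TD ξ I J D (CD ξ true (proj ξ J s))))
    (ho : OrthP (TD ξ I J D (CD ξ true (proj ξ J s))) (CD ξ false (s.map dual))) :
    ∀ v, Play D Y v → Legal ξ true v → (∀ u, u <+: v → VE (proj ξ I s) u) → v ≠ [] →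
      Sim ξ I (TD ξ I J D (CD ξ true (proj ξ J s))) s v := by
  intro v
  induction v using List.reverseRecOn with
  | nil => intro _ _ _ h; exact absurd rfl h
  | append_singleton v κ ih =>
    intro hp hl hve _
    have hκ := ve_mem (hve _ List.prefix_rfl)
    obtain ⟨κ', hκs, hκp, hκe⟩ := mem_proj.mp hκ
    by_cases hv : v = []
    · subst hv
      obtain ⟨L, rfl⟩ := Legal.head (s := []) hl
      obtain ⟨w, hw⟩ := mem_split_prefix hi
      have := (hs.isIn_nil hw).mp (by simp [isIn])
      subst this
      have h1 : view ([] ++ [proper true ξ (I ∪ J)]) ∈ TD ξ I J D (CD ξ true (proj ξ J s)) := by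
        rw [List.nil_append, view_single]; exact ⟨[], rfl, Or.inl hID⟩
      have h2 := ho.2.1 [] _ (play_nil _ _) (by simp) rfl h1
      refine ⟨[], _, play_snoc.mpr ⟨play_nil _ _, by simp, h1, h2⟩, ?_, by simp [pI, isIn], ?_⟩
      · rw [proj_true (by simp [pI, isIn]), rl_init, proj_nil]
        rw [hκe]
        have : isIn ξ κ' = true := by rw [← rl_isIn (L := I), ← hκe]; simp [isIn]
        cases κ' with
        | daimon => simp [isIn] at this
        | proper b f M =>
          simp [isIn] at this
          subst this
          rw [rl_init] at hκe ⊢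
          simp at hκe
          simp [← hκe]
      · have h0 : INV ξ I s [] := by intro w m hw; simp at hw
        exact h0.snoc (p := []) hw rfl (fun _ => rfl)
    · have hsv := ih (hp.prefix (List.prefix_append _ _)) (hl.pre (List.prefix_append _ _))
        (fun u hu => hve u (hu.trans (List.prefix_append _ _))) hv
      cases hk : κ.isPositive with
      | false =>
        obtain ⟨x, h1, h2, h3, h4, h5⟩ := sim_neg hs hi hG ho hsv hk (hve _ List.prefix_rfl)
        exact ⟨x, κ, h1, h2, h3, h5⟩
      | true =>
        obtain ⟨x, a, hx, rfl, ha, hinv⟩ := hsv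
        have hki : isIn ξ κ = false := by
          cases h : isIn ξ κ with
          | false => rfl
          | true => exact absurd ((hl.isIn_nil List.prefix_rfl).mp h) hv
        have hki' : isIn ξ κ' = false := by rwa [hκe, rl_isIn] at hki
        rw [rl_not_in hki'] at hκe
        subst hκe
        have hlx : Legal ξ true (x ++ [a]) := play_legal hG (cd_design hs.dual) hx
        obtain ⟨p, hpp⟩ := mem_split_prefix hκs
        have := pos_step (b := κ) hs hG ho hx hinv (by simp) hpp hk
          (sim_G hs hi hD hID hlx ha (fun b hb => hinv.mem hb) hk hki (hp.2 _ List.prefix_rfl (by simp)).1)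
          (fun h => by rw [hκp] at h; cases h)
        exact ⟨_, _, this.1, by rw [proj_true hκp, rl_not_in hki], hκp, this.2⟩
end P16
end Part16
section Part17
open Action
section P17
variable {ξ : Address} {pos : Bool} {q s u v w c d t t1 t2 tl x y p : List Action} {a b m n κ k : Action}
  {X Y D E F G : DSet} {I J K L I' J' K' : Finset ℕ} {A B C : Behaviour ξ true} {SA SB : Set (Finset ℕ)}
theorem ve_nil_pos (hs : Legal ξ true s) (hk : κ.isPositive = false) (h : VE s ([] ++ [κ])) : False := by
  obtain ⟨u, hu, hc⟩ := h
  have hlast := cov_getLast? u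
  rw [← hc, cov_getLast?] at hlast
  simp at hlast
  obtain ⟨u, rfl⟩ := List.getLast?_eq_some_iff.mp hlast.symm
  rw [cov_neg _ hk, cov_neg _ hk] at hc
  have hc2 := List.append_cancel_right hc
  have : u = [] := by
    by_contra hne
    exact cov_ne_nil hne (by rw [← hc2]; rfl)
  subst this
  obtain ⟨L, rfl⟩ := Legal.head (s := []) (hs.pre hu)
  simp [isPositive] at hk
theorem ve_head_proj (h : VE (proj ξ I s) [proper true ξ L]) : L = I := by
  have := ve_mem (w := []) h
  obtain ⟨κ', hκs, hκp, hκe⟩ := mem_proj.mp this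
  have : isIn ξ κ' = true := by rw [← rl_isIn (L := I), ← hκe]; simp [isIn]
  cases κ' with
  | daimon => simp [isIn] at this
  | proper b f M =>
    simp [isIn] at this
    subst this
    rw [rl_init] at hκe
    simp at hκe
    exact hκe.2
theorem t2_perp (h : IsTensorOf C A B) (hal : Alien ξ A B) (hs : VisS C s) (hi : proper true ξ (I ∪ J) ∈ s)
    (hI : I ∈ dir A) (hJ : J ∈ dir B) : CD ξ false ((proj ξ I s).map dual) ∈ perp A := by
  have hl := hs.legal
  have hdis : Disjoint I J := hal I hI J hJ
  have hB : CD ξ true (proj ξ J s) ∈ B.designs :=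
    t2_mem (tensor_comm h) (alien_symm hal) hs (by rwa [Finset.union_comm]) hJ hI
  have hlA := hl.proj I
  rw [mem_perp]
  refine ⟨cd_design hlA.dual, fun D hD => ?_⟩
  have hDd := A.isDesign D hD
  have hFd := B.isDesign _ hB
  have hJF : [proper true ξ J] ∈ CD ξ true (proj ξ J s) := proj_hd hl hi
  have pre : ∀ v, v ≠ [] → Play D (CD ξ (!true) ((proj ξ I s).map dual)) v → Legal ξ true v →
      (∀ u, u <+: v → VE (proj ξ I s) u) →
      [proper true ξ I] ∈ D ∧ IsDesign (simpleBase ξ true) (TD ξ I J D (CD ξ true (proj ξ J s))) ∧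
      OrthP (TD ξ I J D (CD ξ true (proj ξ J s))) (CD ξ false (s.map dual)) ∧
      Sim ξ I (TD ξ I J D (CD ξ true (proj ξ J s))) s v := by
    intro v hne hp hlv hve
    have hID : [proper true ξ I] ∈ D := by
      cases v with
      | nil => exact absurd rfl hne
      | cons b v =>
        obtain ⟨L, rfl⟩ := hlv.head
        have hpre : [proper true ξ L] <+: proper true ξ L :: v := by simp
        have := ve_head_proj (hve _ hpre)
        subst this
        have := (hp.2 _ hpre (by simp)).1
        rwa [view_single] at this
    have hGm := TD_mem h hal hD hB hID hJF
    have hGd := C.isDesign _ hGm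
    have ho := (mem_perp.mp hs.cd_perp).2 _ hGm
    exact ⟨hID, hGd, ho, sim hl hi hDd hID hGd ho v hp hlv hve hne⟩
  refine cd_orth (pos := true) hlA hDd ?_ ?_
  · intro v κ hp hlv hve hk hvk
    by_cases hv : v = []
    · subst hv; exact (ve_nil_pos hlA hk hvk).elim
    obtain ⟨hID, hGd, ho, hsim⟩ := pre v hv hp hlv hve
    obtain ⟨x, h1, h2, h3, h4, h5⟩ := sim_neg hl hi hGd ho hsim hk hvk
    have hlx : Legal ξ true (x ++ [κ]) := play_legal hGd (cd_design hl.dual) h1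
    rw [← h2, view_proj hlx h3]
    have hg := (h1.2 _ List.prefix_rfl (by simp)).1
    obtain ⟨t, ht, htD, _⟩ := down_D (a := κ) hDd hFd hdis hg (by
      obtain ⟨c, hc⟩ := view_snoc x κ
      rw [hc]; simp) (by simpa [pI, h4] using h3)
    rw [ht, List.map_cons, rl_init, map_rl_id (chr_not_in (des_chr hDd htD))]
    exact htD
  · intro v κ hp hlv hve hv hkd hk hvk
    obtain ⟨hID, hGd, ho, x, a, hx, rfl, ha, hinv⟩ := pre v hv hp hlv hve
    have hlx : Legal ξ true (x ++ [a]) := play_legal hGd (cd_design hl.dual) hx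
    have hvk' := hvk
    rw [view_pos _ hk] at hvk'
    obtain ⟨t, ht⟩ := hd_form hDd hID hvk'
    have hch := des_chr hDd hvk'
    rw [ht] at hch
    have hκt : κ ∈ t := by
      have hv0 : view (proj ξ I (x ++ [a])) ≠ [] := view_ne_nil hv
      obtain ⟨e, r, her⟩ := List.exists_cons_of_ne_nil hv0
      rw [her] at ht
      simp at ht
      rw [← ht.2]; simp
    have hki := chr_not_in hch κ hκt
    have hkc := chr_cls hch κ hκt hkd
    have hg := sim_G (F := CD ξ true (proj ξ J s)) hl hi hDd hID hlx ha (fun b hb => hinv.mem hb) hk hki hvk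
    have h1 := ho.2.1 _ _ hx hkd hk hg
    have hP := play_snoc.mpr ⟨hx, hkd, hg, h1⟩
    have hlk : Legal ξ true (x ++ [a] ++ [κ]) := play_legal hGd (cd_design hl.dual) hP
    obtain ⟨_, m, _, _, hm, hj, hmp, _⟩ := hlk.step List.prefix_rfl (by simp)
    rw [hk] at hmp
    have hmi := hlx.neg_isIn hm hmp
    have hpm : pI ξ I m = true := by
      rw [hlx.pI_just' hm hj hmi]; simp [pI, hkc]
    exact ⟨m, mem_proj.mpr ⟨m, hm, hpm, (rl_not_in hmi).symm⟩, hj, hmp⟩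
theorem T2 (h : IsTensorOf C A B) (hal : Alien ξ A B) (hs : VisS C s) (hi : proper true ξ (I ∪ J) ∈ s)
    (hI : I ∈ dir A) (hJ : J ∈ dir B) : VisS A (proj ξ I s) :=
  visS_of_cd (hs.legal.proj I) (t2_mem h hal hs hi hI hJ) (t2_perp h hal hs hi hI hJ)
end P17
end Part17
section Part18
open Action
section P18
variable {ξ : Address} {pos : Bool} {q s u v w c d t t1 t2 tl x y p : List Action} {a b m n κ k : Action}
  {X Y D E F G : DSet} {I J K L I' J' K' : Finset ℕ} {A B C : Behaviour ξ true} {SA SB : Set (Finset ℕ)}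
theorem ve_split (hk : κ.isPositive = false) (h : VE s (v ++ [κ])) : ∃ u, u ++ [κ] <+: s ∧ cov v = cov u := by
  obtain ⟨u, hu, hc⟩ := h
  have hlast := cov_getLast? u
  rw [← hc, cov_getLast?] at hlast
  simp at hlast
  obtain ⟨u, rfl⟩ := List.getLast?_eq_some_iff.mp hlast.symm
  rw [cov_neg _ hk, cov_neg _ hk] at hc
  exact ⟨u, hu, List.append_cancel_right hc⟩
theorem ve_sub (hve : ∀ u, u <+: v → VE s u) : ∀ a ∈ v, a ∈ s := by
  intro a ha
  obtain ⟨u, hu⟩ := mem_split_prefix ha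
  exact ve_mem (hve _ hu)
theorem leg_ext (hs : Legal ξ true s) (hv : Legal ξ true v) (hve : ∀ u, u <+: v → VE s u) (hne : v ≠ [])
    (hk : κ.isPositive = false) (h : VE s (v ++ [κ])) : Legal ξ true (v ++ [κ]) := by
  obtain ⟨u, hu, hc⟩ := ve_split hk h
  have hun : u ≠ [] := by rintro rfl; exact cov_ne_nil hne hc
  have hκs : κ ∈ s := hu.subset (by simp)
  obtain ⟨n, m, hn, hnp, hm, hj, hmp, _, h2⟩ := hs.step hu hun
  have hmc := h2 hk
  rw [← hc] at hmc
  rw [← cov_getLast?, ← hc, cov_getLast?] at hn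
  obtain ⟨b, f, L, rfl⟩ := hs.prop hκs
  refine legal_snoc.mpr ⟨hv, b, f, L, rfl, ?_, Or.inr ⟨n, m, hn, hnp, cov_subset hmc, hj, hmp, ?_, fun _ => hmc⟩⟩
  · intro hf
    obtain ⟨b', L', hmem⟩ := mem_foci.mp hf
    have hin := hs.mem_unique (ve_sub hve _ hmem) hκs rfl
    rw [hin] at hmem
    obtain ⟨v1, hv1⟩ := mem_split_prefix hmem
    obtain ⟨u1, hu1, hc1⟩ := ve_split hk (hve _ hv1)
    obtain ⟨rfl, _⟩ := hs.at_unique hu hu1 rfl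
    have h3 : v1.getLast? = some n := by rw [← cov_getLast?, hc1, ← hc, cov_getLast?, hn]
    have hnv1 : n ∈ v1 := List.mem_of_getLast? h3
    obtain ⟨r, rfl⟩ := hv1
    have hnd := hv.nodup
    rw [List.append_assoc, List.nodup_append] at hnd
    refine hnd.2.2 n hnv1 n ?_ rfl
    rw [List.append_assoc, List.getLast?_append_of_ne_nil _ (by simp)] at hn
    exact List.mem_of_getLast? hn
  · intro hb; simp [isPositive] at hk; rw [hk] at hb; cases hb
theorem chain_head (h : JustChain (simpleBase ξ true) s t) : ∃ L r, t = proper true ξ L :: r ∧ proper true ξ L ∈ s := by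
  induction h with
  | @init κ hm hi =>
    obtain ⟨pol, f, L, rfl, σ, hσ, h⟩ := hi
    simp [simpleBase] at hσ
    subst hσ
    simp at h
    obtain ⟨rfl, rfl⟩ := h
    exact ⟨L, [], rfl, hm⟩
  | @cons s' κ κ' _ _ _ ih =>
    obtain ⟨L, r, he, hm⟩ := ih
    refine ⟨L, r ++ [κ'], ?_, hm⟩
    have : s' ++ [κ, κ'] = (s' ++ [κ]) ++ [κ'] := by simp
    rw [this, he]; rfl
theorem chain_init (hs : Legal ξ true s) (hi : proper true ξ K ∈ s) (h : JustChain (simpleBase ξ true) s t)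
    (h' : JustChain (simpleBase ξ true) x t) : proper true ξ K ∈ x := by
  obtain ⟨L, r, rfl, hm⟩ := chain_head h
  obtain ⟨L', r', he, hm'⟩ := chain_head h'
  simp at he
  obtain ⟨rfl, rfl⟩ := he
  have := hs.mem_unique hm hi rfl
  rwa [this] at hm'
theorem trv_dir (hs : Legal ξ true s) (hi : proper true ξ K ∈ s) (h : Trv C s) : K ∈ dir C := by
  obtain ⟨t, s', h1, _, h3, h4⟩ := h _ hi
  exact visS_dir h3 (chain_init hs hi h1 h4)
theorem trv_sub (hs : Legal ξ true s) (h : Trv C s) (hv : Legal ξ true v) (hsub : ∀ a ∈ v, a ∈ s) : Trv C v := by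
  intro κ hκ
  obtain ⟨t, s', h1, h2, h3, h4⟩ := h κ (hsub κ hκ)
  exact ⟨t, s', justChain_sub hs hv hsub h1 κ h2 hκ, h2, h3, h4⟩
theorem trv_proj (h : IsTensorOf C A B) (hal : Alien ξ A B) (hI : I ∈ dir A) (hJ : J ∈ dir B)
    (hv : Legal ξ true v) (hi : proper true ξ (I ∪ J) ∈ v) (ht : Trv C v) : Trv A (proj ξ I v) := by
  intro κ hκ
  obtain ⟨a, ha, hp, rfl⟩ := mem_proj.mp hκ
  obtain ⟨t, s', h1, h2, h3, h4⟩ := ht a ha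
  have hi' := chain_init hv hi h1 h4
  refine ⟨t.map (rl ξ I), proj ξ I s', justChain_proj hv h1 h2 hp, by rw [List.getLast?_map, h2]; rfl,
    T2 h hal h3 hi' hI hJ, justChain_proj h3.legal h4 h2 hp⟩
theorem head_eq (hv : Legal ξ true (w ++ [a])) (ha : isIn ξ a = true) (hi : proper true ξ K ∈ w ++ [a]) :
    w ++ [a] = [proper true ξ K] := by
  have := (hv.isIn_nil List.prefix_rfl).mp ha
  subst this
  simp at hi
  simp [hi]
theorem view_down (hD : IsDesign (simpleBase ξ true) D) (hF : IsDesign (simpleBase ξ true) F)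
    (hID : [proper true ξ I] ∈ D) (hdis : Disjoint I J) (hl : Legal ξ true (w ++ [a]))
    (hi : proper true ξ (I ∪ J) ∈ w ++ [a]) (ha : pI ξ I a = true)
    (h : view (w ++ [a]) ∈ TD ξ I J D F) : view (proj ξ I (w ++ [a])) ∈ D := by
  rw [view_proj hl ha]
  cases hai : isIn ξ a with
  | true =>
    rw [head_eq hl hai hi, view_single, List.map_singleton, rl_init]; exact hID
  | false =>
    obtain ⟨t, ht, htD, _⟩ := down_D (a := a) hD hF hdis h (by
      obtain ⟨c, hc⟩ := view_snoc w a
      rw [hc]; simp) (by simpa [pI, hai] using ha)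
    rw [ht, List.map_cons, rl_init, map_rl_id (chr_not_in (des_chr hD htD))]
    exact htD
theorem proj_play (hD : IsDesign (simpleBase ξ true) D) (hF : IsDesign (simpleBase ξ true) F)
    (hID : [proper true ξ I] ∈ D) (hdis : Disjoint I J) (hl : Legal ξ true v)
    (hi : proper true ξ (I ∪ J) ∈ v) (h : ∀ w, w <+: v → w ≠ [] → view w ∈ TD ξ I J D F)
    (hq : proj ξ I v <+: q) : Play D (CD ξ false (q.map dual)) (proj ξ I v) := by
  refine ⟨(hl.proj I).dai, fun w hw hne => ⟨?_, Or.inl ⟨_, prefix_dual.mpr (hw.trans hq), by simpa using hne, rfl⟩⟩⟩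
  obtain rfl | ⟨w, κ, rfl⟩ := List.eq_nil_or_concat' w
  · exact absurd rfl hne
  obtain ⟨w, a, hw', ha, rfl, rfl⟩ := prefix_proj hw
  rw [← proj_true ha]
  exact view_down hD hF hID hdis (hl.pre hw') (head_mem_prefix hl hi hw' (by simp)) ha (h _ hw' (by simp))
theorem ext_a (hD : IsDesign (simpleBase ξ true) D) (hF : IsDesign (simpleBase ξ true) F)
    (hID : [proper true ξ I] ∈ D) (hdis : Disjoint I J) (hl : Legal ξ true (v ++ [κ]))
    (hi : proper true ξ (I ∪ J) ∈ v) (h : ∀ w, w <+: v → w ≠ [] → view w ∈ TD ξ I J D F)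
    (ho : OrthP D (CD ξ false ((proj ξ I (v ++ [κ])).map dual))) (hk : κ.isPositive = false)
    (hp : pI ξ I κ = true) : view (v ++ [κ]) ∈ TD ξ I J D F := by
  have hki : isIn ξ κ = false := hl.neg_isIn (by simp) hk
  have hpr : proj ξ I (v ++ [κ]) = proj ξ I v ++ [κ] := by rw [proj_true hp, rl_not_in hki]
  have hP : Play D (CD ξ false ((proj ξ I (v ++ [κ])).map dual)) (proj ξ I v) :=
    proj_play hD hF hID hdis (hl.pre (List.prefix_append _ _)) hi h (by rw [hpr]; exact List.prefix_append _ _)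
  have h1 := ho.2.2 _ κ hP hk (Or.inl ⟨_, prefix_dual.mpr (by rw [hpr]), by simp, rfl⟩)
  rw [← hpr, view_proj hl hp] at h1
  have h2 := up_D (J := J) (F := F) hD hID h1
  rwa [rl_map_rl, hl.rl_self (K := I ∪ J) (by simp [hi]) (fun a ha => view_subset ha)] at h2
theorem ext_b (hD : IsDesign (simpleBase ξ true) D) (hF : IsDesign (simpleBase ξ true) F)
    (hID : [proper true ξ I] ∈ D) (hdis : Disjoint I J) (hl : Legal ξ true (v ++ [n]))
    (hi : proper true ξ (I ∪ J) ∈ v ++ [n]) (h : ∀ w, w <+: v ++ [n] → w ≠ [] → view w ∈ TD ξ I J D F)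
    (ho : OrthP D (CD ξ false ((proj ξ I (v ++ [n])).map dual))) (hn : n.isPositive = false)
    (hk : κ.isPositive = true) (hkd : κ ≠ daimon)
    (hp : pI ξ I n = true) (hv : view (v ++ [n] ++ [κ]) ∈ TD ξ I J D F) :
    ∃ m ∈ v ++ [n], m.justifies κ ∧ m.isPositive = false := by
  have hni : isIn ξ n = false := hl.neg_isIn (by simp) hn
  have hP : Play D (CD ξ false ((proj ξ I (v ++ [n])).map dual)) (proj ξ I (v ++ [n])) :=
    proj_play hD hF hID hdis hl hi h List.prefix_rfl
  rw [view_pos _ hk] at hv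
  obtain ⟨c, hc⟩ := view_snoc v n
  obtain ⟨t, ht, htD, _⟩ := down_D (a := n) hD hF hdis hv (by
      rw [hc]; simp) (by simpa [pI, hni] using hp)
  have hn0 : view (v ++ [n]) ≠ [] := view_ne_nil (by simp)
  obtain ⟨e, r, her⟩ := List.exists_cons_of_ne_nil hn0
  have ht' := ht
  rw [her] at ht'
  simp at ht'
  have hni' := chr_not_in (des_chr hD htD)
  have hki : isIn ξ κ = false := hni' κ (by rw [← ht'.2]; simp)
  have h1 : view (proj ξ I (v ++ [n]) ++ [κ]) ∈ D := by
    rw [view_pos _ hk, view_proj hl hp]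
    have : (view (v ++ [n])).map (rl ξ I) ++ [κ] = (view (v ++ [n]) ++ [κ]).map (rl ξ I) := by
      simp [rl_not_in hki]
    rw [this, ht, List.map_cons, rl_init, map_rl_id hni']
    exact htD
  have h2 := ho.2.1 _ κ hP hkd hk h1
  have hP' := play_snoc.mpr ⟨hP, hkd, h1, h2⟩
  have hlk : Legal ξ true (proj ξ I (v ++ [n]) ++ [κ]) := play_legal hD (cd_design (hl.proj I).dual) hP'
  obtain ⟨_, m, _, _, hm, hj, hmp, _⟩ := hlk.step List.prefix_rfl (by rw [proj_true hp]; simp)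
  rw [hk] at hmp
  have hmi := (hl.proj I).neg_isIn hm hmp
  obtain ⟨m', hm', _, rfl⟩ := mem_proj.mp hm
  rw [rl_isIn] at hmi
  rw [rl_not_in hmi] at hj hmp
  exact ⟨m', hm', hj, hmp⟩
theorem fwd (h : IsTensorOf C A B) (hal : Alien ξ A B) (hA : Regular A) (hB : Regular B) : Regular C := by
  rw [regular_iff] at *
  intro s hs ht
  by_cases hne : s = []
  · subst hne; exact visS_nil C
  obtain ⟨K, hi⟩ : ∃ K, proper true ξ K ∈ s := by
    cases s with
    | nil => exact absurd rfl hne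
    | cons b s =>
      obtain ⟨L, rfl⟩ := hs.head
      exact ⟨L, by simp⟩
  obtain ⟨I, hI, J, hJ, rfl⟩ := dir_tensor h hal (trv_dir hs hi ht)
  have hdis : Disjoint I J := hal I hI J hJ
  have hal' : AlienS (dir A) (dir B) := hal
  have RA : ∀ v, Legal ξ true v → (∀ a ∈ v, a ∈ s) → v ≠ [] →
      proper true ξ (I ∪ J) ∈ v ∧ VisS A (proj ξ I v) ∧ VisS B (proj ξ J v) := by
    intro v hv hsub hvn
    have hiv : proper true ξ (I ∪ J) ∈ v := by
      cases v with
      | nil => exact absurd rfl hvn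
      | cons b v =>
        obtain ⟨L, rfl⟩ := hv.head
        have := hs.mem_unique (hsub (proper true ξ L) (by simp)) hi rfl
        rw [this]; simp
    have htv := trv_sub hs ht hv hsub
    refine ⟨hiv, hA _ (hv.proj I) (trv_proj h hal hI hJ hv hiv htv), hB _ (hv.proj J) ?_⟩
    exact trv_proj (tensor_comm h) (alien_symm hal) hJ hI hv (by rwa [Finset.union_comm]) htv
  obtain ⟨_, hsA, hsB⟩ := RA s hs (fun _ h => h) hne
  refine ⟨TD ξ I J (CD ξ true (proj ξ I s)) (CD ξ true (proj ξ J s)),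
    TD_mem h hal hsA.cd_mem hsB.cd_mem (proj_hd hs hi) (proj_hd hs hi), CD ξ false (s.map dual), ?_, ?_⟩
  · refine mem_perp_of h hal (cd_design hs.dual) ?_
    intro D hD F hF I' J' hI' hJ'
    have hDd := A.isDesign D hD
    have hFd := B.isDesign F hF
    have hdis' : Disjoint I' J' := hal _ (hd_dir hD hI') _ (hd_dir hF hJ')
    have hTd := TD_design (J := J') hDd hFd hI' hdis'
    have pre : ∀ v, v ≠ [] → Play (TD ξ I' J' D F) (CD ξ (!true) (s.map dual)) v → Legal ξ true v →
        (∀ u, u <+: v → VE s u) → I' = I ∧ J' = J := by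
      intro v hvn hp hlv hve
      cases v with
      | nil => exact absurd rfl hvn
      | cons b v =>
        obtain ⟨L, rfl⟩ := hlv.head
        have h1 := (hp.2 [proper true ξ L] (by simp) (by simp)).1
        rw [view_single] at h1
        have h2 := TD_single h1
        have h3 := hs.mem_unique (ve_sub hve (proper true ξ L) (by simp)) hi rfl
        rw [h3] at h2
        simp at h2
        have := hal'.inj (hd_dir hD hI') hI (hd_dir hF hJ') hJ h2.symm
        exact this
    refine cd_orth (pos := true) hs hTd ?_ ?_
    · intro v κ hp hlv hve hk hvk
      by_cases hv : v = []
      · subst hv; exact (ve_nil_pos hs hk hvk).elim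
      obtain ⟨rfl, rfl⟩ := pre v hv hp hlv hve
      have hlk := leg_ext hs hlv hve hv hk hvk
      have hsubk : ∀ a ∈ v ++ [κ], a ∈ s := by
        intro a ha
        simp at ha
        rcases ha with ha | rfl
        · exact ve_sub hve a ha
        · exact ve_mem hvk
      obtain ⟨hik, hkA, hkB⟩ := RA _ hlk hsubk (by simp)
      have hiv := (RA v hlv (ve_sub hve) hv).1
      cases hpk : pI ξ I' κ with
      | true =>
        exact ext_a hDd hFd hI' hdis hlk hiv (fun w hw hwn => (hp.2 w hw hwn).1)
          ((mem_perp.mp hkA.cd_perp).2 D hD) hk hpk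
      | false =>
        rw [TD_comm]
        exact ext_a hFd hDd hJ' hdis.symm hlk (by rwa [Finset.union_comm])
          (fun w hw hwn => by rw [TD_comm]; exact (hp.2 w hw hwn).1)
          ((mem_perp.mp hkB.cd_perp).2 F hF) hk (pI_other hlk hik (by simp) hpk)
    · intro v κ hp hlv hve hv hkd hk hvk
      obtain ⟨rfl, rfl⟩ := pre v hv hp hlv hve
      obtain ⟨hiv, hvA, hvB⟩ := RA v hlv (ve_sub hve) hv
      obtain rfl | ⟨v, n, rfl⟩ := List.eq_nil_or_concat' v
      · exact absurd rfl hv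
      have hn : n.isPositive = false := by
        have h1 := hvk
        rw [view_pos _ hk] at h1
        rcases des_turn hTd h1 with ⟨h2, _⟩ | ⟨b, hb, _, hb2⟩
        · exact absurd h2 (view_ne_nil (by simp))
        · rw [view_getLast?] at hb
          simp at hb
          subst hb
          rw [hk] at hb2
          simpa using hb2.symm
      cases hpn : pI ξ I' n with
      | true =>
        exact ext_b hDd hFd hI' hdis hlv hiv (fun w hw hwn => (hp.2 w hw hwn).1)
          ((mem_perp.mp hvA.cd_perp).2 D hD) hn hk hkd hpn hvk
      | false =>
        exact ext_b (D := F) (F := D) hFd hDd hJ' hdis.symm hlv (by rwa [Finset.union_comm])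
          (fun w hw hwn => by rw [TD_comm]; exact (hp.2 w hw hwn).1)
          ((mem_perp.mp hvB.cd_perp).2 F hF) hn hk hkd (pI_other hlv hiv (by simp) hpn)
          (by rw [TD_comm]; exact hvk)
  · refine ⟨hs.dai, fun w hw hwn => ⟨?_, Or.inl ⟨_, prefix_dual.mpr hw, by simpa using hwn, rfl⟩⟩⟩
    obtain rfl | ⟨w, b, rfl⟩ := List.eq_nil_or_concat' w
    · exact absurd rfl hwn
    cases hb : pI ξ I b with
    | false => exact other_G hs hi hw hb
    | true =>
      have h2 : view (proj ξ I (w ++ [b])) ∈ CD ξ true (proj ξ I s) :=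
        Or.inl ⟨_, proj_prefix hw, by rw [proj_true hb]; simp, rfl⟩
      have h3 := up_D (J := J) (F := CD ξ true (proj ξ J s)) (cd_design (hs.proj I)) (proj_hd hs hi) h2
      rwa [view_proj (hs.pre hw) hb, rl_map_rl,
        hs.rl_self hi (fun a ha => hw.subset (view_subset ha))] at h3
theorem bwd (h : IsTensorOf C A B) (hal : Alien ξ A B) (hB0 : B.designs ≠ {DaiDesign}) (hC : Regular C) :
    Regular A := by
  rw [regular_iff] at *
  intro s hs ht
  by_cases hne : s = []
  · subst hne; exact visS_nil A
  obtain ⟨I, hi⟩ : ∃ K, proper true ξ K ∈ s := by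
    cases s with
    | nil => exact absurd rfl hne
    | cons b s =>
      obtain ⟨L, rfl⟩ := hs.head
      exact ⟨L, by simp⟩
  have hI := trv_dir hs hi ht
  obtain ⟨J, hJ⟩ : ∃ J, J ∈ dir B := by
    by_contra hcon
    apply hB0
    ext D
    constructor
    · intro hD
      rcases des_cases (B.isDesign D hD) with h | ⟨J, hJ⟩
      · exact h
      · exact absurd ⟨J, hd_dir hD hJ⟩ hcon
    · rintro rfl
      have := beh_nil B
      rwa [dai_eq] at this
  have hsub : I ⊆ I ∪ J := Finset.subset_union_left
  have hl' := hs.rl (hs.up hi hsub)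
  have hin : proper true ξ (I ∪ J) ∈ s.map (rl ξ (I ∪ J)) :=
    List.mem_map.mpr ⟨_, hi, rl_init _⟩
  have hv : VisS C (s.map (rl ξ (I ∪ J))) := by
    refine hC _ hl' ?_
    intro κ hκ
    obtain ⟨a, ha, rfl⟩ := List.mem_map.mp hκ
    obtain ⟨t, s', h1, h2, h3, h4⟩ := ht a ha
    have hi' := chain_init hs hi h1 h4
    exact ⟨t.map (rl ξ (I ∪ J)), s'.map (rl ξ (I ∪ J)), justChain_rl (hs.rel (hs.up hi hsub)) h1,
      by rw [List.getLast?_map, h2]; rfl, T3 h hal h3 hi' hJ,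
      justChain_rl (h3.legal.rel (h3.legal.up hi' hsub)) h4⟩
  have hA := T2 h hal hv hin hI hJ
  have he : proj ξ I (s.map (rl ξ (I ∪ J))) = s := by
    unfold proj
    rw [List.filter_eq_self.mpr, rl_map_rl, hs.rl_self hi (fun _ h => h)]
    intro a ha
    obtain ⟨b, hb, rfl⟩ := List.mem_map.mp ha
    rw [rl_pI]
    exact hs.all_pI hi b hb
  rwa [he] at hA
end P18
end Part18

/-- for alien positive behaviours `A`, `B`, both distinct from
`0`, `A` and `B` are regular iff `A ⊗ B` is regular. -/
theorem regular_tensor_iff (ξ : Address) (A B C : Behaviour ξ true)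
    (hal : Alien ξ A B)
    (hA0 : A.designs ≠ {DaiDesign}) (hB0 : B.designs ≠ {DaiDesign})
    (h : IsTensorOf C A B) :
    (Regular A ∧ Regular B) ↔ Regular C :=
  ⟨fun hr => fwd h hal hr.1 hr.2,
    fun hr => ⟨bwd h hal hB0 hr, bwd (tensor_comm h) (alien_symm hal) hA0 hr⟩⟩

end Ludics
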